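/- There exist constants 0 < c ≤ C < ∞ such that for all integers 0 ≤ ρ ≤ ν, c·(2^{ρ}/2^{ν}) ≤ P(J_2(ρ,ν)) ≤ C·(2^{ρ}/2^{ν}). -/

import Mathlib

/-!
Critical site percolation on the triangular lattice realized on `ℤ²`.
A configuration assigns to each site `true` (open) or `false` (closed),
and `P` is the product Bernoulli(1/2) measure, axiomatized by
`IsBernoulliHalf` below (finite cylinder events have product probability).
-/

open MeasureTheory
open scoped ENNReal

/-- Sites of the lattice: vertices of `ℤ²`. -/
abbrev Site : Type := ℤ × ℤ

/-- A percolation configuration: `true` = open, `false` = closed. -/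
abbrev Config : Type := Site → Bool

/-- Adjacency for the triangular lattice realized on `ℤ²`:
the neighbors of `(x,y)` are `(x±1,y)`, `(x,y±1)`, `(x+1,y-1)`, `(x-1,y+1)`. -/
def Adj (a b : Site) : Prop :=
  (b.1 - a.1, b.2 - a.2) ∈
    ({(1, 0), (-1, 0), (0, 1), (0, -1), (1, -1), (-1, 1)} : Set (ℤ × ℤ))

/-- A (nonempty, self-avoiding) lattice path: a list of distinct sites in which
consecutive sites are neighbors. -/
def IsPath (p : List Site) : Prop := p ≠ [] ∧ p.Nodup ∧ p.Chain' Adj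

/-- A path all of whose vertices lie in the set `S`. -/
def PathIn (S : Set Site) (p : List Site) : Prop := IsPath p ∧ ∀ v ∈ p, v ∈ S

/-- All sites of `p` are open in `ω`. -/
def IsOpenOn (ω : Config) (p : List Site) : Prop := ∀ v ∈ p, ω v = true

/-- All sites of `p` are closed in `ω`. -/
def IsClosedOn (ω : Config) (p : List Site) : Prop := ∀ v ∈ p, ω v = false

/-- The first vertex of `p` lies in `A`. -/
def FirstIn (A : Set Site) (p : List Site) : Prop := ∃ a ∈ A, p.head? = some a

/-- The last vertex of `p` lies in `A`. -/
def LastIn (A : Set Site) (p : List Site) : Prop := ∃ a ∈ A, p.getLast? = some a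

/-- `μ` is the product Bernoulli(1/2) measure on configurations: a probability
measure for which every finite cylinder event has the product probability. -/
def IsBernoulliHalf (μ : Measure Config) : Prop :=
  IsProbabilityMeasure μ ∧
    ∀ (S : Finset Site) (f : Site → Bool),
      μ {ω | ∀ v ∈ S, ω v = f v} = (1 / 2 : ℝ≥0∞) ^ S.card

/-- The lattice rectangle `[x₀,x₁] × [y₀,y₁]`. -/
def rect (x₀ x₁ y₀ y₁ : ℤ) : Set Site :=
  {v | x₀ ≤ v.1 ∧ v.1 ≤ x₁ ∧ y₀ ≤ v.2 ∧ v.2 ≤ y₁}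

/-- The left side of a rectangle. -/
def rectLeft (x₀ x₁ y₀ y₁ : ℤ) : Set Site := {v ∈ rect x₀ x₁ y₀ y₁ | v.1 = x₀}

/-- The right side of a rectangle. -/
def rectRight (x₀ x₁ y₀ y₁ : ℤ) : Set Site := {v ∈ rect x₀ x₁ y₀ y₁ | v.1 = x₁}

/-- The top side of a rectangle. -/
def rectTop (x₀ x₁ y₀ y₁ : ℤ) : Set Site := {v ∈ rect x₀ x₁ y₀ y₁ | v.2 = y₁}

/-- The bottom side of a rectangle. -/
def rectBot (x₀ x₁ y₀ y₁ : ℤ) : Set Site := {v ∈ rect x₀ x₁ y₀ y₁ | v.2 = y₀}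

/-- A horizontal open crossing of the rectangle `[x₀,x₁] × [y₀,y₁]`:
an open path in the rectangle from its left side to its right side. -/
def HorizCrossing (x₀ x₁ y₀ y₁ : ℤ) (ω : Config) (p : List Site) : Prop :=
  PathIn (rect x₀ x₁ y₀ y₁) p ∧ IsOpenOn ω p ∧
    FirstIn (rectLeft x₀ x₁ y₀ y₁) p ∧ LastIn (rectRight x₀ x₁ y₀ y₁) p

/-- The box with bottom edge centered at `(a,b)` and radius `r`:
`[a-r, a+r] × [b, b+2r]`. -/
def hBox (a b r : ℤ) : Set Site :=
  {v | a - r ≤ v.1 ∧ v.1 ≤ a + r ∧ b ≤ v.2 ∧ v.2 ≤ b + 2 * r}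

/-- `∂₊`: the union of the top and side edges of the box `hBox a b r`. -/
def hBoxPlus (a b r : ℤ) : Set Site :=
  {v ∈ hBox a b r | v.1 = a - r ∨ v.1 = a + r ∨ v.2 = b + 2 * r}

/-- Counterclockwise coordinate (as viewed from inside the box) along
`∂₊ (hBox a b r)`, starting at the bottom-right corner, going up the right
edge, leftward along the top edge, and down the left edge. -/
def ccw (a b r : ℤ) (v : Site) : ℤ :=
  if v.1 = a + r then v.2 - b
  else if v.2 = b + 2 * r then 2 * r + (a + r - v.1)
  else 4 * r + (b + 2 * r - v.2)

/-- An arm of the horseshoe `hBox a b r₂ \ hBox a b r₁`: a path starting on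
`∂₊B₁`, ending on `∂₊B₂`, and otherwise remaining in the horseshoe. -/
def HorseArm (a b r₁ r₂ : ℤ) (p : List Site) : Prop :=
  IsPath p ∧ FirstIn (hBoxPlus a b r₁) p ∧ LastIn (hBoxPlus a b r₂) p ∧
    ∀ v ∈ p.tail, v ∈ hBox a b r₂ \ hBox a b r₁

/-- `J₂(ρ,ν)` (for the horseshoe pair with bottom center `(a,b)` and radii
`r₁ ≤ r₂`): there exist a disjoint open arm and closed arm crossing the
horseshoe, the closed arm lying counterclockwise from the open arm as viewed
from the inner box. -/
def J2 (a b r₁ r₂ : ℤ) (ω : Config) : Prop :=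
  ∃ p q : List Site,
    HorseArm a b r₁ r₂ p ∧ IsOpenOn ω p ∧
    HorseArm a b r₁ r₂ q ∧ IsClosedOn ω q ∧
    List.Disjoint p q ∧
    (∀ u w, p.head? = some u → q.head? = some w → ccw a b r₁ u < ccw a b r₁ w) ∧
    (∀ u w, p.getLast? = some u → q.getLast? = some w → ccw a b r₂ u < ccw a b r₂ w)

/-- Adjacency of the triangulation of `ℤ²` whose unit squares in the column `[x, x+1]` carry the
diagonal of slope `1` if `d x` and the diagonal of slope `-1` otherwise. -/
def FAdj (d : ℤ → Bool) (a b : Site) : Prop :=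
  (a.2 = b.2 ∧ (b.1 = a.1 + 1 ∨ a.1 = b.1 + 1)) ∨
  (a.1 = b.1 ∧ (b.2 = a.2 + 1 ∨ a.2 = b.2 + 1)) ∨
  (b.1 = a.1 + 1 ∧ a.2 = b.2 + 1 ∧ d a.1 = false) ∨
  (a.1 = b.1 + 1 ∧ b.2 = a.2 + 1 ∧ d b.1 = false) ∨
  (b.1 = a.1 + 1 ∧ b.2 = a.2 + 1 ∧ d a.1 = true) ∨
  (a.1 = b.1 + 1 ∧ a.2 = b.2 + 1 ∧ d b.1 = true)

theorem FAdj.symm {d : ℤ → Bool} {a b : Site} (h : FAdj d a b) : FAdj d b a := by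
  unfold FAdj at *
  tauto

theorem adj_iff_fadj {a b : Site} : Adj a b ↔ FAdj (fun _ => false) a b := by
  obtain ⟨x, y⟩ := a
  obtain ⟨z, w⟩ := b
  simp only [Adj, FAdj, Set.mem_insert_iff, Set.mem_singleton_iff, Prod.mk.injEq]
  simp
  omega

theorem adj_eq_fadj : Adj = FAdj (fun _ => false) := by
  funext a b
  exact propext adj_iff_fadj

/-- `u` and `v` are joined by a walk inside `S`. -/
def Conn (adj : Site → Site → Prop) (S : Set Site) (u v : Site) : Prop :=
  u ∈ S ∧ Relation.ReflTransGen (fun a b => adj a b ∧ b ∈ S) u v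

section Conn

variable {adj : Site → Site → Prop} {S T X : Set Site} {u v w : Site}

theorem Conn.refl (h : u ∈ S) : Conn adj S u u := ⟨h, .refl⟩

theorem Conn.left_mem (h : Conn adj S u v) : u ∈ S := h.1

theorem Conn.right_mem (h : Conn adj S u v) : v ∈ S := by
  obtain ⟨hu, h⟩ := h
  cases h with
  | refl => exact hu
  | tail _ h => exact h.2

theorem Conn.trans (h : Conn adj S u v) (h' : Conn adj S v w) : Conn adj S u w :=
  ⟨h.1, h.2.trans h'.2⟩

theorem Conn.tail (h : Conn adj S u v) (a : adj v w) (hw : w ∈ S) : Conn adj S u w :=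
  ⟨h.1, h.2.tail ⟨a, hw⟩⟩

theorem Conn.of_adj (hu : u ∈ S) (a : adj u v) (hv : v ∈ S) : Conn adj S u v :=
  (Conn.refl hu).tail a hv

theorem Conn.head (hu : u ∈ S) (a : adj u v) (h : Conn adj S v w) : Conn adj S u w :=
  (Conn.of_adj hu a h.1).trans h

theorem Conn.mono (hST : S ⊆ T) (h : Conn adj S u v) : Conn adj T u v :=
  ⟨hST h.1, Relation.ReflTransGen.mono (fun _ _ h => ⟨h.1, hST h.2⟩) _ _ h.2⟩

theorem Conn.induction {P : Site → Prop} (h : Conn adj S u v) (h0 : P u)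
    (hs : ∀ a b, Conn adj S u a → P a → adj a b → b ∈ S → P b) : P v := by
  obtain ⟨hu, h⟩ := h
  induction h with
  | refl => exact h0
  | tail h1 h2 ih => exact hs _ _ ⟨hu, h1⟩ ih h2.1 h2.2

theorem Conn.symm (ha : ∀ a b, adj a b → adj b a) (h : Conn adj S u v) : Conn adj S v u := by
  refine h.induction (P := fun v => Conn adj S v u) (Conn.refl h.1) ?_
  intro a b _ h1 h2 h3
  exact Conn.head h3 (ha _ _ h2) h1

/-- The walk up to its first exit from `X`. -/
theorem Conn.first_exit (h : Conn adj S u v) (hu : u ∈ X) (hv : v ∉ X) :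
    ∃ s t, Conn adj (S ∩ X) u s ∧ adj s t ∧ t ∈ S ∧ t ∉ X := by
  have : (v ∈ X ∧ Conn adj (S ∩ X) u v) ∨
      ∃ s t, Conn adj (S ∩ X) u s ∧ adj s t ∧ t ∈ S ∧ t ∉ X := by
    refine h.induction (P := fun v => (v ∈ X ∧ Conn adj (S ∩ X) u v) ∨ _)
      (Or.inl ⟨hu, Conn.refl ⟨h.1, hu⟩⟩) ?_
    rintro a b - (⟨ha, hc⟩ | h1) hab hb
    · by_cases hbX : b ∈ X
      · exact Or.inl ⟨hbX, hc.tail hab ⟨hb, hbX⟩⟩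
      · exact Or.inr ⟨a, b, hc, hab, hb, hbX⟩
    · exact Or.inr h1
  tauto

/-- The walk after its last visit to `X`. -/
theorem Conn.last_exit (h : Conn adj S u v) (hu : u ∈ X) (hv : v ∉ X) :
    ∃ s t, Conn adj S u s ∧ s ∈ X ∧ adj s t ∧ t ∉ X ∧ Conn adj (S \ X) t v := by
  have : v ∈ X ∨ ∃ s t, Conn adj S u s ∧ s ∈ X ∧ adj s t ∧ t ∉ X ∧ Conn adj (S \ X) t v := by
    refine h.induction (P := fun v => v ∈ X ∨
      ∃ s t, Conn adj S u s ∧ s ∈ X ∧ adj s t ∧ t ∉ X ∧ Conn adj (S \ X) t v) (Or.inl hu) ?_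
    intro a b hc h1 hab hb
    by_cases hbX : b ∈ X
    · exact Or.inl hbX
    · rcases h1 with h1 | ⟨s, t, h1, h2, h3, h4, h5⟩
      · exact Or.inr ⟨a, b, hc, h1, hab, hbX, Conn.refl ⟨hb, hbX⟩⟩
      · exact Or.inr ⟨s, t, h1, h2, h3, h4, h5.tail hab ⟨hb, hbX⟩⟩
  exact this.resolve_left hv

theorem Conn.map {adj' : Site → Site → Prop} (φ : Site → Site)
    (ha : ∀ a b, a ∈ S → b ∈ S → adj a b → adj' (φ a) (φ b))
    (hS : ∀ a ∈ S, φ a ∈ T) (h : Conn adj S u v) : Conn adj' T (φ u) (φ v) := by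
  refine h.induction (P := fun v => Conn adj' T (φ u) (φ v)) (Conn.refl (hS _ h.1)) ?_
  intro a b hc h1 h2 h3
  exact h1.tail (ha _ _ hc.right_mem h3 h2) (hS _ h3)

end Conn

section Lists

variable {adj : Site → Site → Prop}

/-- A walk can be shortened to a list of distinct sites. -/
theorem Conn.exists_list {S : Set Site} {u v : Site} (h : Conn adj S u v) :
    ∃ p : List Site, p ≠ [] ∧ p.Nodup ∧ p.IsChain adj ∧ (∀ x ∈ p, x ∈ S) ∧
      p.head? = some u ∧ p.getLast? = some v := by
  refine h.induction (P := fun v => ∃ p : List Site, p ≠ [] ∧ p.Nodup ∧ p.IsChain adj ∧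
    (∀ x ∈ p, x ∈ S) ∧ p.head? = some u ∧ p.getLast? = some v)
    ⟨[u], by simp, by simp, by simp, by simpa using h.1, by simp, by simp⟩ ?_
  rintro a b - ⟨p, h1, h2, h3, h4, h5, h6⟩ hab hb
  by_cases hbp : b ∈ p
  · obtain ⟨s, t, rfl⟩ := List.append_of_mem hbp
    refine ⟨s ++ [b], by simp, ?_, ?_, ?_, ?_, by simp⟩
    · have : (s ++ [b] ++ t).Nodup := by simpa using h2
      exact this.of_append_left
    · have : (s ++ [b] ++ t).IsChain adj := by simpa using h3
      exact this.left_of_append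
    · intro x hx
      apply h4
      simp at hx ⊢
      tauto
    · cases s <;> simpa using h5
  · refine ⟨p ++ [b], by simp, ?_, ?_, ?_, ?_, by simp⟩
    · rw [List.nodup_append]
      refine ⟨h2, by simp, ?_⟩
      rintro x hx y hy rfl
      simp at hy
      exact hbp (hy ▸ hx)
    · rw [List.isChain_append]
      refine ⟨h3, by simp, ?_⟩
      intro x hx y hy
      simp [h6] at hx
      simp at hy
      rw [← hx, ← hy]
      exact hab
    · intro x hx
      simp at hx
      rcases hx with hx | rfl
      · exact h4 _ hx
      · exact hb
    · rw [List.head?_append, h5]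
      rfl

theorem conn_of_chain {p : List Site} {S : Set Site} {u v : Site} (hc : p.IsChain adj)
    (hS : ∀ x ∈ p, x ∈ S) (hu : p.head? = some u) (hv : p.getLast? = some v) :
    Conn adj S u v := by
  induction p generalizing u with
  | nil => simp at hu
  | cons x l ih =>
    simp at hu
    subst hu
    cases l with
    | nil =>
      simp at hv
      subst hv
      exact Conn.refl (hS _ (by simp))
    | cons y l =>
      rw [List.isChain_cons_cons] at hc
      refine Conn.head (hS _ (by simp)) hc.1 (ih hc.2 (fun x hx => hS x (by simp at hx ⊢; tauto))
        (by simp) ?_)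
      rw [List.getLast?_cons_cons] at hv
      exact hv

end Lists

theorem conn_hseg {d : ℤ → Bool} {S : Set Site} {x x' y : ℤ} (h : x ≤ x')
    (hS : ∀ z, x ≤ z → z ≤ x' → (z, y) ∈ S) : Conn (FAdj d) S (x, y) (x', y) := by
  obtain ⟨n, rfl⟩ := Int.le.dest h
  induction n with
  | zero => simpa using Conn.refl (hS x le_rfl (by simp))
  | succ n ih =>
    refine (ih (by omega) fun z h1 h2 => hS z h1 (by push_cast; omega)).tail ?_
      (hS _ (by push_cast; omega) le_rfl)
    left
    simp
    left
    omega

theorem conn_vseg {d : ℤ → Bool} {S : Set Site} {x y y' : ℤ} (h : y ≤ y')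
    (hS : ∀ z, y ≤ z → z ≤ y' → (x, z) ∈ S) : Conn (FAdj d) S (x, y) (x, y') := by
  obtain ⟨n, rfl⟩ := Int.le.dest h
  induction n with
  | zero => simpa using Conn.refl (hS y le_rfl (by simp))
  | succ n ih =>
    refine (ih (by omega) fun z h1 h2 => hS z h1 (by push_cast; omega)).tail ?_
      (hS _ (by push_cast; omega) le_rfl)
    right; left
    simp
    left
    omega

theorem Conn.fsymm {d : ℤ → Bool} {S : Set Site} {u v : Site} (h : Conn (FAdj d) S u v) :
    Conn (FAdj d) S v u := h.symm fun _ _ h => h.symm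

/-- Signed crossing of the step `s → t` with the ray issuing from `v` to the right, pushed
slightly below the row of `v`. -/
def crossNum (v s t : Site) : ℤ :=
  (if s.2 = v.2 ∧ t.2 = v.2 - 1 ∧ v.1 < s.1 then 1 else 0) -
  (if t.2 = v.2 ∧ s.2 = v.2 - 1 ∧ v.1 < t.1 then 1 else 0)

/-- Indicator of `s` lying on the row of `v`, strictly to its right. -/
def rightOf (v s : Site) : ℤ := if s.2 = v.2 ∧ v.1 < s.1 then 1 else 0

theorem crossNum_horizontal {v v' s t : Site} (h2 : v'.2 = v.2) (h1 : v'.1 = v.1 + 1)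
    (hs' : s ≠ v') (ht' : t ≠ v') :
    crossNum v s t = crossNum v' s t := by
  obtain ⟨v1, v2⟩ := v
  obtain ⟨w1, w2⟩ := v'
  obtain ⟨s1, s2⟩ := s
  obtain ⟨t1, t2⟩ := t
  simp only [crossNum, ne_eq, Prod.mk.injEq] at *
  split_ifs <;> omega

theorem fadj_order {d : ℤ → Bool} {v v' s t : Site} (ha : FAdj d v v') (hst : FAdj d s t)
    (h1 : s.2 = v.2) (h2 : t.2 = v'.2) (h3 : v'.2 = v.2 - 1) (hs : s ≠ v) (ht : t ≠ v') :
    v.1 < s.1 ↔ v'.1 < t.1 := by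
  obtain ⟨v1, v2⟩ := v
  obtain ⟨w1, w2⟩ := v'
  obtain ⟨s1, s2⟩ := s
  obtain ⟨t1, t2⟩ := t
  simp only [FAdj, ne_eq, Prod.mk.injEq] at *
  by_cases e1 : s1 = v1
  · omega
  by_cases e2 : t1 = w1
  · omega
  by_cases e3 : s1 = w1
  · subst e3
    by_cases e4 : t1 = v1
    · subst e4
      cases h4 : d s1 <;> cases h5 : d t1 <;> simp [h4, h5] at ha hst <;> omega
    · omega
  · omega

theorem crossNum_vertical {d : ℤ → Bool} {v v' s t : Site} (ha : FAdj d v v') (hst : FAdj d s t)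
    (h3 : v'.2 = v.2 - 1) (hs : s ≠ v) (ht : t ≠ v) (hs' : s ≠ v') (ht' : t ≠ v') :
    crossNum v s t - crossNum v' s t = rightOf v' t - rightOf v' s := by
  have k1 := fun h1 h2 => fadj_order ha hst h1 h2 h3 hs ht'
  have k2 := fun h1 h2 => fadj_order ha hst.symm h1 h2 h3 ht hs'
  have k3 : s.2 = t.2 ∨ s.2 = t.2 + 1 ∨ t.2 = s.2 + 1 := by
    unfold FAdj at hst
    omega
  have k4 : s.2 = v'.2 → t.2 = v'.2 → (v'.1 < s.1 ↔ v'.1 < t.1) := by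
    rw [ne_eq, Prod.ext_iff] at hs' ht'
    unfold FAdj at hst
    omega
  by_cases e1 : s.2 = v.2 ∧ t.2 = v'.2
  · have k1 := k1 e1.1 e1.2
    simp only [crossNum, rightOf]
    split_ifs <;> omega
  by_cases e2 : t.2 = v.2 ∧ s.2 = v'.2
  · have k2 := k2 e2.1 e2.2
    simp only [crossNum, rightOf]
    split_ifs <;> omega
  simp only [crossNum, rightOf]
  split_ifs <;> omega

theorem exists_windingNum {d : ℤ → Bool} {A : Set Site} {y₀ : ℤ} (hA : ∀ v ∈ A, y₀ ≤ v.2)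
    {a c : Site} (h : Conn (FAdj d) A a c) :
    ∃ N : Site → ℤ, (∀ v, v.2 ≤ y₀ → N v = 0) ∧
      (∀ v v', v' ∉ A → v'.2 = v.2 → v'.1 = v.1 + 1 → N v = N v') ∧
      (∀ v v', v ∉ A → v' ∉ A → FAdj d v v' → v'.2 = v.2 - 1 →
        N v - N v' = rightOf v' c - rightOf v' a) := by
  refine h.induction (P := fun c => ∃ N : Site → ℤ, (∀ v, v.2 ≤ y₀ → N v = 0) ∧
      (∀ v v', v' ∉ A → v'.2 = v.2 → v'.1 = v.1 + 1 → N v = N v') ∧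
      (∀ v v', v ∉ A → v' ∉ A → FAdj d v v' → v'.2 = v.2 - 1 →
        N v - N v' = rightOf v' c - rightOf v' a)) ⟨fun _ => 0, by simp⟩ ?_
  rintro s t hs ⟨N, h1, h2, h3⟩ hst ht
  have hs := hs.right_mem
  have hys := hA _ hs
  have hyt := hA _ ht
  refine ⟨fun v => N v + crossNum v s t, ?_, ?_, ?_⟩
  · intro v hv
    simp only [h1 v hv, crossNum]
    split_ifs <;> omega
  · intro v v' hv' e1 e2
    simp only
    rw [h2 v v' hv' e1 e2, crossNum_horizontal e1 e2]
    · rintro rfl; exact hv' hs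
    · rintro rfl; exact hv' ht
  · intro v v' hv hv' e1 e2
    have k1 := h3 v v' hv hv' e1 e2
    have k2 := crossNum_vertical e1 hst e2 (s := s) (t := t) (by rintro rfl; exact hv hs)
      (by rintro rfl; exact hv ht) (by rintro rfl; exact hv' hs) (by rintro rfl; exact hv' ht)
    simp only
    omega

/-- Two disjoint connected sets in a half-plane cannot join interlaced boundary points. -/
theorem halfPlane_crossing {d : ℤ → Bool} {A B : Set Site} {y₀ : ℤ} (hA : ∀ v ∈ A, y₀ ≤ v.2)
    (hB : ∀ v ∈ B, y₀ ≤ v.2) (hAB : Disjoint A B) {a b c e : Site}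
    (hac : Conn (FAdj d) A a c) (hbe : Conn (FAdj d) B b e)
    (ha : a.2 = y₀) (hb : b.2 = y₀) (hc : c.2 = y₀) (he : e.2 = y₀)
    (hab : a.1 < b.1) (hbc : b.1 < c.1) (hce : c.1 < e.1) : False := by
  obtain ⟨N, h1, h2, h3⟩ := exists_windingNum hA hac
  have hBA : ∀ v ∈ B, v ∉ A := fun v hv hv' => Set.disjoint_left.1 hAB hv' hv
  set J : Site → ℤ := fun v => N v + if v.2 = y₀ then rightOf v c - rightOf v a else 0 with hJ
  have hne : ∀ v ∈ B, v ≠ a ∧ v ≠ c := fun v hv =>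
    ⟨by rintro rfl; exact hBA _ hv hac.left_mem, by rintro rfl; exact hBA _ hv hac.right_mem⟩
  have hor : ∀ v v', v ∈ B → v' ∈ B → v'.2 = v.2 → v'.1 = v.1 + 1 → J v = J v' := by
    intro v v' hv hv' e1 e2
    have k1 := h2 v v' (hBA _ hv') e1 e2
    obtain ⟨n1, n2⟩ := hne v hv
    obtain ⟨n3, n4⟩ := hne v' hv'
    simp only [hJ, rightOf, ne_eq, Prod.ext_iff] at *
    split_ifs <;> omega
  have ver : ∀ v v', v ∈ B → v' ∈ B → FAdj d v v' → v'.2 = v.2 - 1 → J v = J v' := by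
    intro v v' hv hv' e1 e2
    have k1 := h3 v v' (hBA _ hv) (hBA _ hv') e1 e2
    have k2 := h1 v'
    have k3 := hB _ hv'
    simp only [hJ, rightOf] at *
    split_ifs at * <;> omega
  have step : ∀ v v', v ∈ B → v' ∈ B → FAdj d v v' → J v = J v' := by
    intro v v' hv hv' e1
    have e2 := e1
    unfold FAdj at e2
    rcases lt_trichotomy v.2 v'.2 with h | h | h
    · exact (ver v' v hv' hv e1.symm (by omega)).symm
    · rcases lt_trichotomy v.1 v'.1 with h' | h' | h'
      · exact hor v v' hv hv' h.symm (by omega)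
      · omega
      · exact (hor v' v hv' hv h (by omega)).symm
    · exact ver v v' hv hv' e1 (by omega)
  have hJe : J b = J e := by
    refine hbe.induction (P := fun e => J b = J e) rfl ?_
    intro s t hs hJs hst ht
    rw [hJs, step s t hs.right_mem ht hst]
  have k1 := h1 b hb.le
  have k2 := h1 e he.le
  have k3 : rightOf b c = 1 := if_pos ⟨by omega, hbc⟩
  have k4 : rightOf b a = 0 := if_neg (by omega)
  have k5 : rightOf e c = 0 := if_neg (by omega)
  have k6 : rightOf e a = 0 := if_neg (by omega)
  simp [hJ, hb, he, k1, k2, k3, k4, k5, k6] at hJe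

/-- `v` is a boundary site of the rectangle with counterclockwise position `p`, where the positions
along the bottom are the abscissae. -/
def BdPos (x₀ x₁ y₀ y₁ : ℤ) (v : Site) (p : ℤ) : Prop :=
  v ∈ rect x₀ x₁ y₀ y₁ ∧
    ((v.2 = y₀ ∧ p = v.1) ∨ (v.1 = x₁ ∧ p = x₁ + 1 + (v.2 - y₀)) ∨
      (v.2 = y₁ ∧ p = x₁ + 1 + (y₁ - y₀) + (x₁ - v.1)) ∨
      (v.1 = x₀ ∧ p = x₁ + 1 + (y₁ - y₀) + (x₁ - x₀) + (y₁ - v.2)))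

/-- A clockwise spiral outside the rectangle, from the boundary site `v` to the site `(p, y₀)`. -/
def spiral (x₀ x₁ y₀ y₁ : ℤ) (v : Site) (p : ℤ) : Set Site :=
  {z | z = v ∨
    (v.1 = x₁ ∧ p = x₁ + 1 + (v.2 - y₀) ∧
      ((z.2 = v.2 ∧ x₁ < z.1 ∧ z.1 ≤ p) ∨ (z.1 = p ∧ y₀ ≤ z.2 ∧ z.2 ≤ v.2))) ∨
    (v.2 = y₁ ∧ p = x₁ + 1 + (y₁ - y₀) + (x₁ - v.1) ∧
      ((z.1 = v.1 ∧ y₁ < z.2 ∧ z.2 ≤ y₁ + (p - x₁)) ∨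
        (z.2 = y₁ + (p - x₁) ∧ v.1 ≤ z.1 ∧ z.1 ≤ p) ∨
        (z.1 = p ∧ y₀ ≤ z.2 ∧ z.2 ≤ y₁ + (p - x₁)))) ∨
    (v.1 = x₀ ∧ p = x₁ + 1 + (y₁ - y₀) + (x₁ - x₀) + (y₁ - v.2) ∧
      ((z.2 = v.2 ∧ x₀ - (p - x₁) ≤ z.1 ∧ z.1 < x₀) ∨
        (z.1 = x₀ - (p - x₁) ∧ v.2 ≤ z.2 ∧ z.2 ≤ y₁ + (p - x₁)) ∨
        (z.2 = y₁ + (p - x₁) ∧ x₀ - (p - x₁) ≤ z.1 ∧ z.1 ≤ p) ∨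
        (z.1 = p ∧ y₀ ≤ z.2 ∧ z.2 ≤ y₁ + (p - x₁))))}

section Rect

variable {d : ℤ → Bool} {x₀ x₁ y₀ y₁ : ℤ}

theorem spiral_ge {v z : Site} {p : ℤ} (h : BdPos x₀ x₁ y₀ y₁ v p)
    (hz : z ∈ spiral x₀ x₁ y₀ y₁ v p) : y₀ ≤ z.2 := by
  obtain ⟨z1, z2⟩ := z
  obtain ⟨v1, v2⟩ := v
  simp only [BdPos, spiral, rect, Set.mem_ofPred_eq, Prod.mk.injEq] at *
  omega

theorem spiral_inter {v z : Site} {p : ℤ} (h : BdPos x₀ x₁ y₀ y₁ v p)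
    (hz : z ∈ spiral x₀ x₁ y₀ y₁ v p) (hr : z ∈ rect x₀ x₁ y₀ y₁) : z = v := by
  obtain ⟨z1, z2⟩ := z
  obtain ⟨v1, v2⟩ := v
  simp only [BdPos, spiral, rect, Set.mem_ofPred_eq, Prod.mk.injEq] at *
  omega

theorem spiral_disjoint {v v' z : Site} {p p' : ℤ} (h : BdPos x₀ x₁ y₀ y₁ v p)
    (h' : BdPos x₀ x₁ y₀ y₁ v' p') (hv : v ≠ v') (hp : p < p')
    (hz : z ∈ spiral x₀ x₁ y₀ y₁ v p) (hz' : z ∈ spiral x₀ x₁ y₀ y₁ v' p') : False := by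
  by_cases e : z ∈ rect x₀ x₁ y₀ y₁
  · exact hv ((spiral_inter h hz e).symm.trans (spiral_inter h' hz' e))
  obtain ⟨z1, z2⟩ := z
  obtain ⟨v1, v2⟩ := v
  obtain ⟨w1, w2⟩ := v'
  simp only [BdPos, spiral, rect, Set.mem_ofPred_eq, Prod.mk.injEq, ne_eq] at *
  obtain ⟨h, -⟩ := h
  obtain ⟨h', -⟩ := h'
  rcases hz with hz | ⟨e1, e2, hz⟩ | ⟨e1, e2, hz⟩ | ⟨e1, e2, hz⟩ <;>
  rcases hz' with hz' | ⟨e1', e2', hz'⟩ | ⟨e1', e2', hz'⟩ | ⟨e1', e2', hz'⟩ <;> omega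

theorem conn_spiral {v : Site} {p : ℤ} (h : BdPos x₀ x₁ y₀ y₁ v p) :
    Conn (FAdj d) (spiral x₀ x₁ y₀ y₁ v p) v (p, y₀) := by
  obtain ⟨v1, v2⟩ := v
  obtain ⟨h1, h⟩ := h
  simp only [rect, Set.mem_ofPred_eq] at h h1
  rcases h with ⟨rfl, rfl⟩ | ⟨rfl, rfl⟩ | ⟨rfl, rfl⟩ | ⟨rfl, rfl⟩
  · exact Conn.refl (by simp [spiral])
  · refine Conn.trans (conn_hseg (x' := v1 + 1 + (v2 - y₀)) (by omega) ?_) (Conn.fsymm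
      (conn_vseg (by omega) ?_)) <;>
    · intro z e1 e2
      simp only [spiral, Set.mem_ofPred_eq, Prod.mk.injEq, true_and, and_true]
      omega
  · set p := x₁ + 1 + (v2 - y₀) + (x₁ - v1) with hp
    refine Conn.trans (conn_vseg (y' := v2 + (p - x₁)) (by omega) ?_) (Conn.trans
      (conn_hseg (x' := p) (by omega) ?_) (Conn.fsymm (conn_vseg (by omega) ?_))) <;>
    · intro z e1 e2
      simp only [spiral, Set.mem_ofPred_eq, Prod.mk.injEq, true_and]
      omega
  · set p := x₁ + 1 + (y₁ - y₀) + (x₁ - v1) + (y₁ - v2) with hp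
    refine Conn.trans (Conn.fsymm (conn_hseg (x := v1 - (p - x₁)) (by omega) ?_)) (Conn.trans
      (conn_vseg (y' := y₁ + (p - x₁)) (by omega) ?_) (Conn.trans
      (conn_hseg (x' := p) (by omega) ?_) (Conn.fsymm (conn_vseg (by omega) ?_)))) <;>
    · intro z e1 e2
      simp only [spiral, Set.mem_ofPred_eq, Prod.mk.injEq, true_and, and_true]
      omega

/-- Two disjoint connected subsets of a rectangle cannot join interlaced boundary sites. -/
theorem rect_crossing {A B : Set Site} (hA : A ⊆ rect x₀ x₁ y₀ y₁) (hB : B ⊆ rect x₀ x₁ y₀ y₁)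
    (hAB : Disjoint A B) {a b c e : Site} {pa pb pc pe : ℤ}
    (hac : Conn (FAdj d) A a c) (hbe : Conn (FAdj d) B b e)
    (ha : BdPos x₀ x₁ y₀ y₁ a pa) (hb : BdPos x₀ x₁ y₀ y₁ b pb)
    (hc : BdPos x₀ x₁ y₀ y₁ c pc) (he : BdPos x₀ x₁ y₀ y₁ e pe)
    (hab : pa < pb) (hbc : pb < pc) (hce : pc < pe) : False := by
  have hd : ∀ {u v}, u ∈ A → v ∈ B → u ≠ v := by
    rintro u v hu hv rfl
    exact Set.disjoint_left.1 hAB hu hv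
  set S := spiral x₀ x₁ y₀ y₁
  have hac' : Conn (FAdj d) (A ∪ (S a pa ∪ S c pc)) (pa, y₀) (pc, y₀) :=
    ((conn_spiral ha).fsymm.mono fun z hz => Or.inr (Or.inl hz)).trans
      ((hac.mono fun z hz => Or.inl hz).trans
        ((conn_spiral hc).mono fun z hz => Or.inr (Or.inr hz)))
  have hbe' : Conn (FAdj d) (B ∪ (S b pb ∪ S e pe)) (pb, y₀) (pe, y₀) :=
    ((conn_spiral hb).fsymm.mono fun z hz => Or.inr (Or.inl hz)).trans
      ((hbe.mono fun z hz => Or.inl hz).trans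
        ((conn_spiral he).mono fun z hz => Or.inr (Or.inr hz)))
  refine halfPlane_crossing (y₀ := y₀) ?_ ?_ ?_ hac' hbe' rfl rfl rfl rfl hab hbc hce
  · rintro v (hv | hv | hv)
    · exact (hA hv).2.2.1
    · exact spiral_ge ha hv
    · exact spiral_ge hc hv
  · rintro v (hv | hv | hv)
    · exact (hB hv).2.2.1
    · exact spiral_ge hb hv
    · exact spiral_ge he hv
  · have ma := hac.left_mem
    have mc := hac.right_mem
    have mb := hbe.left_mem
    have me := hbe.right_mem
    rw [Set.disjoint_left]
    rintro z (hz | hz | hz) (hz' | hz' | hz')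
    · exact hd hz hz' rfl
    · exact hd hz mb (spiral_inter hb hz' (hA hz))
    · exact hd hz me (spiral_inter he hz' (hA hz))
    · exact hd ma hz' (spiral_inter ha hz (hB hz')).symm
    · exact spiral_disjoint ha hb (hd ma mb) hab hz hz'
    · exact spiral_disjoint ha he (hd ma me) (by omega) hz hz'
    · exact hd mc hz' (spiral_inter hc hz (hB hz')).symm
    · exact spiral_disjoint hb hc (hd mc mb).symm hbc hz' hz
    · exact spiral_disjoint hc he (hd mc me) hce hz hz'

/-- Signed indicator of the step `u → v` going from `B` to `A`. -/
noncomputable def flux (A B : Set Site) (u v : Site) : ℤ :=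
  open Classical in (if u ∈ B ∧ v ∈ A then 1 else 0) - (if u ∈ A ∧ v ∈ B then 1 else 0)

/-- `A` and `B` are unions of open, resp. closed, clusters of the colouring `κ` of `R`. -/
structure Clusters (adj : Site → Site → Prop) (R : Set Site) (κ : Site → Prop) (A B : Set Site) :
    Prop where
  colorA : ∀ u ∈ A, κ u
  colorB : ∀ u ∈ B, ¬ κ u
  stepA : ∀ u ∈ A, ∀ v ∈ R, adj u v → κ v → v ∈ A
  stepB : ∀ u ∈ B, ∀ v ∈ R, adj u v → ¬ κ v → v ∈ B

theorem flux_triangle {R A B : Set Site} {κ : Site → Prop} (h : Clusters (FAdj d) R κ A B)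
    {u v w : Site} (hu : u ∈ R) (hv : v ∈ R) (hw : w ∈ R)
    (huv : FAdj d u v) (hvw : FAdj d v w) (huw : FAdj d u w) :
    flux A B u v + flux A B v w = flux A B u w := by
  classical
  have a1 := h.colorA u
  have a2 := h.colorA v
  have a3 := h.colorA w
  have b1 := h.colorB u
  have b2 := h.colorB v
  have b3 := h.colorB w
  have s1 := fun m => h.stepA u m v hv huv
  have s2 := fun m => h.stepA u m w hw huw
  have s3 := fun m => h.stepA v m w hw hvw
  have s4 := fun m => h.stepA v m u hu huv.symm
  have s5 := fun m => h.stepA w m u hu huw.symm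
  have s6 := fun m => h.stepA w m v hv hvw.symm
  have t1 := fun m => h.stepB u m v hv huv
  have t2 := fun m => h.stepB u m w hw huw
  have t3 := fun m => h.stepB v m w hw hvw
  have t4 := fun m => h.stepB v m u hu huv.symm
  have t5 := fun m => h.stepB w m u hu huw.symm
  have t6 := fun m => h.stepB w m v hv hvw.symm
  unfold flux
  by_cases c1 : κ u <;> by_cases c2 : κ v <;> by_cases c3 : κ w <;>
    grind

theorem flux_square {R A B : Set Site} {κ : Site → Prop} (h : Clusters (FAdj d) R κ A B) {x y : ℤ}
    (h1 : (x, y) ∈ R) (h2 : (x + 1, y) ∈ R) (h3 : (x, y + 1) ∈ R) (h4 : (x + 1, y + 1) ∈ R) :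
    flux A B (x, y) (x + 1, y) + flux A B (x + 1, y) (x + 1, y + 1) =
      flux A B (x, y) (x, y + 1) + flux A B (x, y + 1) (x + 1, y + 1) := by
  have e1 : FAdj d (x, y) (x + 1, y) := by unfold FAdj; simp
  have e2 : FAdj d (x + 1, y) (x + 1, y + 1) := by unfold FAdj; simp
  have e3 : FAdj d (x, y) (x, y + 1) := by unfold FAdj; simp
  have e4 : FAdj d (x, y + 1) (x + 1, y + 1) := by unfold FAdj; simp
  cases hd : d x
  · have e5 : FAdj d (x + 1, y) (x, y + 1) := by unfold FAdj; simp [hd]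
    have k1 := flux_triangle h h1 h2 h3 e1 e5 e3
    have k2 := flux_triangle h h2 h3 h4 e5 e4 e2
    omega
  · have e5 : FAdj d (x, y) (x + 1, y + 1) := by unfold FAdj; simp [hd]
    have k1 := flux_triangle h h1 h2 h4 e1 e2 e5
    have k2 := flux_triangle h h1 h3 h4 e3 e4 e5
    omega

/-- Discrete Stokes formula on a rectangle. -/
theorem flux_rect {R A B : Set Site} {κ : Site → Prop} (h : Clusters (FAdj d) R κ A B) (x y : ℤ)
    (m n : ℕ) (hR : rect x (x + m) y (y + n) ⊆ R) :
    ∑ i ∈ Finset.range m, flux A B (x + i, y) (x + i + 1, y) +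
      ∑ j ∈ Finset.range n, flux A B (x + m, y + j) (x + m, y + j + 1) =
    ∑ j ∈ Finset.range n, flux A B (x, y + j) (x, y + j + 1) +
      ∑ i ∈ Finset.range m, flux A B (x + i, y + n) (x + i + 1, y + n) := by
  have hs : ∀ i < m, ∀ j < n,
      flux A B (x + i, y + j) (x + i + 1, y + j) +
        flux A B (x + i + 1, y + j) (x + i + 1, y + j + 1) =
      flux A B (x + i, y + j) (x + i, y + j + 1) +
        flux A B (x + i, y + j + 1) (x + i + 1, y + j + 1) := by
    intro i hi j hj
    apply flux_square h <;> apply hR <;> simp only [rect, Set.mem_ofPred_eq] <;> omega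
  clear hR
  induction n with
  | zero => simp
  | succ n ih =>
    have k1 := ih fun i hi j hj => hs i hi j (by omega)
    have k2 : ∀ m' ≤ m, ∑ i ∈ Finset.range m', flux A B (x + i, y + n) (x + i + 1, y + n) +
        flux A B (x + m', y + n) (x + m', y + n + 1) = flux A B (x, y + n) (x, y + n + 1) +
        ∑ i ∈ Finset.range m', flux A B (x + i, y + n + 1) (x + i + 1, y + n + 1) := by
      intro m'
      induction m' with
      | zero => simp
      | succ m' ih' =>
        intro hm
        have := hs m' (by omega) n (by omega)
        have := ih' (by omega)
        rw [Finset.sum_range_succ, Finset.sum_range_succ]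
        push_cast
        rw [← add_assoc]
        omega
    have k3 := k2 m le_rfl
    rw [Finset.sum_range_succ, Finset.sum_range_succ]
    push_cast
    rw [← add_assoc y]
    omega

/-- The set of sites joined to `A₀` by a walk of colour `κ` inside `R`. -/
def clusterOf (adj : Site → Site → Prop) (R : Set Site) (κ : Site → Prop) (A₀ : Set Site) :
    Set Site := {v | ∃ a ∈ A₀, Conn adj {v | v ∈ R ∧ κ v} a v}

theorem clusters_clusterOf (adj : Site → Site → Prop) (R : Set Site) (κ : Site → Prop)
    (A₀ B₀ : Set Site) :
    Clusters adj R κ (clusterOf adj R κ A₀) (clusterOf adj R (fun v => ¬ κ v) B₀) where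
  colorA := fun _ ⟨_, _, h⟩ => h.right_mem.2
  colorB := fun _ ⟨_, _, h⟩ => h.right_mem.2
  stepA := fun _ ⟨a, ha, h⟩ _ hv huv hk => ⟨a, ha, h.tail huv ⟨hv, hk⟩⟩
  stepB := fun _ ⟨a, ha, h⟩ _ hv huv hk => ⟨a, ha, h.tail huv ⟨hv, hk⟩⟩

end Rect

section Flux

variable {d : ℤ → Bool} {A B : Set Site}

theorem flux_eq_zero_of_notMem_left {u v : Site} (hu : u ∉ A) (hv : v ∉ A) : flux A B u v = 0 := by
  simp [flux, hu, hv]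

theorem flux_eq_zero_of_notMem_right {u v : Site} (hu : u ∉ B) (hv : v ∉ B) : flux A B u v = 0 := by
  simp [flux, hu, hv]

theorem FAdj.abs_le {u v : Site} (h : FAdj d u v) :
    u.1 ≤ v.1 + 1 ∧ v.1 ≤ u.1 + 1 ∧ u.2 ≤ v.2 + 1 ∧ v.2 ≤ u.2 + 1 := by
  unfold FAdj at h
  omega

/-- The Hex lemma: a coloured rectangle has an open horizontal or a closed vertical crossing. -/
theorem hex (d : ℤ → Bool) (κ : Site → Prop) {x₀ x₁ y₀ y₁ : ℤ} (hx : x₀ ≤ x₁) (hy : y₀ ≤ y₁) :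
    (∃ u v, u.1 = x₀ ∧ v.1 = x₁ ∧ Conn (FAdj d) {z | z ∈ rect x₀ x₁ y₀ y₁ ∧ κ z} u v) ∨
    (∃ u v, u.2 = y₀ ∧ v.2 = y₁ ∧ Conn (FAdj d) {z | z ∈ rect x₀ x₁ y₀ y₁ ∧ ¬ κ z} u v) := by
  obtain ⟨m, hm⟩ := Int.le.dest hx
  obtain ⟨n, hn⟩ := Int.le.dest hy
  set R : Set Site := rect (x₀ - 1) x₁ (y₀ - 1) y₁ with hR
  set κ' : Site → Prop := fun z => y₀ ≤ z.2 ∧ (z.1 < x₀ ∨ κ z) with hκ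
  set A₀ : Set Site := {z | z ∈ R ∧ z.1 < x₀ ∧ y₀ ≤ z.2} with hA₀
  set B₀ : Set Site := {z | z ∈ R ∧ z.2 < y₀} with hB₀
  have hc := clusters_clusterOf (FAdj d) R κ' A₀ B₀
  set A := clusterOf (FAdj d) R κ' A₀ with hA
  set B := clusterOf (FAdj d) R (fun v => ¬ κ' v) B₀ with hB
  have hAm : ∀ z ∈ A₀, z ∈ A := fun z hz => ⟨z, hz, Conn.refl ⟨hz.1, hz.2.2, Or.inl hz.2.1⟩⟩
  have hBm : ∀ z ∈ B₀, z ∈ B := fun z hz => ⟨z, hz, Conn.refl ⟨hz.1, fun h => by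
    have := hz.2; have := h.1; omega⟩⟩
  have st := flux_rect hc (x₀ - 1) (y₀ - 1) (m + 1) (n + 1) (by
    intro z hz
    simp only [hR, rect, Set.mem_ofPred_eq] at *
    push_cast at hz
    omega)
  have s1 : ∑ i ∈ Finset.range (m + 1), flux A B (x₀ - 1 + i, y₀ - 1) (x₀ - 1 + i + 1, y₀ - 1) = 0 := by
    refine Finset.sum_eq_zero fun i _ => flux_eq_zero_of_notMem_left ?_ ?_ <;>
    · intro h
      have := (hc.colorA _ h).1
      simp at this
  have s2 : ∑ j ∈ Finset.range (n + 1),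
      flux A B (x₀ - 1, y₀ - 1 + j) (x₀ - 1, y₀ - 1 + j + 1) = 1 := by
    rw [Finset.sum_range_succ', Finset.sum_eq_zero]
    · have b1 : ((x₀ - 1, y₀ - 1) : Site) ∈ B := hBm _ ⟨by
        simp only [hR, rect, Set.mem_ofPred_eq]; omega, by simp⟩
      have a1 : ((x₀ - 1, y₀) : Site) ∈ A := hAm _ ⟨by
        simp only [hR, rect, Set.mem_ofPred_eq]; omega, by simp, by simp⟩
      have a2 : ((x₀ - 1, y₀ - 1) : Site) ∉ A := fun h => hc.colorB _ b1 (hc.colorA _ h)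
      simp [flux, b1, a1, a2]
    · intro j _
      apply flux_eq_zero_of_notMem_right <;>
      · intro h
        apply hc.colorB _ h
        constructor
        · push_cast
          omega
        · left; simp
  by_contra hcon
  push Not at hcon
  obtain ⟨h1, h2⟩ := hcon
  have s3 : ∑ j ∈ Finset.range (n + 1), flux A B (x₀ - 1 + (m + 1 : ℕ), y₀ - 1 + j)
      (x₀ - 1 + (m + 1 : ℕ), y₀ - 1 + j + 1) = 0 := by
    have key : ∀ y, ((x₀ - 1 + (m + 1 : ℕ), y) : Site) ∉ A := by
      rintro y ⟨a, ha, hav⟩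
      obtain ⟨s, t, -, hs, hst, ht, htv⟩ := hav.last_exit (X := {z | z.1 < x₀}) ha.2.1 (by
        simp only [Set.mem_ofPred_eq]; push_cast; omega)
      have ht1 := htv.left_mem
      have := hst.abs_le
      simp only [Set.mem_ofPred_eq] at hs ht
      refine h1 t _ (by omega) ?_ (htv.mono ?_)
      · push_cast
        omega
      · rintro z ⟨⟨z1, z2, z3⟩, z4⟩
        simp only [hR, rect, Set.mem_ofPred_eq] at z1 z4 ⊢
        refine ⟨by omega, by tauto⟩
    exact Finset.sum_eq_zero fun j _ => flux_eq_zero_of_notMem_left (key _) (key _)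
  have s4 : ∑ i ∈ Finset.range (m + 1), flux A B (x₀ - 1 + i, y₀ - 1 + (n + 1 : ℕ))
      (x₀ - 1 + i + 1, y₀ - 1 + (n + 1 : ℕ)) = 0 := by
    have key : ∀ x, ((x, y₀ - 1 + (n + 1 : ℕ)) : Site) ∉ B := by
      rintro x ⟨b, hb, hbv⟩
      obtain ⟨s, t, -, hs, hst, ht, htv⟩ := hbv.last_exit (X := {z | z.2 < y₀}) hb.2 (by
        simp only [Set.mem_ofPred_eq]; push_cast; omega)
      have ht1 := htv.left_mem
      have := hst.abs_le
      simp only [Set.mem_ofPred_eq] at hs ht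
      refine h2 t _ (by omega) ?_ (htv.mono ?_)
      · push_cast
        omega
      · rintro z ⟨⟨z1, z2⟩, z4⟩
        simp only [hR, rect, Set.mem_ofPred_eq, hκ] at z1 z2 z4 ⊢
        refine ⟨?_, fun hk => z2 ⟨by omega, Or.inr hk⟩⟩
        have : ¬ z.1 < x₀ := by
          intro h
          exact z2 ⟨by omega, Or.inl h⟩
        omega
    exact Finset.sum_eq_zero fun j _ => flux_eq_zero_of_notMem_right (key _) (key _)
  rw [s1, s2, s3, s4] at st
  omega

/-- A horizontal and a vertical crossing of a rectangle meet. -/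
theorem crossings_meet {x₀ x₁ y₀ y₁ : ℤ} {A B : Set Site} (hA : A ⊆ rect x₀ x₁ y₀ y₁)
    (hB : B ⊆ rect x₀ x₁ y₀ y₁) {a c b e : Site} (hac : Conn (FAdj d) A a c)
    (hbe : Conn (FAdj d) B b e) (ha : a.1 = x₀) (hc : c.1 = x₁) (hb : b.2 = y₀) (he : e.2 = y₁) :
    ∃ z, z ∈ A ∧ z ∈ B := by
  by_contra h
  push Not at h
  have r1 := hA hac.left_mem
  have r2 := hA hac.right_mem
  have r3 := hB hbe.left_mem
  have r4 := hB hbe.right_mem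
  simp only [rect, Set.mem_ofPred_eq] at r1 r2 r3 r4
  have n1 : c ≠ e := by rintro rfl; exact h _ hac.right_mem hbe.right_mem
  have n2 : a ≠ e := by rintro rfl; exact h _ hac.left_mem hbe.right_mem
  rw [ne_eq, Prod.ext_iff] at n1 n2
  refine rect_crossing hB hA (Set.disjoint_left.2 fun z hz hz' => h z hz' hz) hbe hac.fsymm
    (pa := b.1) (pb := x₁ + 1 + (c.2 - y₀)) (pc := x₁ + 1 + (y₁ - y₀) + (x₁ - e.1))
    (pe := x₁ + 1 + (y₁ - y₀) + (x₁ - x₀) + (y₁ - a.2))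
    ⟨hB hbe.left_mem, by omega⟩ ⟨hA hac.right_mem, by omega⟩ ⟨hB hbe.right_mem, by omega⟩
    ⟨hA hac.left_mem, by omega⟩ (by omega) (by omega) (by omega)

end Flux

/-- The event `E` is determined by the states of the sites in `Λ`. -/
def Dep (Λ : Set Site) (E : Config → Prop) : Prop :=
  ∀ ω ω' : Config, (∀ v ∈ Λ, ω v = ω' v) → E ω → E ω'

theorem Dep.iff {Λ : Set Site} {E : Config → Prop} (h : Dep Λ E) {ω ω' : Config}
    (hω : ∀ v ∈ Λ, ω v = ω' v) : E ω ↔ E ω' :=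
  ⟨h _ _ hω, h _ _ fun v hv => (hω v hv).symm⟩

theorem Dep.mono {Λ Λ' : Set Site} {E : Config → Prop} (h : Dep Λ E) (hs : Λ ⊆ Λ') : Dep Λ' E :=
  fun ω ω' hω => h ω ω' fun v hv => hω v (hs hv)

theorem Dep.and {Λ : Set Site} {E F : Config → Prop} (h : Dep Λ E) (h' : Dep Λ F) :
    Dep Λ (fun ω => E ω ∧ F ω) :=
  fun ω ω' hω he => ⟨h ω ω' hω he.1, h' ω ω' hω he.2⟩

/-- The event that `E` is increasing in the set of open sites. -/
def Incr (E : Config → Prop) : Prop := ∀ ω ω' : Config, ω ≤ ω' → E ω → E ω'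

/-- Probability of an event. -/
noncomputable def pr (μ : Measure Config) (E : Config → Prop) : ℝ := μ.real {ω | E ω}

section Prob

variable {μ : Measure Config} {Λ : Set Site} {E F : Config → Prop}

/-- Extension of a finite configuration by closed sites. -/
def extendCfg (Λ : Finset Site) (f : Λ → Bool) : Config :=
  fun v => if h : v ∈ Λ then f ⟨v, h⟩ else false

theorem Dep.measurableSet (hΛ : Λ.Finite) (h : Dep Λ E) : MeasurableSet {ω | E ω} := by
  have : {ω | E ω} = ⋃ f ∈ {f : hΛ.toFinset → Bool | E (extendCfg hΛ.toFinset f)},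
      {ω : Config | ∀ v : hΛ.toFinset, ω v = f v} := by
    ext ω
    simp only [Set.mem_ofPred_eq, Set.mem_iUnion, exists_prop]
    constructor
    · intro hω
      exact ⟨fun v => ω v, h _ _ (fun v hv => by simp [extendCfg, hv]) hω, fun v => rfl⟩
    · rintro ⟨f, hf, hω⟩
      refine h _ _ (fun v hv => ?_) hf
      have hv' : v ∈ hΛ.toFinset := by simpa using hv
      simp [extendCfg, hv, hω ⟨v, hv'⟩]
  rw [this]
  refine MeasurableSet.biUnion (Set.to_countable _) fun f _ => ?_
  have : {ω : Config | ∀ v : hΛ.toFinset, ω v = f v} =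
      ⋂ v : hΛ.toFinset, (fun ω : Config => ω v) ⁻¹' {f v} := by
    ext ω
    simp
  rw [this]
  exact MeasurableSet.iInter fun v => measurable_pi_apply _ (MeasurableSet.singleton _)

theorem pr_nonneg : 0 ≤ pr μ E := measureReal_nonneg

theorem IsBernoulliHalf.pr_le_one (hμ : IsBernoulliHalf μ) : pr μ E ≤ 1 := by
  have := hμ.1
  exact measureReal_le_one

theorem IsBernoulliHalf.pr_mono (hμ : IsBernoulliHalf μ) (h : ∀ ω, E ω → F ω) :
    pr μ E ≤ pr μ F := by
  have := hμ.1
  exact measureReal_mono h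

theorem pr_congr (h : ∀ ω, E ω ↔ F ω) : pr μ E = pr μ F := by
  have : E = F := funext fun ω => propext (h ω)
  rw [this]

theorem IsBernoulliHalf.pr_or_le (hμ : IsBernoulliHalf μ) :
    pr μ (fun ω => E ω ∨ F ω) ≤ pr μ E + pr μ F := by
  have := hμ.1
  exact measureReal_union_le _ _

theorem IsBernoulliHalf.pr_not (hμ : IsBernoulliHalf μ) (hΛ : Λ.Finite) (h : Dep Λ E) :
    pr μ (fun ω => ¬ E ω) = 1 - pr μ E := by
  have := hμ.1
  exact probReal_compl_eq_one_sub (h.measurableSet hΛ)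

theorem IsBernoulliHalf.pr_eq_sum (hμ : IsBernoulliHalf μ) (hΛ : Λ.Finite) (h : Dep Λ E) :
    pr μ E = (1 / 2 : ℝ) ^ hΛ.toFinset.card *
      ∑ f : hΛ.toFinset → Bool, Set.indicator {f | E (extendCfg hΛ.toFinset f)} 1 f := by
  classical
  have hp := hμ.1
  have hdec : {ω | E ω} =
      ⋃ f ∈ Finset.univ.filter fun f : hΛ.toFinset → Bool => E (extendCfg hΛ.toFinset f),
      {ω : Config | ∀ v ∈ hΛ.toFinset, ω v = extendCfg hΛ.toFinset f v} := by
    ext ω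
    simp only [Set.mem_ofPred_eq, Set.mem_iUnion, exists_prop, Finset.mem_filter,
      Finset.mem_univ, true_and]
    constructor
    · intro hω
      refine ⟨fun v => ω v, h _ _ (fun v hv => by simp [extendCfg, hv]) hω, fun v hv => ?_⟩
      simp only [extendCfg, dif_pos hv]
    · rintro ⟨f, hf, hω⟩
      exact h _ _ (fun v hv => (hω v (by simpa using hv)).symm) hf
  have hc : ∀ f : hΛ.toFinset → Bool,
      μ.real {ω : Config | ∀ v ∈ hΛ.toFinset, ω v = extendCfg hΛ.toFinset f v} =
      (1 / 2 : ℝ) ^ hΛ.toFinset.card := by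
    intro f
    rw [measureReal_def, hμ.2]
    simp
  rw [pr, hdec, measureReal_biUnion_finset]
  · rw [Finset.sum_congr rfl fun f _ => hc f, Finset.sum_const, nsmul_eq_mul, mul_comm]
    congr 1
    rw [Finset.card_filter]
    push_cast
    refine Finset.sum_congr rfl fun f _ => ?_
    simp [Set.indicator]
  · intro f _ g _ hfg
    refine Set.disjoint_left.2 fun ω hf hg => hfg ?_
    funext v
    have h1 := hf v v.2
    have h2 := hg v v.2
    simp only [extendCfg, dif_pos v.2] at h1 h2
    rw [← h1, ← h2]
  · intro f _
    refine Dep.measurableSet (E := fun ω => ∀ v ∈ hΛ.toFinset, ω v = extendCfg hΛ.toFinset f v)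
      hΛ.toFinset.finite_toSet ?_
    intro ω ω' hω h v hv
    rw [← hω v hv, h v hv]

theorem pr_unique {μ' : Measure Config} (hμ : IsBernoulliHalf μ) (hμ' : IsBernoulliHalf μ')
    (hΛ : Λ.Finite) (h : Dep Λ E) : pr μ E = pr μ' E := by
  rw [hμ.pr_eq_sum hΛ h, hμ'.pr_eq_sum hΛ h]

theorem IsBernoulliHalf.pr_comap (hμ : IsBernoulliHalf μ) (hΛ : Λ.Finite) (h : Dep Λ E)
    {φ : Site → Site} (hφ : Function.Injective φ) : pr μ (fun ω => E (ω ∘ φ)) = pr μ E := by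
  have hp := hμ.1
  have hm : Measurable fun ω : Config => ω ∘ φ :=
    measurable_pi_lambda _ fun v => measurable_pi_apply _
  have h' : IsBernoulliHalf (μ.map fun ω => ω ∘ φ) := by
    refine ⟨Measure.isProbabilityMeasure_map hm.aemeasurable, fun S f => ?_⟩
    rw [Measure.map_apply hm]
    · classical
      obtain ⟨g, hg⟩ : ∃ g : Site → Bool, ∀ v, g (φ v) = f v :=
        ⟨f ∘ Function.invFun φ, fun v => by simp [Function.leftInverse_invFun hφ v]⟩
      have := hμ.2 (S.image φ) g
      rw [Finset.card_image_of_injective _ hφ] at this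
      rw [← this]
      congr 1
      ext ω
      simp only [Set.mem_preimage, Set.mem_ofPred_eq, Finset.mem_image, Function.comp_apply]
      constructor
      · rintro h _ ⟨v, hv, rfl⟩
        rw [hg, h v hv]
      · intro h v hv
        rw [h _ ⟨v, hv, rfl⟩, hg]
    · refine Dep.measurableSet (E := fun ω => ∀ v ∈ S, ω v = f v) S.finite_toSet ?_
      intro ω ω' hω h v hv
      rw [← hω v hv, h v hv]
  rw [pr_unique hμ h' hΛ h, pr, pr, map_measureReal_apply hm (h.measurableSet hΛ)]
  rfl

theorem IsBernoulliHalf.pr_flip (hμ : IsBernoulliHalf μ) (hΛ : Λ.Finite) (h : Dep Λ E) :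
    pr μ (fun ω => E (fun v => !ω v)) = pr μ E := by
  have hp := hμ.1
  have hm : Measurable fun (ω : Config) v => !ω v :=
    measurable_pi_lambda _ fun v => (measurable_of_finite not).comp (measurable_pi_apply v)
  have h' : IsBernoulliHalf (μ.map fun ω v => !ω v) := by
    refine ⟨Measure.isProbabilityMeasure_map hm.aemeasurable, fun S f => ?_⟩
    rw [Measure.map_apply hm]
    · rw [← hμ.2 S fun v => !f v]
      congr 1
      ext ω
      simp only [Set.mem_preimage, Set.mem_ofPred_eq]
      refine forall₂_congr fun v _ => ?_
      cases ω v <;> cases f v <;> simp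
    · refine Dep.measurableSet (E := fun ω => ∀ v ∈ S, ω v = f v) S.finite_toSet ?_
      intro ω ω' hω h v hv
      rw [← hω v hv, h v hv]
  rw [pr_unique hμ h' hΛ h, pr, pr, map_measureReal_apply hm (h.measurableSet hΛ)]
  rfl

/-- Events depending on disjoint sets of sites are independent. -/
theorem IsBernoulliHalf.pr_indep (hμ : IsBernoulliHalf μ) {S T : Set Site} (hS : S.Finite)
    (hT : T.Finite) (hST : Disjoint S T) (hE : Dep S E) (hF : Dep T F) :
    pr μ (fun ω => E ω ∧ F ω) = pr μ E * pr μ F := by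
  classical
  have hp := hμ.1
  set g : Config × Config → Config := fun p v => if v ∈ S then p.1 v else p.2 v with hg
  have hm : Measurable g := by
    refine measurable_pi_lambda _ fun v => ?_
    by_cases hv : v ∈ S
    · simp only [hg, hv, if_true]
      exact (measurable_pi_apply v).comp measurable_fst
    · simp only [hg, hv, if_false]
      exact (measurable_pi_apply v).comp measurable_snd
  have h' : IsBernoulliHalf ((μ.prod μ).map g) := by
    refine ⟨Measure.isProbabilityMeasure_map hm.aemeasurable, fun Λ f => ?_⟩
    rw [Measure.map_apply hm]
    · have : g ⁻¹' {ω | ∀ v ∈ Λ, ω v = f v} =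
          {ω | ∀ v ∈ Λ.filter (· ∈ S), ω v = f v} ×ˢ {ω | ∀ v ∈ Λ.filter (· ∉ S), ω v = f v} := by
        ext ⟨ω, ω'⟩
        simp only [hg, Set.mem_preimage, Set.mem_ofPred_eq, Set.mem_prod, Finset.mem_filter]
        constructor
        · intro h
          refine ⟨fun v hv => ?_, fun v hv => ?_⟩
          · simpa [hv.2] using h v hv.1
          · simpa [hv.2] using h v hv.1
        · rintro ⟨h1, h2⟩ v hv
          split_ifs with h
          · exact h1 v ⟨hv, h⟩
          · exact h2 v ⟨hv, h⟩
      rw [this, Measure.prod_prod, hμ.2, hμ.2, ← pow_add, Finset.card_filter_add_card_filter_not]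
    · refine Dep.measurableSet (E := fun ω => ∀ v ∈ Λ, ω v = f v) Λ.finite_toSet ?_
      intro ω ω' hω h v hv
      rw [← hω v hv, h v hv]
  have hEF : Dep (S ∪ T) fun ω => E ω ∧ F ω :=
    (hE.mono Set.subset_union_left).and (hF.mono Set.subset_union_right)
  rw [pr_unique hμ h' (hS.union hT) hEF, pr,
    map_measureReal_apply hm (hEF.measurableSet (hS.union hT))]
  have : g ⁻¹' {ω | E ω ∧ F ω} = {ω | E ω} ×ˢ {ω | F ω} := by
    ext ⟨ω, ω'⟩
    simp only [Set.mem_preimage, Set.mem_ofPred_eq, Set.mem_prod]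
    rw [hE.iff (ω := g (ω, ω')) (ω' := ω) fun v hv => by simp [hg, hv],
      hF.iff (ω := g (ω, ω')) (ω' := ω') fun v hv => by
        simp [hg, Set.disjoint_right.1 hST hv]]
  rw [this, measureReal_prod_prod]
  rfl

theorem extendCfg_mono (Λ : Finset Site) {f g : Λ → Bool} (h : f ≤ g) :
    extendCfg Λ f ≤ extendCfg Λ g := by
  intro v
  unfold extendCfg
  split_ifs with hv
  · exact h ⟨v, hv⟩
  · exact le_rfl

/-- Harris' inequality. -/
theorem IsBernoulliHalf.harris (hμ : IsBernoulliHalf μ) (hΛ : Λ.Finite) (hE : Dep Λ E)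
    (hF : Dep Λ F) (iE : Incr E) (iF : Incr F) :
    pr μ E * pr μ F ≤ pr μ (fun ω => E ω ∧ F ω) := by
  classical
  rw [hμ.pr_eq_sum hΛ hE, hμ.pr_eq_sum hΛ hF, hμ.pr_eq_sum hΛ (hE.and hF)]
  set n := hΛ.toFinset.card with hn
  have hmono : ∀ {E : Config → Prop}, Incr E →
      Monotone (Set.indicator {f | E (extendCfg hΛ.toFinset f)} (1 : (hΛ.toFinset → Bool) → ℝ)) := by
    intro E iE f g hfg
    have := fun h => iE _ _ (extendCfg_mono _ hfg) h
    simp only [Set.indicator, Set.mem_ofPred_eq, Pi.one_apply]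
    split_ifs <;> first | (exfalso; tauto) | norm_num
  have key := fkg (μ := (1 : (hΛ.toFinset → Bool) → ℝ))
    (f := Set.indicator {f | E (extendCfg _ f)} 1)
    (g := Set.indicator {f | F (extendCfg _ f)} 1) (by intro; simp)
    (fun f => Set.indicator_nonneg (by simp) f) (fun f => Set.indicator_nonneg (by simp) f) (hmono iE) (hmono iF)
    (by simp)
  simp only [Pi.one_apply, one_mul, Finset.sum_const, nsmul_eq_mul, mul_one] at key
  have hcard : ((Finset.univ : Finset (hΛ.toFinset → Bool)).card : ℝ) = 2 ^ n := by
    simp [hn]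
  rw [hcard] at key
  have hprod : ∀ f : hΛ.toFinset → Bool,
      Set.indicator {f | E (extendCfg _ f)} (1 : (hΛ.toFinset → Bool) → ℝ) f *
        Set.indicator {f | F (extendCfg _ f)} 1 f =
      Set.indicator {f | E (extendCfg _ f) ∧ F (extendCfg hΛ.toFinset f)} 1 f := by
    intro f
    simp only [Set.indicator, Set.mem_ofPred_eq, Pi.one_apply]
    split_ifs <;> simp_all
  simp only [hprod] at key
  have h2 : (1 / 2 : ℝ) ^ n * 2 ^ n = 1 := by rw [← mul_pow]; norm_num
  calc _ = (1 / 2 : ℝ) ^ n * (1 / 2) ^ n * ((∑ f, Set.indicator {f | E (extendCfg _ f)} 1 f) *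
        ∑ f, Set.indicator {f | F (extendCfg _ f)} 1 f) := by ring
    _ ≤ (1 / 2 : ℝ) ^ n * (1 / 2) ^ n * _ := mul_le_mul_of_nonneg_left key (by positivity)
    _ = (1 / 2 : ℝ) ^ n * ((1 / 2) ^ n * 2 ^ n) * _ := by ring
    _ = _ := by rw [h2, mul_one]

/-- Conditioning on a random set explored site by site. -/
theorem IsBernoulliHalf.explore (hμ : IsBernoulliHalf μ) {Λ : Set Site} (hΛ : Λ.Finite)
    {V : Config → Set Site} (hV : ∀ ω, V ω ⊆ Λ)
    (hVd : ∀ ω ω', (∀ v ∈ V ω, ω v = ω' v) → V ω' = V ω)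
    {G O O' : Set Site → Config → Prop} (hG : ∀ S, Dep S (G S))
    (hO : ∀ S, Dep (Λ \ S) (O S)) (hO' : ∀ S, Dep (Λ \ S) (O' S)) {κ : ℝ} 
    (h : ∀ ω, G (V ω) ω → κ * pr μ (O (V ω)) ≤ pr μ (O' (V ω))) :
    κ * pr μ (fun ω => G (V ω) ω ∧ O (V ω) ω) ≤ pr μ (fun ω => G (V ω) ω ∧ O' (V ω) ω) := by
  classical
  have hp := hμ.1
  have hdep : ∀ S, Dep S fun ω => V ω = S ∧ G S ω := fun S ω ω' hω ⟨h1, h2⟩ =>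
    ⟨by subst h1; exact hVd ω ω' hω, hG S ω ω' hω h2⟩
  have key : ∀ O : Set Site → Config → Prop, (∀ S, Dep (Λ \ S) (O S)) →
      pr μ (fun ω => G (V ω) ω ∧ O (V ω) ω) =
      ∑ S ∈ hΛ.finite_subsets.toFinset, pr μ (fun ω => V ω = S ∧ G S ω) * pr μ (O S) := by
    intro O hO
    have : {ω | G (V ω) ω ∧ O (V ω) ω} =
        ⋃ S ∈ hΛ.finite_subsets.toFinset, {ω | (V ω = S ∧ G S ω) ∧ O S ω} := by
      ext ω
      simp only [Set.mem_ofPred_eq, Set.mem_iUnion, exists_prop, Set.Finite.mem_toFinset]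
      constructor
      · rintro ⟨h1, h2⟩
        exact ⟨_, hV ω, ⟨rfl, h1⟩, h2⟩
      · rintro ⟨S, -, ⟨rfl, h1⟩, h2⟩
        exact ⟨h1, h2⟩
    rw [pr, this, measureReal_biUnion_finset]
    · refine Finset.sum_congr rfl fun S hS => ?_
      have hS : S ⊆ Λ := by simpa using hS
      exact hμ.pr_indep (hΛ.subset hS) (hΛ.subset Set.sdiff_subset) Set.disjoint_sdiff_right
        (hdep S) (hO S)
    · intro S _ S' _ hne
      exact Set.disjoint_left.2 fun ω h1 h2 => hne (h1.1.1.symm.trans h2.1.1)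
    · intro S hS
      have hS : S ⊆ Λ := by simpa using hS
      exact (((hdep S).mono hS).and ((hO S).mono Set.sdiff_subset)).measurableSet hΛ
  rw [key O hO, key O' hO', Finset.mul_sum]
  refine Finset.sum_le_sum fun S _ => ?_
  by_cases hex : ∃ ω, V ω = S ∧ G S ω
  · obtain ⟨ω, rfl, hω⟩ := hex
    calc _ = pr μ (fun ω' => V ω' = V ω ∧ G (V ω) ω') * (κ * pr μ (O (V ω))) := by ring
      _ ≤ _ := mul_le_mul_of_nonneg_left (h ω hω) pr_nonneg
  · have : pr μ (fun ω => V ω = S ∧ G S ω) = 0 := by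
      rw [pr]
      have : {ω | V ω = S ∧ G S ω} = ∅ := by
        ext ω
        simp only [Set.mem_ofPred_eq, Set.mem_empty_iff_false, iff_false]
        exact fun h => hex ⟨ω, h⟩
      rw [this]
      simp
    simp [this]

end Prob

theorem Conn.self_cluster {adj : Site → Site → Prop} {S : Set Site} {u v : Site}
    (h : Conn adj S u v) : Conn adj {y | Conn adj S u y} u v := by
  refine h.induction (P := fun v => Conn adj {y | Conn adj S u y} u v)
    (Conn.refl (Conn.refl h.1)) ?_
  intro a b h1 h2 h3 h4
  exact h2.tail h3 (h1.tail h3 h4)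

theorem rect_finite (x₀ x₁ y₀ y₁ : ℤ) : (rect x₀ x₁ y₀ y₁).Finite := by
  refine ((Set.finite_Icc x₀ x₁).prod (Set.finite_Icc y₀ y₁)).subset ?_
  rintro ⟨x, y⟩ ⟨h1, h2, h3, h4⟩
  exact ⟨⟨h1, h2⟩, ⟨h3, h4⟩⟩

/-- Sites reached from `A₀` in `Λ` by walks whose sites, except possibly the last, have state `c`. -/
def reach (adj : Site → Site → Prop) (Λ A₀ : Set Site) (c : Bool) (ω : Config) : Set Site :=
  {v | ∃ a ∈ A₀, Relation.ReflTransGen (fun u v => ω u = c ∧ adj u v ∧ v ∈ Λ) a v}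

section Reach

variable {adj : Site → Site → Prop} {Λ A₀ : Set Site} {c : Bool} {ω ω' : Config}

theorem subset_reach : A₀ ⊆ reach adj Λ A₀ c ω := fun a ha => ⟨a, ha, .refl⟩

theorem reach_step {u v : Site} (hu : u ∈ reach adj Λ A₀ c ω) (hc : ω u = c) (huv : adj u v)
    (hv : v ∈ Λ) : v ∈ reach adj Λ A₀ c ω := by
  obtain ⟨a, ha, h⟩ := hu
  exact ⟨a, ha, h.tail ⟨hc, huv, hv⟩⟩

theorem reach_induction {P : Site → Prop} {v : Site} (hv : v ∈ reach adj Λ A₀ c ω)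
    (h0 : ∀ a ∈ A₀, P a)
    (hs : ∀ u v, u ∈ reach adj Λ A₀ c ω → P u → ω u = c → adj u v → v ∈ Λ → P v) : P v := by
  obtain ⟨a, ha, h⟩ := hv
  induction h with
  | refl => exact h0 a ha
  | tail h1 h2 ih => exact hs _ _ ⟨a, ha, h1⟩ ih h2.1 h2.2.1 h2.2.2

theorem reach_subset (h : A₀ ⊆ Λ) : reach adj Λ A₀ c ω ⊆ Λ := by
  intro v hv
  exact reach_induction (P := (· ∈ Λ)) hv (fun a ha => h ha) fun _ _ _ _ _ _ h => h

theorem reach_congr (h : ∀ v ∈ reach adj Λ A₀ c ω, ω v = ω' v) :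
    reach adj Λ A₀ c ω' = reach adj Λ A₀ c ω := by
  apply Set.Subset.antisymm
  · intro v hv
    refine reach_induction (P := (· ∈ reach adj Λ A₀ c ω)) hv (fun a ha => subset_reach ha) ?_
    intro u v _ hu hc huv hv
    exact reach_step hu ((h u hu).trans hc) huv hv
  · intro v hv
    refine reach_induction (P := (· ∈ reach adj Λ A₀ c ω')) hv (fun a ha => subset_reach ha) ?_
    intro u v hu hu' hc huv hv
    exact reach_step hu' ((h u hu).symm.trans hc) huv hv

theorem exists_conn_of_mem_reach {v : Site} (hv : v ∈ reach adj Λ A₀ c ω) :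
    ∃ a ∈ A₀, Conn adj ({z | z ∈ reach adj Λ A₀ c ω ∧ ω z = c} ∪ {v}) a v := by
  refine reach_induction (P := fun v => ∃ a ∈ A₀, Conn adj
    ({z | z ∈ reach adj Λ A₀ c ω ∧ ω z = c} ∪ {v}) a v) hv
    (fun a ha => ⟨a, ha, Conn.refl (by simp)⟩) ?_
  rintro u v hu ⟨a, ha, h⟩ hc huv -
  refine ⟨a, ha, Conn.tail (h.mono ?_) huv (Or.inr rfl)⟩
  rintro z (hz | rfl)
  · exact Or.inl hz
  · exact Or.inl ⟨hu, hc⟩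

/-- A walk of colour `c` started in `A₀` stays in the explored set. -/
theorem mem_reach_of_conn {a v : Site} (ha : a ∈ A₀)
    (h : Conn adj {z | z ∈ Λ ∧ ω z = c} a v) : v ∈ reach adj Λ A₀ c ω ∧ ω v = c := by
  refine h.induction (P := fun v => v ∈ reach adj Λ A₀ c ω ∧ ω v = c)
    ⟨subset_reach ha, h.1.2⟩ ?_
  intro u v _ hu huv hv
  exact ⟨reach_step hu.1 hu.2 huv hv.1, hv.2⟩

end Reach

/-- Horizontal crossing of a rectangle through sites satisfying `κ`. -/
def HCross (d : ℤ → Bool) (x₀ x₁ y₀ y₁ : ℤ) (κ : Site → Prop) : Prop :=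
  ∃ u v, u.1 = x₀ ∧ v.1 = x₁ ∧ Conn (FAdj d) {z | z ∈ rect x₀ x₁ y₀ y₁ ∧ κ z} u v

/-- Vertical crossing of a rectangle through sites satisfying `κ`. -/
def VCross (d : ℤ → Bool) (x₀ x₁ y₀ y₁ : ℤ) (κ : Site → Prop) : Prop :=
  ∃ u v, u.2 = y₀ ∧ v.2 = y₁ ∧ Conn (FAdj d) {z | z ∈ rect x₀ x₁ y₀ y₁ ∧ κ z} u v

section Cross

variable {d : ℤ → Bool} {x₀ x₁ y₀ y₁ : ℤ} {c : Bool} {μ : Measure Config}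

/-- Connection through sites of state `c` of a region is determined by the region. -/
theorem conn_congr {adj : Site → Site → Prop} {Λ : Set Site} {ω ω' : Config} {u v : Site}
    (hω : ∀ v ∈ Λ, ω v = ω' v) (h : Conn adj {z | z ∈ Λ ∧ ω z = c} u v) :
    Conn adj {z | z ∈ Λ ∧ ω' z = c} u v :=
  h.mono fun z hz => ⟨hz.1, (hω z hz.1).symm.trans hz.2⟩

theorem conn_incr {adj : Site → Site → Prop} {Λ : Set Site} {ω ω' : Config} {u v : Site}
    (hω : ω ≤ ω') (h : Conn adj {z | z ∈ Λ ∧ ω z = true} u v) :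
    Conn adj {z | z ∈ Λ ∧ ω' z = true} u v :=
  h.mono fun z hz => ⟨hz.1, by
    have h1 := hω z
    rw [hz.2] at h1
    cases h2 : ω' z
    · rw [h2] at h1; exact absurd (h1 rfl) Bool.false_ne_true
    · rfl⟩

theorem dep_HCross : Dep (rect x₀ x₁ y₀ y₁) fun ω => HCross d x₀ x₁ y₀ y₁ fun v => ω v = c :=
  fun _ _ hω ⟨u, v, hu, hv, h⟩ => ⟨u, v, hu, hv, conn_congr hω h⟩

theorem dep_VCross : Dep (rect x₀ x₁ y₀ y₁) fun ω => VCross d x₀ x₁ y₀ y₁ fun v => ω v = c :=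
  fun _ _ hω ⟨u, v, hu, hv, h⟩ => ⟨u, v, hu, hv, conn_congr hω h⟩

theorem incr_HCross : Incr fun ω => HCross d x₀ x₁ y₀ y₁ fun v => ω v = true :=
  fun _ _ hω ⟨u, v, hu, hv, h⟩ => ⟨u, v, hu, hv, conn_incr hω h⟩

theorem incr_VCross : Incr fun ω => VCross d x₀ x₁ y₀ y₁ fun v => ω v = true :=
  fun _ _ hω ⟨u, v, hu, hv, h⟩ => ⟨u, v, hu, hv, conn_incr hω h⟩

theorem hcross_iff_not_vcross (hx : x₀ ≤ x₁) (hy : y₀ ≤ y₁) (ω : Config) :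
    HCross d x₀ x₁ y₀ y₁ (fun v => ω v = c) ↔ ¬ VCross d x₀ x₁ y₀ y₁ fun v => ω v = !c := by
  constructor
  · rintro ⟨u, v, hu, hv, h⟩ ⟨u', v', hu', hv', h'⟩
    obtain ⟨z, h1, h2⟩ := crossings_meet (fun z hz => hz.1) (fun z hz => hz.1) h h' hu hv hu' hv'
    have := h1.2.symm.trans h2.2
    cases c <;> simp at this
  · intro hn
    rcases hex d (fun v => ω v = c) hx hy with h | ⟨u, v, hu, hv, h⟩
    · exact h
    · exact absurd ⟨u, v, hu, hv, h.mono fun z hz => ⟨hz.1, by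
        have := hz.2
        cases c <;> simpa using this⟩⟩ hn

theorem IsBernoulliHalf.pr_VCross_flip (hμ : IsBernoulliHalf μ) :
    pr μ (fun ω => VCross d x₀ x₁ y₀ y₁ fun v => ω v = !c) =
      pr μ (fun ω => VCross d x₀ x₁ y₀ y₁ fun v => ω v = c) := by
  rw [← hμ.pr_flip (rect_finite x₀ x₁ y₀ y₁) dep_VCross]
  simp

theorem VCross.swap {β : Bool} {κ : Site → Prop}
    (hd : ∀ x, x₀ ≤ x → x < x₁ → d x = β) (h : VCross d x₀ x₁ y₀ y₁ κ) :
    HCross (fun _ => β) y₀ y₁ x₀ x₁ fun v => κ v.swap := by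
  obtain ⟨u, v, hu, hv, h⟩ := h
  refine ⟨u.swap, v.swap, hu, hv, h.map Prod.swap ?_ ?_⟩
  · rintro ⟨a1, a2⟩ ⟨b1, b2⟩ ha hb hab
    simp only [FAdj, Prod.swap, rect, Set.mem_ofPred_eq] at *
    have k1 := hd a1
    have k2 := hd b1
    cases β
    · simp only [reduceCtorEq, and_false, or_false, and_true] at *
      rcases hab with h | h | h | h | h | h
      · omega
      · omega
      · omega
      · omega
      · rw [k1 (by omega) (by omega)] at h; simp at h
      · rw [k2 (by omega) (by omega)] at h; simp at h
    · simp only [reduceCtorEq, and_false, and_true, false_or] at *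
      rcases hab with h | h | h | h | h | h
      · omega
      · omega
      · rw [k1 (by omega) (by omega)] at h; simp at h
      · rw [k2 (by omega) (by omega)] at h; simp at h
      · omega
      · omega
  · rintro ⟨a1, a2⟩ ha
    simp only [Prod.swap, rect, Set.mem_ofPred_eq] at *
    tauto

theorem HCross.swap' {β : Bool} {κ : Site → Prop}
    (hd : ∀ x, y₀ ≤ x → x < y₁ → d x = β) (h : HCross (fun _ => β) x₀ x₁ y₀ y₁ κ) :
    VCross d y₀ y₁ x₀ x₁ fun v => κ v.swap := by
  obtain ⟨u, v, hu, hv, h⟩ := h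
  refine ⟨u.swap, v.swap, hu, hv, h.map Prod.swap ?_ ?_⟩
  · rintro ⟨a1, a2⟩ ⟨b1, b2⟩ ha hb hab
    simp only [FAdj, Prod.swap, rect, Set.mem_ofPred_eq] at *
    have k1 := hd a2
    have k2 := hd b2
    cases β
    · simp only [reduceCtorEq, and_false, or_false, and_true] at *
      rcases hab with h | h | h | h
      · omega
      · omega
      · exact Or.inr (Or.inr (Or.inr (Or.inl ⟨by omega, by omega, k2 (by omega) (by omega)⟩)))
      · exact Or.inr (Or.inr (Or.inl ⟨by omega, by omega, k1 (by omega) (by omega)⟩))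
    · simp only [reduceCtorEq, and_false, and_true, false_or] at *
      rcases hab with h | h | h | h
      · omega
      · omega
      · exact Or.inr (Or.inr (Or.inr (Or.inr (Or.inl
          ⟨by omega, by omega, k1 (by omega) (by omega)⟩))))
      · exact Or.inr (Or.inr (Or.inr (Or.inr (Or.inr
          ⟨by omega, by omega, k2 (by omega) (by omega)⟩))))
  · rintro ⟨a1, a2⟩ ha
    simp only [Prod.swap, rect, Set.mem_ofPred_eq] at *
    tauto

theorem IsBernoulliHalf.pr_VCross_swap (hμ : IsBernoulliHalf μ) {β : Bool}
    (hd : ∀ x, x₀ ≤ x → x < x₁ → d x = β) :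
    pr μ (fun ω => VCross d x₀ x₁ y₀ y₁ fun v => ω v = c) =
      pr μ (fun ω => HCross (fun _ => β) y₀ y₁ x₀ x₁ fun v => ω v = c) := by
  rw [← hμ.pr_comap (rect_finite _ _ _ _) dep_HCross Prod.swap_injective]
  refine pr_congr fun ω => ⟨fun h => h.swap hd, fun h => ?_⟩
  have := h.swap' hd
  simpa using this

/-- Translations preserve crossing probabilities. -/
theorem IsBernoulliHalf.pr_HCross_translate (hμ : IsBernoulliHalf μ) (a b : ℤ) {d' : ℤ → Bool}
    (hd : ∀ x, x₀ ≤ x → x < x₁ → d' (x + a) = d x) :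
    pr μ (fun ω => HCross d x₀ x₁ y₀ y₁ fun v => ω v = c) ≤
      pr μ (fun ω => HCross d' (x₀ + a) (x₁ + a) (y₀ + b) (y₁ + b) fun v => ω v = c) := by
  have hinj : Function.Injective fun v : Site => ((v.1 + a, v.2 + b) : Site) := by
    rintro ⟨x, y⟩ ⟨z, w⟩ h
    simpa using h
  rw [← hμ.pr_comap (rect_finite x₀ x₁ y₀ y₁) dep_HCross hinj]
  refine hμ.pr_mono fun ω => ?_
  rintro ⟨u, v, hu, hv, h⟩
  refine ⟨_, _, ?_, ?_, h.map (fun v : Site => ((v.1 + a, v.2 + b) : Site)) ?_ ?_⟩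
  · simp [hu]
  · simp [hv]
  · rintro ⟨a1, a2⟩ ⟨b1, b2⟩ ha hb hab
    simp only [FAdj, rect, Set.mem_ofPred_eq] at *
    rcases hab with h | h | h | h | h | h
    · left; omega
    · right; left; omega
    · rw [hd a1 (by omega) (by omega)]; right; right; left; exact ⟨by omega, by omega, h.2.2⟩
    · rw [hd b1 (by omega) (by omega)]; right; right; right; left; exact ⟨by omega, by omega, h.2.2⟩
    · rw [hd a1 (by omega) (by omega)]; right; right; right; right; left
      exact ⟨by omega, by omega, h.2.2⟩
    · rw [hd b1 (by omega) (by omega)]; right; right; right; right; right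
      exact ⟨by omega, by omega, h.2.2⟩
  · rintro ⟨a1, a2⟩ ⟨h1, h2⟩
    simp only [rect, Set.mem_ofPred_eq] at *
    exact ⟨by omega, h2⟩

/-- Squares are crossed with probability one half. -/
theorem IsBernoulliHalf.pr_square (hμ : IsBernoulliHalf μ) {β : Bool} {n : ℤ} (hn : 0 ≤ n)
    (hd : ∀ x, x₀ ≤ x → x < x₀ + n → d x = β) :
    pr μ (fun ω => HCross d x₀ (x₀ + n) y₀ (y₀ + n) fun v => ω v = c) = 1 / 2 := by
  have h1 : pr μ (fun ω => HCross d x₀ (x₀ + n) y₀ (y₀ + n) fun v => ω v = c) =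
      1 - pr μ (fun ω => VCross d x₀ (x₀ + n) y₀ (y₀ + n) fun v => ω v = !c) := by
    rw [← hμ.pr_not (rect_finite _ _ _ _) dep_VCross]
    exact pr_congr fun ω => hcross_iff_not_vcross (by omega) (by omega) ω
  have h2 : pr μ (fun ω => VCross d x₀ (x₀ + n) y₀ (y₀ + n) fun v => ω v = !c) =
      pr μ (fun ω => HCross (fun _ => β) y₀ (y₀ + n) x₀ (x₀ + n) fun v => ω v = c) := by
    rw [hμ.pr_VCross_flip, hμ.pr_VCross_swap hd]
  have h3 : pr μ (fun ω => HCross (fun _ => β) y₀ (y₀ + n) x₀ (x₀ + n) fun v => ω v = c) =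
      pr μ (fun ω => HCross d x₀ (x₀ + n) y₀ (y₀ + n) fun v => ω v = c) := by
    apply le_antisymm
    · have := hμ.pr_HCross_translate (d := fun _ => β) (x₀ := y₀) (x₁ := y₀ + n) (y₀ := x₀)
        (y₁ := x₀ + n) (c := c) (x₀ - y₀) (y₀ - x₀) (d' := d)
        (fun x h1 h2 => hd _ (by omega) (by omega))
      rwa [show y₀ + (x₀ - y₀) = x₀ by ring, show y₀ + n + (x₀ - y₀) = x₀ + n by ring,
        show x₀ + (y₀ - x₀) = y₀ by ring, show x₀ + n + (y₀ - x₀) = y₀ + n by ring] at this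
    · have := hμ.pr_HCross_translate (d' := fun _ => β) (x₀ := x₀) (x₁ := x₀ + n) (y₀ := y₀)
        (y₁ := y₀ + n) (c := c) (y₀ - x₀) (x₀ - y₀) (d := d)
        (fun x h1 h2 => (hd _ h1 h2).symm)
      rwa [show y₀ + (x₀ - y₀) = x₀ by ring, show y₀ + n + (x₀ - y₀) = x₀ + n by ring,
        show x₀ + (y₀ - x₀) = y₀ by ring, show x₀ + n + (y₀ - x₀) = y₀ + n by ring] at this
  linarith

theorem IsBernoulliHalf.pr_square' (hμ : IsBernoulliHalf μ) {β : Bool} {n : ℤ} (hn : 0 ≤ n)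
    (hd : ∀ x, x₀ ≤ x → x < x₀ + n → d x = β) :
    pr μ (fun ω => VCross d x₀ (x₀ + n) y₀ (y₀ + n) fun v => ω v = c) = 1 / 2 := by
  rw [hμ.pr_VCross_swap hd]
  exact hμ.pr_square hn fun _ _ _ => rfl

end Cross

/-- Reflection in the column `m`. -/
def mirror (m : ℤ) (v : Site) : Site := (2 * m - v.1, v.2)

section Reflection

variable {d : ℤ → Bool} {m n : ℤ} {β : Bool} {μ : Measure Config}

@[simp] theorem mirror_mirror (m : ℤ) (v : Site) : mirror m (mirror m v) = v := by
  simp [mirror]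

theorem mirror_injective (m : ℤ) : Function.Injective (mirror m) :=
  Function.LeftInverse.injective (mirror_mirror m)

theorem mirror_of_eq {v : Site} (h : v.1 = m) : mirror m v = v := by
  obtain ⟨x, y⟩ := v
  simp only [mirror] at *
  rw [h]
  congr 1
  ring

theorem mirror_mem_rect {v : Site} (h : v ∈ rect (m - n) (m + n) 0 n) :
    mirror m v ∈ rect (m - n) (m + n) 0 n := by
  simp only [mirror, rect, Set.mem_ofPred_eq] at *
  omega

/-- The direction of the diagonals is symmetric about the column `m`. -/
def Mirrored (d : ℤ → Bool) (m n : ℤ) : Prop :=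
  ∃ β, (∀ x, m - n ≤ x → x < m → d x = β) ∧ ∀ x, m ≤ x → x < m + n → d x = !β

theorem Mirrored.adj (hd : Mirrored d m n) {a b : Site} (ha : a ∈ rect (m - n) (m + n) 0 n)
    (hb : b ∈ rect (m - n) (m + n) 0 n) (h : FAdj d a b) : FAdj d (mirror m a) (mirror m b) := by
  obtain ⟨β, h1, h2⟩ := hd
  have key : ∀ x, m - n ≤ x → x < m + n → d (2 * m - x - 1) = !d x := by
    intro x k1 k2
    rcases lt_or_ge x m with h | h
    · rw [h1 x k1 h, h2 _ (by omega) (by omega)]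
    · rw [h2 x h k2, h1 _ (by omega) (by omega)]; simp
  obtain ⟨a1, a2⟩ := a
  obtain ⟨b1, b2⟩ := b
  simp only [FAdj, mirror, rect, Set.mem_ofPred_eq] at *
  rcases h with h | h | h | h | h | h
  · left; omega
  · right; left; omega
  · have := key a1 (by omega) (by omega)
    rw [h.2.2, show 2 * m - a1 - 1 = 2 * m - b1 by omega] at this
    right; right; right; right; right
    exact ⟨by omega, by omega, this⟩
  · have := key b1 (by omega) (by omega)
    rw [h.2.2, show 2 * m - b1 - 1 = 2 * m - a1 by omega] at this
    right; right; right; right; left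
    exact ⟨by omega, by omega, this⟩
  · have := key a1 (by omega) (by omega)
    rw [h.2.2, show 2 * m - a1 - 1 = 2 * m - b1 by omega] at this
    right; right; right; left
    exact ⟨by omega, by omega, this⟩
  · have := key b1 (by omega) (by omega)
    rw [h.2.2, show 2 * m - b1 - 1 = 2 * m - a1 by omega] at this
    right; right; left
    exact ⟨by omega, by omega, this⟩

theorem Mirrored.conn (hd : Mirrored d m n) {X Y : Set Site} {u v : Site} (h : Conn (FAdj d) X u v)
    (hX : X ⊆ rect (m - n) (m + n) 0 n) (hXY : ∀ z ∈ X, mirror m z ∈ Y) :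
    Conn (FAdj d) Y (mirror m u) (mirror m v) :=
  h.map (mirror m) (fun _ _ ha hb hab => hd.adj (hX ha) (hX hb) hab) hXY

/-- Sites outside `V` and its mirror image. -/
def freeSites (m n : ℤ) (V : Set Site) : Set Site :=
  {z | z ∈ rect (m - n) (m + n) 0 n ∧ z ∉ V ∧ mirror m z ∉ V}

/-- A connection from the left part of the boundary to the right half of the top which is open
outside `V`. -/
def RelCross (d : ℤ → Bool) (m n : ℤ) (V : Set Site) (ω : Config) : Prop :=
  ∃ u v, (u.1 = m - n ∨ u.1 ≤ m ∧ u.2 = 0) ∧ v.2 = n ∧ m ≤ v.1 ∧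
    Conn (FAdj d) {z | z ∈ rect (m - n) (m + n) 0 n ∧
      (z ∈ V ∨ (ω z = true ∧ z ∈ freeSites m n V))} u v

/-- Open connection from the left side to the right half of the top side. -/
def CornerCross (d : ℤ → Bool) (m n : ℤ) (ω : Config) : Prop :=
  ∃ u v, u.1 = m - n ∧ v.2 = n ∧ m ≤ v.1 ∧
    Conn (FAdj d) {z | z ∈ rect (m - n) (m + n) 0 n ∧ ω z = true} u v

theorem relCross_or (hd : Mirrored d m n) (hn : 1 ≤ n) {V : Set Site}
    (hV : V ⊆ rect (m - n) m 0 n) (hV0 : ∀ x, m - n ≤ x → x ≤ m → (x, 0) ∈ V) (ω : Config) :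
    RelCross d m n V ω ∨ RelCross d m n V fun z => !ω (mirror m z) := by
  obtain ⟨N, hN⟩ := Int.le.dest hn
  set D := rect (m - n) (m + n) 0 n with hD
  set R : Set Site := rect (m - n - 1) (m + n + 1) 0 n with hR
  set κ : Site → Prop := fun z => z.1 < m - n ∨
    (z ∈ D ∧ (z ∈ V ∨ (ω z = true ∧ z ∈ freeSites m n V))) with hκ
  set A₀ : Set Site := {z | z ∈ R ∧ (z.1 < m - n ∨ z.1 ≤ m ∧ z.2 = 0)} with hA₀
  set B₀ : Set Site := {z | z ∈ R ∧ (m + n < z.1 ∨ m < z.1 ∧ z.2 = 0)} with hB₀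
  have hc := clusters_clusterOf (FAdj d) R κ A₀ B₀
  set A := clusterOf (FAdj d) R κ A₀ with hA
  set B := clusterOf (FAdj d) R (fun v => ¬ κ v) B₀ with hB
  have kA : ∀ z ∈ A₀, κ z := by
    rintro ⟨x, y⟩ ⟨h1, h2⟩
    simp only [hR, rect, Set.mem_ofPred_eq] at h1 h2
    by_cases hx : x < m - n
    · exact Or.inl hx
    · obtain rfl : y = 0 := by omega
      refine Or.inr ⟨by simp only [hD, rect, Set.mem_ofPred_eq]; omega, Or.inl (hV0 _ ?_ ?_)⟩ <;> omega
  have kB : ∀ z ∈ B₀, ¬ κ z := by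
    rintro ⟨x, y⟩ ⟨h1, h2⟩ hk
    simp only [hR, rect, Set.mem_ofPred_eq] at h1 h2
    rcases hk with hk | ⟨hk1, hk2⟩
    · simp only at hk; omega
    · simp only [hD, rect, Set.mem_ofPred_eq] at hk1
      rcases hk2 with hk2 | hk2
      · have := hV hk2
        simp only [rect, Set.mem_ofPred_eq] at this
        omega
      · obtain rfl : y = 0 := by omega
        exact hk2.2.2.2 (hV0 _ (by omega) (by omega))
  have hAm : ∀ z ∈ A₀, z ∈ A := fun z hz => ⟨z, hz, Conn.refl ⟨hz.1, kA z hz⟩⟩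
  have hBm : ∀ z ∈ B₀, z ∈ B := fun z hz => ⟨z, hz, Conn.refl ⟨hz.1, kB z hz⟩⟩
  have nBA : ∀ z ∈ A₀, z ∉ B := fun z hz h => hc.colorB _ h (kA z hz)
  have nAB : ∀ z ∈ B₀, z ∉ A := fun z hz h => kB z hz (hc.colorA _ h)
  by_contra hcon
  push Not at hcon
  obtain ⟨c1, c2⟩ := hcon
  have tA : ∀ x, m ≤ x → ((x, n) : Site) ∉ A := by
    rintro x hx ⟨a, ha, hav⟩
    obtain ⟨s, t, -, hs, hst, ht, htv⟩ := hav.last_exit (X := A₀) ha (by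
      simp only [hA₀, Set.mem_ofPred_eq]; omega)
    have ht1 := htv.left_mem
    have hst' := hst.abs_le
    have hsub : ∀ z ∈ {v | v ∈ R ∧ κ v} \ A₀, z ∈ D ∧ (z ∈ V ∨ (ω z = true ∧ z ∈ freeSites m n V)) := by
      rintro z ⟨⟨z1, z2⟩, z3⟩
      rcases z2 with z2 | z2
      · exact absurd ⟨z1, Or.inl z2⟩ z3
      · exact z2
    have htv' := htv.mono hsub
    have ht2 := (hsub t ht1).1
    simp only [hD, rect, Set.mem_ofPred_eq] at ht2
    by_cases hsx : s.1 < m - n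
    · exact c1 ⟨t, (x, n), Or.inl (by omega), rfl, hx, htv'⟩
    · have hk := (kA s hs).resolve_left hsx
      refine c1 ⟨s, (x, n), Or.inr ?_, rfl, hx, htv'.head hk hst⟩
      simp only [hA₀, Set.mem_ofPred_eq] at hs
      omega
  have tB : ∀ x, x ≤ m → ((x, n) : Site) ∉ B := by
    rintro x hx ⟨a, ha, hav⟩
    have hBk : ∀ z, z ∈ D → ¬ κ z → mirror m z ∈ D ∧ (mirror m z ∈ V ∨
        ((!ω (mirror m (mirror m z))) = true ∧ mirror m z ∈ freeSites m n V)) := by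
      intro z hz hk
      refine ⟨mirror_mem_rect hz, ?_⟩
      by_contra hcon
      push Not at hcon
      obtain ⟨q1, q2⟩ := hcon
      simp only [mirror_mirror, Bool.not_eq_true'] at q2
      apply hk
      refine Or.inr ⟨hz, ?_⟩
      by_cases hzV : z ∈ V
      · exact Or.inl hzV
      · refine Or.inr ⟨?_, hz, hzV, q1⟩
        by_contra hw
        exact q2 (by simpa using hw) ⟨mirror_mem_rect hz, q1, by simpa using hzV⟩
    have hRD : ∀ z ∈ {v | v ∈ R ∧ ¬ κ v} \ B₀, z ∈ D ∧ ¬ κ z := by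
      rintro ⟨zx, zy⟩ ⟨⟨z1, z2⟩, z3⟩
      refine ⟨?_, z2⟩
      have h4 : ¬ zx < m - n := fun h => z2 (Or.inl h)
      have h5 : ¬ m + n < zx := fun h => z3 ⟨z1, Or.inl h⟩
      simp only [hR, hD, rect, Set.mem_ofPred_eq] at z1 ⊢
      omega
    set Y : Set Site := {z | z ∈ D ∧ (z ∈ V ∨ ((!ω (mirror m z)) = true ∧
      z ∈ freeSites m n V))} with hY
    obtain ⟨s, t, -, hs, hst, ht, htv⟩ := hav.last_exit (X := B₀) ha (by
      simp only [hB₀, Set.mem_ofPred_eq]; omega)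
    have ht1 := htv.left_mem
    have hst' := hst.abs_le
    have htv' : Conn (FAdj d) {z | z ∈ D ∧ ¬ κ z} t (x, n) := htv.mono hRD
    have ht2 := (hRD t ht1).1
    simp only [hD, rect, Set.mem_ofPred_eq] at ht2
    by_cases hsx : m + n < s.1
    · have := hd.conn (Y := Y) htv' (fun z hz => hz.1) (fun z hz => hBk z hz.1 hz.2)
      refine c2 ⟨_, _, Or.inl ?_, ?_, ?_, this⟩ <;> simp only [mirror] <;> omega
    · have hs' := hs
      simp only [hB₀, hR, rect, Set.mem_ofPred_eq] at hs'
      have hsD : s ∈ D := by simp only [hD, rect, Set.mem_ofPred_eq]; omega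
      have := hd.conn (Y := Y) (htv'.head (u := s) (show s ∈ {z | z ∈ D ∧ ¬ κ z} from ⟨hsD, kB s hs⟩) hst) (fun z hz => hz.1)
        (fun z hz => hBk z hz.1 hz.2)
      refine c2 ⟨_, _, Or.inr ?_, ?_, ?_, this⟩ <;> simp only [mirror] <;> omega
  have st := flux_rect hc (m - n - 1) 0 (2 * N + 4) (N + 1) (by
    intro z hz
    simp only [hR, rect, Set.mem_ofPred_eq] at *
    push_cast at hz
    omega)
  have s1 : ∑ i ∈ Finset.range (2 * N + 4),
      flux A B (m - n - 1 + i, 0) (m - n - 1 + i + 1, 0) = -1 := by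
    rw [Finset.sum_eq_single (N + 2)]
    · have a1 : ((m - n - 1 + (N + 2 : ℕ), 0) : Site) ∈ A := hAm _ ⟨by
        simp only [hR, rect, Set.mem_ofPred_eq, le_refl, true_and]; push_cast; omega, Or.inr ⟨by
          push_cast; omega, rfl⟩⟩
      have b1 : ((m - n - 1 + (N + 2 : ℕ) + 1, 0) : Site) ∈ B := hBm _ ⟨by
        simp only [hR, rect, Set.mem_ofPred_eq, le_refl, true_and]; push_cast; omega, Or.inr ⟨by
          push_cast; omega, rfl⟩⟩
      have b2 : ((m - n - 1 + (N + 2 : ℕ) + 1, 0) : Site) ∉ A := fun h =>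
        hc.colorB _ b1 (hc.colorA _ h)
      simp only [flux, a1, b1, b2, and_self, if_true, and_false, if_false]
      norm_num
    · intro i hi hi'
      rw [Finset.mem_range] at hi
      rcases lt_or_gt_of_ne hi' with h | h
      · apply flux_eq_zero_of_notMem_right <;> apply nBA <;>
        · simp only [hA₀, hR, rect, Set.mem_ofPred_eq, le_refl, true_and, and_true]
          omega
      · apply flux_eq_zero_of_notMem_left <;> apply nAB <;>
        · simp only [hB₀, hR, rect, Set.mem_ofPred_eq, le_refl, true_and, and_true]
          omega
    · intro h
      exact absurd (Finset.mem_range.2 (by omega)) h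
  have s2 : ∑ j ∈ Finset.range (N + 1),
      flux A B (m - n - 1 + (2 * N + 4 : ℕ), 0 + j) (m - n - 1 + (2 * N + 4 : ℕ), 0 + j + 1) = 0 := by
    refine Finset.sum_eq_zero fun j hj => ?_
    rw [Finset.mem_range] at hj
    apply flux_eq_zero_of_notMem_left <;> apply nAB <;>
    · simp only [hB₀, hR, rect, Set.mem_ofPred_eq]
      push_cast
      omega
  have s3 : ∑ j ∈ Finset.range (N + 1),
      flux A B (m - n - 1, 0 + j) (m - n - 1, 0 + j + 1) = 0 := by
    refine Finset.sum_eq_zero fun j hj => ?_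
    rw [Finset.mem_range] at hj
    apply flux_eq_zero_of_notMem_right <;> apply nBA <;>
    · simp only [hA₀, hR, rect, Set.mem_ofPred_eq]
      omega
  have s4 : ∑ i ∈ Finset.range (2 * N + 4), flux A B (m - n - 1 + i, 0 + (N + 1 : ℕ))
      (m - n - 1 + i + 1, 0 + (N + 1 : ℕ)) = 0 := by
    refine Finset.sum_eq_zero fun i hi => ?_
    rw [show (0 : ℤ) + (N + 1 : ℕ) = n by push_cast; omega]
    rcases lt_or_ge (m - n - 1 + i) m with h | h
    · exact flux_eq_zero_of_notMem_right (tB _ (by omega)) (tB _ (by omega))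
    · exact flux_eq_zero_of_notMem_left (tA _ (by omega)) (tA _ (by omega))
  rw [s1, s2, s3, s4] at st
  omega

/-- An open crossing of the left square found by exploration from below, prolonged by a
connection which is open outside of the explored set. -/
theorem cornerCross_of_relCross (hd : Mirrored d m n) (hn : 1 ≤ n) {ω : Config} {V : Set Site}
    (hVdef : V = reach (FAdj d) (rect (m - n) m 0 n) {z | z ∈ rect (m - n) m 0 n ∧ z.2 = 0} false ω)
    (hNT : ∀ v ∈ V, v.2 = n → ω v = true) (hO : RelCross d m n V ω) : CornerCross d m n ω := by
  set S := rect (m - n) m 0 n with hS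
  set A₀ : Set Site := {z | z ∈ S ∧ z.2 = 0} with hA₀
  set D := rect (m - n) (m + n) 0 n with hD
  have hSD : S ⊆ D := by
    intro z hz
    simp only [hS, hD, rect, Set.mem_ofPred_eq] at *
    omega
  have hVS : V ⊆ S := by rw [hVdef]; exact reach_subset fun z hz => hz.1
  have hAV : A₀ ⊆ V := by rw [hVdef]; exact subset_reach
  have hstep : ∀ a ∈ V, ω a = false → ∀ b ∈ S, FAdj d a b → b ∈ V := by
    rw [hVdef]
    exact fun a ha hc b hb hab => reach_step ha hc hab hb
  obtain ⟨u0, m0, hu0, hm0, h0⟩ : ∃ u v, u.1 = m - n ∧ v.1 = m ∧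
      Conn (FAdj d) {z | z ∈ S ∧ (z ∈ V ∧ ω z = true)} u v := by
    rcases hex d (fun z => z ∈ V ∧ ω z = true) (show m - n ≤ m by omega) (show 0 ≤ n by omega)
      with h | ⟨u, v, hu, hv, h⟩
    · exact h
    · exfalso
      have : v ∈ V ∧ ω v = false := by
        refine h.induction (P := fun v => v ∈ V ∧ ω v = false) ?_ ?_
        · have h1 := h.left_mem
          have h2 : u ∈ V := hAV ⟨h1.1, hu⟩
          exact ⟨h2, by simpa using fun h3 => h1.2 ⟨h2, h3⟩⟩
        · rintro a b - ha hab hb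
          have h2 := hstep a ha.1 ha.2 b hb.1 hab
          exact ⟨h2, by simpa using fun h3 => hb.2 ⟨h2, h3⟩⟩
      have h3 := hNT v this.1 hv
      rw [this.2] at h3
      exact absurd h3 (by simp)
  set P0 : Set Site := {z | Conn (FAdj d) {z | z ∈ S ∧ (z ∈ V ∧ ω z = true)} u0 z} with hP0
  have hP0m : ∀ z ∈ P0, z ∈ S ∧ z ∈ V ∧ ω z = true := fun z hz => hz.right_mem
  obtain ⟨u, v, hu, hv, hvm, huv⟩ := hO
  set K : Set Site := {z | z ∈ D ∧ (z ∈ V ∨ (ω z = true ∧ z ∈ freeSites m n V))} with hK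
  have hvK : v ∈ D := huv.right_mem.1
  have huK : u ∈ D := huv.left_mem.1
  have main : (∃ w ∈ V, ω w = true ∧
      Conn (FAdj d) {z | z ∈ D ∧ ω z = true ∧ (z = w ∨ z ∈ freeSites m n V)} w v) ∨
      CornerCross d m n ω := by
    by_cases hvV : v ∈ V
    · have := hNT v hvV hv
      exact Or.inl ⟨v, hvV, this, Conn.refl ⟨hvK, this, Or.inl rfl⟩⟩
    set X0 : Set Site := {z | Conn (FAdj d) (K \ V) v z} with hX0
    have hX0v : v ∈ X0 := Conn.refl ⟨huv.right_mem, hvV⟩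
    have hKV : ∀ z ∈ K \ V, z ∈ D ∧ ω z = true ∧ z ∈ freeSites m n V := fun z hz =>
      ⟨hz.1.1, hz.1.2.resolve_left hz.2⟩
    by_cases huX : u ∈ X0
    · right
      have hu1 : u.1 = m - n := by
        rcases hu with hu | hu
        · exact hu
        · exfalso
          refine huX.right_mem.2 (hAV ⟨?_, hu.2⟩)
          simp only [hS, hD, rect, Set.mem_ofPred_eq] at *
          omega
      exact ⟨u, v, hu1, hv, hvm, huX.fsymm.mono fun z hz => ⟨(hKV z hz).1, (hKV z hz).2.1⟩⟩
    · left
      obtain ⟨s, w, hvs, hsw, hwK, hwX⟩ := huv.fsymm.first_exit hX0v huX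
      have hsX : s ∈ X0 := hvs.right_mem.2
      have hs := hKV s hsX.right_mem
      have hwV : w ∈ V := by
        by_contra h
        exact hwX (hsX.tail hsw ⟨hwK, h⟩)
      have hwo : ω w = true := by
        by_contra hwc
        have hwc : ω w = false := by simpa using hwc
        have hws := hsw.symm
        by_cases hsS : s ∈ S
        · exact hs.2.2.2.1 (hstep w hwV hwc s hsS hws)
        · have h1 := hVS hwV
          have h2 := hs.1
          have h3 := hws.abs_le
          have h4 : w.1 = m := by
            simp only [hS, hD, rect, Set.mem_ofPred_eq] at hsS h1 h2
            omega
          have h5 := hd.adj (hSD h1) h2 hws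
          rw [mirror_of_eq h4] at h5
          refine hs.2.2.2.2 (hstep w hwV hwc _ ?_ h5)
          simp only [hS, hD, rect, mirror, Set.mem_ofPred_eq] at hsS h1 h2 ⊢
          omega
      refine ⟨w, hwV, hwo, ?_⟩
      have h1 : Conn (FAdj d) {z | z ∈ D ∧ ω z = true ∧ (z = w ∨ z ∈ freeSites m n V)} s v :=
        hsX.fsymm.mono fun z hz => ⟨(hKV z hz).1, (hKV z hz).2.1, Or.inr (hKV z hz).2.2⟩
      exact h1.head ⟨hwK.1, hwo, Or.inl rfl⟩ hsw.symm
  rcases main with ⟨w, hwV, hwo, hwv⟩ | h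
  swap
  · exact h
  by_cases hwP : w ∈ P0
  · refine ⟨u0, v, hu0, hv, hvm, Conn.trans (hwP.mono ?_) (hwv.mono ?_)⟩
    · exact fun z hz => ⟨hSD hz.1, hz.2.2⟩
    · exact fun z hz => ⟨hz.1, hz.2.1⟩
  exfalso
  obtain ⟨a, ha, haw⟩ : ∃ a ∈ A₀, Conn (FAdj d) ({z | z ∈ V ∧ ω z = false} ∪ {w}) a w := by
    rw [hVdef] at hwV ⊢
    exact exists_conn_of_mem_reach hwV
  set T : Set Site := ({z | z ∈ V ∧ ω z = false} ∪ {w}) ∪ {z | z ∈ D ∧ z ∈ freeSites m n V} with hT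
  have hTc : Conn (FAdj d) T a v := by
    refine (haw.mono fun z hz => Or.inl hz).trans (hwv.mono ?_)
    rintro z ⟨z1, -, rfl | z3⟩
    · exact Or.inl (Or.inr rfl)
    · exact Or.inr ⟨z1, z3⟩
  have hTD : T ⊆ D := by
    rintro z ((hz | rfl) | hz)
    · exact hSD (hVS hz.1)
    · exact hSD (hVS hwV)
    · exact hz.1
  have hPD : P0 ⊆ D := fun z hz => hSD (hP0m z hz).1
  have hPc : Conn (FAdj d) (P0 ∪ {z | mirror m z ∈ P0}) u0 (mirror m u0) := by
    have h1 := h0.self_cluster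
    have h2 := hd.conn h1 hPD (Y := {z | mirror m z ∈ P0}) (fun z hz => by
      rw [Set.mem_ofPred_eq, mirror_mirror]; exact hz)
    rw [mirror_of_eq hm0] at h2
    exact (h1.mono fun z hz => Or.inl hz).trans (h2.fsymm.mono fun z hz => Or.inr hz)
  have hPD' : P0 ∪ {z | mirror m z ∈ P0} ⊆ D := by
    rintro z (hz | hz)
    · exact hPD hz
    · have := mirror_mem_rect (hPD hz)
      rwa [mirror_mirror] at this
  obtain ⟨z, hz1, hz2⟩ := crossings_meet hPD' hTD hPc hTc hu0
    (by simp only [mirror]; omega) ha.2 hv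
  have hcol : mirror m z ∈ P0 → z ∈ V → mirror m z = z := by
    intro h1 h2
    have h3 := (hP0m _ h1).1
    have h4 := hVS h2
    apply mirror_of_eq
    simp only [hS, mirror, rect, Set.mem_ofPred_eq] at h3 h4
    omega
  rcases hz1 with hz1 | hz1
  · have h1 := hP0m z hz1
    rcases hz2 with (hz2 | rfl) | hz2
    · have := hz2.2
      rw [h1.2.2] at this
      exact absurd this (by simp)
    · exact hwP hz1
    · exact hz2.2.2.1 h1.2.1
  · have h1 := hP0m _ hz1
    rcases hz2 with (hz2 | rfl) | hz2
    · have h2 := hcol hz1 hz2.1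
      have := hz2.2
      rw [h2] at h1
      rw [h1.2.2] at this
      exact absurd this (by simp)
    · have h2 := hcol hz1 hwV
      rw [Set.mem_ofPred_eq, h2] at hz1
      exact hwP hz1
    · exact hz2.2.2.2 h1.2.1

theorem dep_relCross (V : Set Site) :
    Dep (rect (m - n) (m + n) 0 n \ V) (RelCross d m n V) := by
  rintro ω ω' hω ⟨u, v, hu, hv, hvm, h⟩
  refine ⟨u, v, hu, hv, hvm, h.mono ?_⟩
  rintro z ⟨h1, h2 | h2⟩
  · exact ⟨h1, Or.inl h2⟩
  · exact ⟨h1, Or.inr ⟨(hω z ⟨h1, h2.2.2.1⟩).symm.trans h2.1, h2.2⟩⟩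

theorem dep_cornerCross : Dep (rect (m - n) (m + n) 0 n) (CornerCross d m n) :=
  fun _ _ hω ⟨u, v, hu, hv, hvm, h⟩ => ⟨u, v, hu, hv, hvm, conn_congr hω h⟩

theorem incr_cornerCross : Incr (CornerCross d m n) :=
  fun _ _ hω ⟨u, v, hu, hv, hvm, h⟩ => ⟨u, v, hu, hv, hvm, conn_incr hω h⟩

theorem IsBernoulliHalf.pr_relCross (hμ : IsBernoulliHalf μ) (hd : Mirrored d m n) (hn : 1 ≤ n)
    {V : Set Site} (hV : V ⊆ rect (m - n) m 0 n) (hV0 : ∀ x, m - n ≤ x → x ≤ m → (x, 0) ∈ V) :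
    1 / 2 ≤ pr μ (RelCross d m n V) := by
  have hfin := rect_finite (m - n) (m + n) 0 n
  have hdep : Dep (rect (m - n) (m + n) 0 n) (RelCross d m n V) :=
    (dep_relCross V).mono Set.sdiff_subset
  have hdep' : Dep (rect (m - n) (m + n) 0 n) fun ω => RelCross d m n V (ω ∘ mirror m) := by
    intro ω ω' hω
    exact hdep _ _ fun v hv => hω _ (mirror_mem_rect hv)
  have h1 : pr μ (fun ω => RelCross d m n V ω ∨ RelCross d m n V fun z => !ω (mirror m z)) = 1 := by
    have := hμ.1
    have : {ω | RelCross d m n V ω ∨ RelCross d m n V fun z => !ω (mirror m z)} = Set.univ :=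
      Set.eq_univ_of_forall (relCross_or hd hn hV hV0)
    unfold pr
    rw [this]
    simp
  have h2 : pr μ (fun ω => RelCross d m n V fun z => !ω (mirror m z)) = pr μ (RelCross d m n V) := by
    rw [← hμ.pr_comap hfin hdep (mirror_injective m)]
    exact hμ.pr_flip hfin hdep'
  have h3 := hμ.pr_or_le (E := RelCross d m n V) (F := fun ω => RelCross d m n V fun z => !ω (mirror m z))
  rw [h1, h2] at h3
  linarith

theorem IsBernoulliHalf.pr_cornerCross (hμ : IsBernoulliHalf μ) (hd : Mirrored d m n) (hn : 1 ≤ n) :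
    1 / 4 ≤ pr μ (CornerCross d m n) := by
  set S := rect (m - n) m 0 n with hS
  set A₀ : Set Site := {z | z ∈ S ∧ z.2 = 0} with hA₀
  set V : Config → Set Site := fun ω => reach (FAdj d) S A₀ false ω with hV
  have hVS : ∀ ω, V ω ⊆ S := fun ω => reach_subset fun z hz => hz.1
  have hSD : S ⊆ rect (m - n) (m + n) 0 n := by
    intro z hz
    simp only [hS, rect, Set.mem_ofPred_eq] at *
    omega
  have key := hμ.explore (rect_finite (m - n) (m + n) 0 n) (V := V)
    (G := fun S ω => ∀ v ∈ S, v.2 = n → ω v = true) (O := fun _ _ => True)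
    (O' := fun S => RelCross d m n S) (κ := 1 / 2) (fun ω => (hVS ω).trans hSD)
    (fun ω ω' h => reach_congr h) (fun S ω ω' h hG v hv hn => (h v hv).symm.trans (hG v hv hn))
    (fun _ _ _ _ _ => trivial) (fun S => dep_relCross S) (by
      intro ω _
      have h1 := hμ.pr_relCross hd hn (hVS ω) (fun x h1 h2 => subset_reach ⟨by
        simp only [hS, rect, Set.mem_ofPred_eq]; omega, rfl⟩)
      have h2 := hμ.pr_le_one (E := fun _ => True)
      linarith)
  have h1 : pr μ (fun ω => (∀ v ∈ V ω, v.2 = n → ω v = true) ∧ True) = 1 / 2 := by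
    rw [← hμ.pr_square (d := d) (x₀ := m - n) (y₀ := 0) (n := n) (c := true) (β := hd.choose)
      (by omega) (fun x h1 h2 => hd.choose_spec.1 x h1 (by omega))]
    refine pr_congr fun ω => ?_
    rw [hcross_iff_not_vcross (by omega) (by omega), and_true]
    rw [show m - n + n = m by ring, show 0 + n = n by ring]
    constructor
    · rintro h ⟨u, v, hu, hv, huv⟩
      have h1 := mem_reach_of_conn (A₀ := A₀) (Λ := S) (c := false) (ω := ω)
        ⟨huv.left_mem.1, hu⟩ (by simpa using huv)
      have := h v h1.1 hv
      rw [h1.2] at this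
      exact absurd this (by simp)
    · intro h v hv hvn
      by_contra hcl
      obtain ⟨a, ha, hav⟩ := exists_conn_of_mem_reach hv
      refine h ⟨a, v, ha.2, hvn, hav.mono ?_⟩
      rintro z (hz | rfl)
      · exact ⟨hVS ω hz.1, by simpa using hz.2⟩
      · exact ⟨hVS ω hv, by simpa using hcl⟩
  have h2 : pr μ (fun ω => (∀ v ∈ V ω, v.2 = n → ω v = true) ∧ RelCross d m n (V ω) ω) ≤
      pr μ (CornerCross d m n) :=
    hμ.pr_mono fun ω h => cornerCross_of_relCross hd hn rfl h.1 h.2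
  rw [h1] at key
  linarith

/-- Crossing a pair of mirror symmetric squares. -/
theorem IsBernoulliHalf.pr_HCross_mirrored (hμ : IsBernoulliHalf μ) (hd : Mirrored d m n)
    (hn : 1 ≤ n) :
    1 / 16 ≤ pr μ fun ω => HCross d (m - n) (m + n) 0 n fun v => ω v = true := by
  have hfin := rect_finite (m - n) (m + n) 0 n
  have h0 := hμ.pr_cornerCross hd hn
  have h1 := hμ.pr_comap hfin (dep_cornerCross (d := d)) (mirror_injective m)
  have h2 := hμ.harris hfin (dep_cornerCross (d := d))
    (F := fun ω => CornerCross d m n (ω ∘ mirror m))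
    (fun ω ω' hω => dep_cornerCross _ _ fun v hv => hω _ (mirror_mem_rect hv)) incr_cornerCross
    (fun ω ω' hω => incr_cornerCross _ _ fun v => hω _)
  rw [h1] at h2
  have h3 : pr μ (fun ω => CornerCross d m n ω ∧ CornerCross d m n (ω ∘ mirror m)) ≤
      pr μ fun ω => HCross d (m - n) (m + n) 0 n fun v => ω v = true := by
    refine hμ.pr_mono ?_
    rintro ω ⟨⟨u, v, hu, hv, hvm, huv⟩, u', v', hu', hv', hvm', huv'⟩
    have h4 := hd.conn huv' (Y := {z | z ∈ rect (m - n) (m + n) 0 n ∧ ω z = true})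
      (fun z hz => hz.1) (fun z hz => ⟨mirror_mem_rect hz.1, hz.2⟩)
    by_contra hno
    set X : Set Site := {z | z ∈ rect (m - n) (m + n) 0 n ∧ ω z = true} with hX
    have hdisj : Disjoint {z | Conn (FAdj d) X (mirror m u') z} {z | Conn (FAdj d) X v z} := by
      rw [Set.disjoint_left]
      intro z hz hz'
      refine hno ⟨u, mirror m u', hu, by simp only [mirror]; omega, ?_⟩
      exact (huv.trans hz').trans hz.fsymm
    have r1 := huv.left_mem.1
    have r2 := huv.right_mem.1
    have r3 := h4.left_mem.1
    have r4 := h4.right_mem.1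
    have n1 : mirror m u' ≠ v := fun h =>
      Set.disjoint_left.1 hdisj (Conn.refl h4.left_mem) (by rw [h]; exact Conn.refl huv.right_mem)
    have n2 : mirror m v' ≠ v := fun h =>
      Set.disjoint_left.1 hdisj h4 (by rw [h]; exact Conn.refl huv.right_mem)
    have n3 : mirror m v' ≠ u := fun h =>
      Set.disjoint_left.1 hdisj h4 (by rw [h]; exact huv.fsymm)
    have e1 : (mirror m u').1 = m + n := by simp only [mirror]; omega
    rw [ne_eq, Prod.ext_iff] at n1 n2 n3
    simp only [rect, mirror, Set.mem_ofPred_eq] at r1 r2 r3 r4 n1 n2 n3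
    refine rect_crossing (d := d) (x₀ := m - n) (x₁ := m + n) (y₀ := 0) (y₁ := n)
      (fun z hz => hz.right_mem.1) (fun z hz => hz.right_mem.1) hdisj h4.self_cluster
      huv.fsymm.self_cluster
      (pa := m + n + 1 + (u'.2 - 0)) (pb := m + n + 1 + (n - 0) + (m + n - v.1))
      (pc := m + n + 1 + (n - 0) + (m + n - (2 * m - v'.1)))
      (pe := m + n + 1 + (n - 0) + (m + n - (m - n)) + (n - u.2))
      ⟨h4.left_mem.1, ?_⟩ ⟨huv.right_mem.1, ?_⟩ ⟨h4.right_mem.1, ?_⟩ ⟨huv.left_mem.1, ?_⟩ ?_ ?_ ?_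
    · simp only [mirror, and_true]; omega
    · omega
    · simp only [mirror, and_true]; omega
    · omega
    · omega
    · omega
    · omega
  nlinarith

end Reflection

section Slab

variable {adj : Site → Site → Prop} {A B : Set Site} {u v : Site} {x₀ x₁ : ℤ}

theorem Conn.above (f : Site → ℤ) (hf : ∀ a b, adj a b → f b ≤ f a + 1)
    (h : Conn adj A u v) (hu : f u ≤ x₀) (hv : x₀ ≤ f v) :
    ∃ u', f u' = x₀ ∧ Conn adj {z | z ∈ A ∧ x₀ ≤ f z} u' v := by
  have key : f v < x₀ ∨ ∃ u', f u' = x₀ ∧ Conn adj {z | z ∈ A ∧ x₀ ≤ f z} u' v := by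
    refine h.induction (P := fun v => f v < x₀ ∨
      ∃ u', f u' = x₀ ∧ Conn adj {z | z ∈ A ∧ x₀ ≤ f z} u' v) ?_ ?_
    · rcases hu.lt_or_eq with hu | hu
      · exact Or.inl hu
      · exact Or.inr ⟨u, hu, Conn.refl ⟨h.left_mem, hu.ge⟩⟩
    · rintro a b hab' ha hab hb
      rcases lt_or_ge (f b) x₀ with h1 | h1
      · exact Or.inl h1
      right
      rcases ha with ha | ⟨u', hu', ha⟩
      · have := hf a b hab
        have h2 : f b = x₀ := by omega
        exact ⟨b, h2, Conn.refl ⟨hb, h1⟩⟩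
      · exact ⟨u', hu', ha.tail hab ⟨hb, h1⟩⟩
  exact key.resolve_left (by omega)

/-- A walk across a slab contains a crossing of the slab. -/
theorem Conn.slab (f : Site → ℤ) (hs : ∀ a b, adj a b → adj b a)
    (hf : ∀ a b, adj a b → f b ≤ f a + 1) (h : Conn adj A u v) (hu : f u ≤ x₀) (hv : x₁ ≤ f v)
    (h01 : x₀ ≤ x₁) : ∃ u' v', f u' = x₀ ∧ f v' = x₁ ∧
      Conn adj {z | z ∈ A ∧ x₀ ≤ f z ∧ f z ≤ x₁} u' v' := by
  obtain ⟨u', hu', h1⟩ := h.above f hf hu (h01.trans hv)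
  obtain ⟨v', hv', h2⟩ := (h1.symm hs).above (fun z => -f z) (x₀ := -x₁)
    (fun a b hab => by have := hf b a (hs _ _ hab); omega) (by omega) (by omega)
  refine ⟨u', v', hu', by omega, (h2.symm hs).mono ?_⟩
  rintro z ⟨⟨z1, z2⟩, z3⟩
  exact ⟨z1, z2, by omega⟩

end Slab

section Crossings

variable {d : ℤ → Bool} {x₀ x₁ x₂ x₃ y₀ y₁ : ℤ} {κ : Site → Prop} {μ : Measure Config}

/-- Walks crossing a rectangle in both directions meet. -/
theorem conns_meet {A B : Set Site} {u v s t : Site} (hA : Conn (FAdj d) A u v)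
    (hB : Conn (FAdj d) B s t) (hx : x₀ ≤ x₁) (hy : y₀ ≤ y₁)
    (hu : u.1 ≤ x₀) (hv : x₁ ≤ v.1) (hs : s.2 ≤ y₀) (ht : y₁ ≤ t.2)
    (hA' : ∀ z ∈ A, x₀ ≤ z.1 → z.1 ≤ x₁ → y₀ ≤ z.2 ∧ z.2 ≤ y₁)
    (hB' : ∀ z ∈ B, y₀ ≤ z.2 → z.2 ≤ y₁ → x₀ ≤ z.1 ∧ z.1 ≤ x₁) : ∃ z, z ∈ A ∧ z ∈ B := by
  obtain ⟨u', v', hu', hv', h1⟩ := hA.slab Prod.fst (fun _ _ h => h.symm)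
    (fun a b h => h.abs_le.2.1) hu hv hx
  obtain ⟨s', t', hs', ht', h2⟩ := hB.slab Prod.snd (fun _ _ h => h.symm)
    (fun a b h => h.abs_le.2.2.2) hs ht hy
  obtain ⟨z, z1, z2⟩ := crossings_meet (fun z hz => ⟨hz.2.1, hz.2.2, hA' z hz.1 hz.2.1 hz.2.2⟩)
    (fun z hz => ⟨(hB' z hz.1 hz.2.1 hz.2.2).1, (hB' z hz.1 hz.2.1 hz.2.2).2, hz.2⟩)
    h1 h2 hu' hv' hs' ht'
  exact ⟨z, z1.1, z2.1⟩

theorem HCross.glue (h1 : HCross d x₀ x₂ y₀ y₁ κ) (hv : VCross d x₁ x₂ y₀ y₁ κ)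
    (h2 : HCross d x₁ x₃ y₀ y₁ κ) (h01 : x₀ ≤ x₁) (h12 : x₁ ≤ x₂) (h23 : x₂ ≤ x₃) (hy : y₀ ≤ y₁) :
    HCross d x₀ x₃ y₀ y₁ κ := by
  obtain ⟨u, v, hu, hv', huv⟩ := h1
  obtain ⟨p, q, hp, hq, hpq⟩ := hv
  obtain ⟨s, t, hs, ht, hst⟩ := h2
  obtain ⟨z, z1, z2⟩ := conns_meet huv.self_cluster hpq.self_cluster h12 hy (by omega)
    (by omega) (by omega) (by omega) (fun z hz _ _ => hz.right_mem.1.2.2)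
    (fun z hz _ _ => ⟨hz.right_mem.1.1, hz.right_mem.1.2.1⟩)
  obtain ⟨w, w1, w2⟩ := conns_meet hst.self_cluster hpq.self_cluster h12 hy (by omega)
    (by omega) (by omega) (by omega) (fun z hz _ _ => hz.right_mem.1.2.2)
    (fun z hz _ _ => ⟨hz.right_mem.1.1, hz.right_mem.1.2.1⟩)
  have m1 : ∀ z ∈ {z | z ∈ rect x₀ x₂ y₀ y₁ ∧ κ z}, z ∈ {z | z ∈ rect x₀ x₃ y₀ y₁ ∧ κ z} := by
    rintro z ⟨⟨a, b, c⟩, e⟩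
    exact ⟨⟨a, by omega, c⟩, e⟩
  have m2 : ∀ z ∈ {z | z ∈ rect x₁ x₂ y₀ y₁ ∧ κ z}, z ∈ {z | z ∈ rect x₀ x₃ y₀ y₁ ∧ κ z} := by
    rintro z ⟨⟨a, b, c⟩, e⟩
    exact ⟨⟨by omega, by omega, c⟩, e⟩
  have m3 : ∀ z ∈ {z | z ∈ rect x₁ x₃ y₀ y₁ ∧ κ z}, z ∈ {z | z ∈ rect x₀ x₃ y₀ y₁ ∧ κ z} := by
    rintro z ⟨⟨a, b, c⟩, e⟩
    exact ⟨⟨by omega, b, c⟩, e⟩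
  exact ⟨u, t, hu, ht, (z1.mono m1).trans ((z2.mono m2).fsymm.trans ((w2.mono m2).trans
    ((w1.mono m3).fsymm.trans (hst.mono m3))))⟩

theorem IsBernoulliHalf.pr_glue (hμ : IsBernoulliHalf μ) (h01 : x₀ ≤ x₁) (h12 : x₁ ≤ x₂)
    (h23 : x₂ ≤ x₃) (hy : y₀ ≤ y₁) :
    pr μ (fun ω => HCross d x₀ x₂ y₀ y₁ fun v => ω v = true) *
      pr μ (fun ω => VCross d x₁ x₂ y₀ y₁ fun v => ω v = true) *
      pr μ (fun ω => HCross d x₁ x₃ y₀ y₁ fun v => ω v = true) ≤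
    pr μ (fun ω => HCross d x₀ x₃ y₀ y₁ fun v => ω v = true) := by
  have hf := rect_finite x₀ x₃ y₀ y₁
  have d1 : Dep (rect x₀ x₃ y₀ y₁) fun ω => HCross d x₀ x₂ y₀ y₁ fun v => ω v = true :=
    dep_HCross.mono fun z hz => ⟨hz.1, by have := hz.2.1; omega, hz.2.2⟩
  have d2 : Dep (rect x₀ x₃ y₀ y₁) fun ω => VCross d x₁ x₂ y₀ y₁ fun v => ω v = true :=
    dep_VCross.mono fun z hz => ⟨by have := hz.1; omega, by have := hz.2.1; omega, hz.2.2⟩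
  have d3 : Dep (rect x₀ x₃ y₀ y₁) fun ω => HCross d x₁ x₃ y₀ y₁ fun v => ω v = true :=
    dep_HCross.mono fun z hz => ⟨by have := hz.1; omega, hz.2⟩
  have h1 := hμ.harris hf d1 d2 incr_HCross incr_VCross
  have h2 := hμ.harris hf (d1.and d2) d3
    (fun ω ω' h he => ⟨incr_HCross ω ω' h he.1, incr_VCross ω ω' h he.2⟩) incr_HCross
  refine (mul_le_mul_of_nonneg_right h1 pr_nonneg).trans (h2.trans (hμ.pr_mono ?_))
  rintro ω ⟨⟨a, b⟩, c⟩
  exact a.glue b c h01 h12 h23 hy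

theorem IsBernoulliHalf.pr_HCross_three (hμ : IsBernoulliHalf μ) {n : ℤ} (hn : 1 ≤ n)
    (h1 : ∀ x, 0 ≤ x → x < n → d x = false) (h2 : ∀ x, n ≤ x → x < 2 * n → d x = true)
    (h3 : ∀ x, 2 * n ≤ x → x < 3 * n → d x = false) :
    1 / 512 ≤ pr μ (fun ω => HCross d 0 (3 * n) 0 n fun v => ω v = true) := by
  have k1 := hμ.pr_HCross_mirrored (d := d) (m := n) (n := n)
    ⟨false, fun x _ _ => h1 x (by omega) (by omega), fun x _ _ => h2 x (by omega) (by omega)⟩ hn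
  have k2 := hμ.pr_HCross_mirrored (d := d) (m := 2 * n) (n := n)
    ⟨true, fun x _ _ => h2 x (by omega) (by omega), fun x _ _ => h3 x (by omega) (by omega)⟩ hn
  have k3 := hμ.pr_square' (d := d) (x₀ := n) (y₀ := 0) (n := n) (c := true) (β := true) (by omega)
    (fun x _ _ => h2 x (by omega) (by omega))
  have k4 := hμ.pr_glue (d := d) (x₀ := 0) (x₁ := n) (x₂ := 2 * n) (x₃ := 3 * n) (y₀ := 0) (y₁ := n)
    (by omega) (by omega) (by omega) (by omega)
  rw [show n - n = 0 by ring, show n + n = 2 * n by ring] at k1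
  rw [show 2 * n - n = n by ring, show 2 * n + n = 3 * n by ring] at k2
  rw [show n + n = 2 * n by ring, show 0 + n = n by ring] at k3
  rw [k3] at k4
  refine le_trans ?_ k4
  nlinarith

/-- The direction of the diagonals in the standard embedding of the triangular lattice. -/
abbrev std : ℤ → Bool := fun _ => false

theorem IsBernoulliHalf.pr_HCross_std (hμ : IsBernoulliHalf μ) {n : ℤ} (hn : 1 ≤ n) :
    1 / 512 ≤ pr μ (fun ω => HCross std 0 (3 * n) 0 (2 * n) fun v => ω v = true) := by
  set d : ℤ → Bool := fun x => decide (n ≤ x ∧ x < 2 * n) with hd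
  set s : ℤ → ℤ := fun x => if x ≤ n then 0 else if x ≤ 2 * n then x - n else n with hs
  set ψ : Site → Site := fun v => (v.1, v.2 + n - s v.1) with hψ
  have hψi : Function.Injective ψ := by
    rintro ⟨x, y⟩ ⟨z, w⟩ h
    simp only [hψ, Prod.mk.injEq] at h ⊢
    obtain ⟨rfl, h⟩ := h
    exact ⟨rfl, by omega⟩
  have k1 := hμ.pr_HCross_three (d := d) hn (fun x _ _ => by simp only [hd, decide_eq_false_iff_not]; omega)
    (fun x _ _ => by simp only [hd, decide_eq_true_eq]; omega)
    (fun x _ _ => by simp only [hd, decide_eq_false_iff_not]; omega)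
  rw [← hμ.pr_comap (rect_finite _ _ _ _) dep_HCross hψi] at k1
  refine k1.trans (hμ.pr_mono ?_)
  rintro ω ⟨u, v, hu, hv, h⟩
  refine ⟨ψ u, ψ v, hu, hv, h.map ψ ?_ ?_⟩
  · rintro ⟨a1, a2⟩ ⟨b1, b2⟩ ha hb hab
    simp only [FAdj, rect, hd, hψ, hs, Set.mem_ofPred_eq, decide_eq_false_iff_not, decide_eq_true_eq,
      and_true, reduceCtorEq, and_false, or_false] at *
    obtain ⟨ha, -⟩ := ha
    obtain ⟨hb, -⟩ := hb
    clear hψi k1 h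
    rcases hab with h | h | h | h | h | h <;> split_ifs <;> omega
  · rintro ⟨a1, a2⟩ ⟨ha, hω⟩
    refine ⟨?_, hω⟩
    simp only [rect, hψ, hs, Set.mem_ofPred_eq] at *
    split_ifs <;> omega

theorem IsBernoulliHalf.pr_HCross_long (hμ : IsBernoulliHalf μ) {n : ℤ} (hn : 1 ≤ n) (j : ℕ) :
    (1 / 1024 : ℝ) ^ (j + 1) ≤
      pr μ (fun ω => HCross std 0 ((j + 3 : ℕ) * n) 0 (2 * n) fun v => ω v = true) := by
  induction j with
  | zero =>
    have := hμ.pr_HCross_std hn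
    norm_num
    linarith
  | succ j ih =>
    have hj : (0 : ℤ) ≤ j * n := by positivity
    have k1 := hμ.pr_HCross_std hn
    have k2 := hμ.pr_HCross_translate (d := std) (d' := std) (x₀ := 0) (x₁ := 3 * n) (y₀ := 0)
      (y₁ := 2 * n) (c := true) (j * n + n) 0 (fun _ _ _ => rfl)
    have k3 := hμ.pr_square' (d := std) (x₀ := j * n + n) (y₀ := 0) (n := 2 * n) (c := true)
      (β := false) (by omega) (fun _ _ _ => rfl)
    have k4 := hμ.pr_glue (d := std) (x₀ := 0) (x₁ := j * n + n) (x₂ := (j + 3 : ℕ) * n)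
      (x₃ := (j + 1 + 3 : ℕ) * n) (y₀ := 0) (y₁ := 2 * n)
      (by omega) (by push_cast; linarith) (by push_cast; linarith) (by omega)
    rw [show 0 + (j * n + n) = j * n + n by ring,
      show 3 * n + (j * n + n) = (j + 1 + 3 : ℕ) * n by push_cast; ring, add_zero, add_zero] at k2
    rw [show j * n + n + 2 * n = (j + 3 : ℕ) * n by push_cast; ring, zero_add] at k3
    rw [k3] at k4
    have k5 := k1.trans k2
    refine le_trans ?_ k4
    rw [pow_succ]
    calc (1 / 1024 : ℝ) ^ (j + 1) * (1 / 1024) = (1 / 1024) ^ (j + 1) * (1 / 2) * (1 / 512) := by ring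
      _ ≤ _ := mul_le_mul (mul_le_mul_of_nonneg_right ih (by norm_num)) k5 (by norm_num)
        (mul_nonneg pr_nonneg (by norm_num))

theorem IsBernoulliHalf.pr_HCross_strip (hμ : IsBernoulliHalf μ) {n : ℤ} (hn : 1 ≤ n) (x y : ℤ) :
    (1 / 1024 : ℝ) ^ 6 ≤
      pr μ (fun ω => HCross std x (x + 8 * n) y (y + 2 * n) fun v => ω v = true) := by
  have k1 := hμ.pr_HCross_long hn 5
  have k2 := hμ.pr_HCross_translate (d := std) (d' := std) (x₀ := 0) (x₁ := (5 + 3 : ℕ) * n)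
    (y₀ := 0) (y₁ := 2 * n) (c := true) x y (fun _ _ _ => rfl)
  refine (k1.trans k2).trans (le_of_eq ?_)
  congr! 3 <;> push_cast <;> ring

theorem IsBernoulliHalf.pr_VCross_strip (hμ : IsBernoulliHalf μ) {n : ℤ} (hn : 1 ≤ n) (x y : ℤ) :
    (1 / 1024 : ℝ) ^ 6 ≤
      pr μ (fun ω => VCross std x (x + 2 * n) y (y + 8 * n) fun v => ω v = true) := by
  rw [hμ.pr_VCross_swap (fun _ _ _ => rfl)]
  exact hμ.pr_HCross_strip hn y x

/-- The half-annulus between the boxes of radii `s` and `2 s`. -/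
def halfAnn (a b s : ℤ) : Set Site :=
  {z | z ∈ rect (a - 2 * s) (a + 2 * s) b (b + 4 * s) ∧
    (z.1 ≤ a - s ∨ a + s ≤ z.1 ∨ b + 3 * s ≤ z.2)}

/-- A half-circuit in the half-annulus. -/
def HalfCircuit (a b s : ℤ) (κ : Site → Prop) : Prop :=
  ∃ u v : Site, u.2 = b ∧ a + s ≤ u.1 ∧ u.1 ≤ a + 2 * s ∧ v.2 = b ∧ a - 2 * s ≤ v.1 ∧ v.1 ≤ a - s ∧
    Conn (FAdj std) {z | z ∈ halfAnn a b s ∧ κ z} u v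

theorem halfCircuit_of_crossings {a b s : ℤ} (hs : 0 ≤ s)
    (h1 : VCross std (a + s) (a + 2 * s) b (b + 4 * s) κ)
    (h2 : HCross std (a - 2 * s) (a + 2 * s) (b + 3 * s) (b + 4 * s) κ)
    (h3 : VCross std (a - 2 * s) (a - s) b (b + 4 * s) κ) : HalfCircuit a b s κ := by
  obtain ⟨u, v, hu, hv, huv⟩ := h1
  obtain ⟨p, q, hp, hq, hpq⟩ := h2
  obtain ⟨x, y, hx, hy, hxy⟩ := h3
  obtain ⟨z, z1, z2⟩ := conns_meet (x₀ := a + s) (x₁ := a + 2 * s) (y₀ := b + 3 * s)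
    (y₁ := b + 4 * s) hpq.self_cluster huv.self_cluster (by omega) (by omega) (by omega)
    (by omega) (by omega) (by omega) (fun z hz _ _ => hz.right_mem.1.2.2)
    (fun z hz _ _ => ⟨hz.right_mem.1.1, hz.right_mem.1.2.1⟩)
  obtain ⟨w, w1, w2⟩ := conns_meet (x₀ := a - 2 * s) (x₁ := a - s) (y₀ := b + 3 * s)
    (y₁ := b + 4 * s) hpq.self_cluster hxy.self_cluster (by omega) (by omega) (by omega)
    (by omega) (by omega) (by omega) (fun z hz _ _ => hz.right_mem.1.2.2)
    (fun z hz _ _ => ⟨hz.right_mem.1.1, hz.right_mem.1.2.1⟩)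
  have r1 := huv.left_mem.1
  have r2 := hxy.left_mem.1
  refine ⟨u, x, hu, r1.1, r1.2.1, hx, r2.1, r2.2.1, (z2.mono ?_).trans ((z1.mono ?_).fsymm.trans
    ((w1.mono ?_).trans (w2.mono ?_).fsymm))⟩ <;>
  · rintro z ⟨hz, hk⟩
    refine ⟨?_, hk⟩
    simp only [halfAnn, rect, Set.mem_ofPred_eq] at *
    omega

theorem dep_HalfCircuit {a b s : ℤ} {c : Bool} :
    Dep (halfAnn a b s) fun ω => HalfCircuit a b s fun v => ω v = c :=
  fun _ _ hω ⟨u, v, h1, h2, h3, h4, h5, h6, h⟩ => ⟨u, v, h1, h2, h3, h4, h5, h6, conn_congr hω h⟩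

theorem halfAnn_subset {a b s : ℤ} : halfAnn a b s ⊆ rect (a - 2 * s) (a + 2 * s) b (b + 4 * s) :=
  fun _ h => h.1

theorem IsBernoulliHalf.pr_HalfCircuit (hμ : IsBernoulliHalf μ) {n : ℤ} (hn : 1 ≤ n) (a b : ℤ)
    (c : Bool) :
    ((1 / 1024 : ℝ) ^ 6) ^ 3 ≤ pr μ (fun ω => HalfCircuit a b (2 * n) fun v => ω v = c) := by
  have hf := rect_finite (a - 2 * (2 * n)) (a + 2 * (2 * n)) b (b + 4 * (2 * n))
  have htrue : ((1 / 1024 : ℝ) ^ 6) ^ 3 ≤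
      pr μ (fun ω => HalfCircuit a b (2 * n) fun v => ω v = true) := by
    have k1 := hμ.pr_VCross_strip hn (a + 2 * n) b
    have k2 := hμ.pr_HCross_strip hn (a - 2 * (2 * n)) (b + 3 * (2 * n))
    have k3 := hμ.pr_VCross_strip hn (a - 2 * (2 * n)) b
    rw [show a + 2 * n + 2 * n = a + 2 * (2 * n) by ring,
      show b + 8 * n = b + 4 * (2 * n) by ring] at k1
    rw [show a - 2 * (2 * n) + 8 * n = a + 2 * (2 * n) by ring,
      show b + 3 * (2 * n) + 2 * n = b + 4 * (2 * n) by ring] at k2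
    rw [show a - 2 * (2 * n) + 2 * n = a - 2 * n by ring,
      show b + 8 * n = b + 4 * (2 * n) by ring] at k3
    have d1 : Dep (rect (a - 2 * (2 * n)) (a + 2 * (2 * n)) b (b + 4 * (2 * n))) fun ω =>
        VCross std (a + 2 * n) (a + 2 * (2 * n)) b (b + 4 * (2 * n)) fun v => ω v = true :=
      dep_VCross.mono fun z hz => ⟨by have := hz.1; omega, hz.2⟩
    have d2 : Dep (rect (a - 2 * (2 * n)) (a + 2 * (2 * n)) b (b + 4 * (2 * n))) fun ω =>
        HCross std (a - 2 * (2 * n)) (a + 2 * (2 * n)) (b + 3 * (2 * n)) (b + 4 * (2 * n))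
          fun v => ω v = true :=
      dep_HCross.mono fun z hz => ⟨hz.1, hz.2.1, by have := hz.2.2; omega⟩
    have d3 : Dep (rect (a - 2 * (2 * n)) (a + 2 * (2 * n)) b (b + 4 * (2 * n))) fun ω =>
        VCross std (a - 2 * (2 * n)) (a - 2 * n) b (b + 4 * (2 * n)) fun v => ω v = true :=
      dep_VCross.mono fun z hz => ⟨hz.1, by have := hz.2.1; omega, hz.2.2⟩
    have h1 := hμ.harris hf d1 d2 incr_VCross incr_HCross
    have h2 := hμ.harris hf (d1.and d2) d3
      (fun ω ω' h he => ⟨incr_VCross ω ω' h he.1, incr_HCross ω ω' h he.2⟩) incr_VCross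
    have h3 : (1 / 1024 : ℝ) ^ 6 * (1 / 1024) ^ 6 ≤ _ :=
      (mul_le_mul k1 k2 (by positivity) pr_nonneg).trans h1
    have h4 : (1 / 1024 : ℝ) ^ 6 * (1 / 1024) ^ 6 * (1 / 1024) ^ 6 ≤ _ :=
      (mul_le_mul h3 k3 (by positivity) pr_nonneg).trans h2
    rw [pow_succ _ 2, pow_two]
    refine h4.trans (hμ.pr_mono ?_)
    rintro ω ⟨⟨e1, e2⟩, e3⟩
    exact halfCircuit_of_crossings (by omega) e1 e2 e3
  cases c
  · rw [← hμ.pr_flip hf (dep_HalfCircuit.mono halfAnn_subset)] at htrue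
    simpa using htrue
  · exact htrue

theorem IsBernoulliHalf.harris_decr (hμ : IsBernoulliHalf μ) {Λ : Set Site} {E F : Config → Prop}
    (hΛ : Λ.Finite) (hE : Dep Λ E) (hF : Dep Λ F) (iE : ∀ ω ω', ω' ≤ ω → E ω → E ω')
    (iF : ∀ ω ω', ω' ≤ ω → F ω → F ω') :
    pr μ E * pr μ F ≤ pr μ (fun ω => E ω ∧ F ω) := by
  have hn : ∀ {G : Config → Prop}, Dep Λ G → Dep Λ fun ω => G fun v => !ω v :=
    fun hG ω ω' h => hG _ _ fun v hv => by rw [h v hv]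
  have hm : ∀ ω ω' : Config, ω ≤ ω' → (fun v => !ω' v) ≤ fun v => !ω v := by
    intro ω ω' h v
    have := h v
    cases h1 : ω v <;> cases h2 : ω' v <;> simp_all
  rw [← hμ.pr_flip hΛ hE, ← hμ.pr_flip hΛ hF, ← hμ.pr_flip hΛ (hE.and hF)]
  exact hμ.harris hΛ (hn hE) (hn hF) (fun ω ω' h => iE _ _ (hm ω ω' h))
    fun ω ω' h => iF _ _ (hm ω ω' h)

end Crossings

/-- The horseshoe between the boxes of radii `r` and `R`. -/
def horseshoe (a b r R : ℤ) : Set Site := hBox a b R \ hBox a b r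

/-- The sites with a neighbour in the box of radius `r`. -/
def nearBox (a b r : ℤ) : Set Site := {u | ∃ w ∈ hBox a b r, FAdj std w u}

/-- The sites of the upper half plane outside the box of radius `R`. -/
def outerRegion (a b R : ℤ) : Set Site := {z | b ≤ z.2 ∧ z ∉ hBox a b R}

section
variable {a b r R : ℤ}

theorem mem_horseshoe {z : Site} : z ∈ horseshoe a b r R ↔
    (a - R ≤ z.1 ∧ z.1 ≤ a + R ∧ b ≤ z.2 ∧ z.2 ≤ b + 2 * R) ∧
      ¬ (a - r ≤ z.1 ∧ z.1 ≤ a + r ∧ b ≤ z.2 ∧ z.2 ≤ b + 2 * r) := Iff.rfl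

theorem hBox_finite : (hBox a b r).Finite := rect_finite _ _ _ _

theorem horseshoe_finite : (horseshoe a b r R).Finite := hBox_finite.subset Set.sdiff_subset

theorem conn_hBox_center {w : Site} (hw : w ∈ hBox a b r) :
    Conn (FAdj std) (hBox a b r) (a, b) w := by
  obtain ⟨x, y⟩ := w
  obtain ⟨h1, h2, h3, h4⟩ := hw
  simp only at h1 h2 h3 h4
  have h5 : Conn (FAdj std) (hBox a b r) (x, b) (x, y) :=
    conn_vseg h3 fun z hz hz' => ⟨h1, h2, hz, by simp only; omega⟩
  rcases le_total a x with h | h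
  · refine Conn.trans (conn_hseg h fun z hz hz' => ?_) h5
    simp only [hBox, Set.mem_ofPred_eq, le_refl, true_and]
    omega
  · refine Conn.trans (Conn.fsymm (conn_hseg h fun z hz hz' => ?_)) h5
    simp only [hBox, Set.mem_ofPred_eq, le_refl, true_and]
    omega

theorem conn_outerRegion (hR : 0 ≤ R) {w : Site} (hw : w ∈ outerRegion a b R) :
    Conn (FAdj std) (outerRegion a b R) w (a + R + 1, b) := by
  obtain ⟨x, y⟩ := w
  have key : ∀ {y' : ℤ}, b + 2 * R < y' → ∀ x, 
      Conn (FAdj std) (outerRegion a b R) (x, y') (a + R + 1, b) := by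
    intro y' hy x
    have h5 : Conn (FAdj std) (outerRegion a b R) (a + R + 1, y') (a + R + 1, b) := by
      refine (conn_vseg (by omega) fun z hz hz' => ?_).fsymm
      simp only [outerRegion, hBox, Set.mem_ofPred_eq]
      omega
    rcases le_total x (a + R + 1) with h | h
    · refine (conn_hseg h fun z hz hz' => ?_).trans h5
      simp only [outerRegion, hBox, Set.mem_ofPred_eq]
      omega
    · refine (conn_hseg h fun z hz hz' => ?_).fsymm.trans h5
      simp only [outerRegion, hBox, Set.mem_ofPred_eq]
      omega
  simp only [outerRegion, hBox, Set.mem_ofPred_eq] at hw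
  by_cases h : b + 2 * R < y
  · exact key h x
  · refine Conn.trans ?_ (key (lt_add_one (b + 2 * R)) x)
    refine conn_vseg (by omega) fun z hz hz' => ?_
    simp only [outerRegion, hBox, Set.mem_ofPred_eq]
    omega

theorem exists_fadj_outerRegion {w : Site} (hw : w ∈ hBoxPlus a b R) :
    ∃ t ∈ outerRegion a b R, FAdj std w t := by
  obtain ⟨x, y⟩ := w
  simp only [hBoxPlus, hBox, Set.mem_ofPred_eq] at hw
  simp only [outerRegion, hBox, Set.mem_ofPred_eq]
  rcases hw with ⟨h, h1 | h1 | h1⟩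
  · exact ⟨(x - 1, y), by simp only; omega, by simp [FAdj]⟩
  · exact ⟨(x + 1, y), by simp only; omega, by simp [FAdj]⟩
  · exact ⟨(x, y + 1), by simp only; omega, by simp [FAdj]⟩

/-- A connection from the inner box to the outer boundary extends to a connection between two
boundary sites of the half plane. -/
theorem Conn.extend_arm (hR : 0 ≤ R) {A : Set Site} {u w : Site}
    (hA : Conn (FAdj std) A u w) (hu : u ∈ nearBox a b r) (hw : w ∈ hBoxPlus a b R) :
    Conn (FAdj std) (A ∪ hBox a b r ∪ outerRegion a b R) (a, b) (a + R + 1, b) := by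
  obtain ⟨u', hu', huu⟩ := hu
  obtain ⟨w', hw', hww⟩ := exists_fadj_outerRegion hw
  have h1 := (conn_hBox_center hu').mono (T := A ∪ hBox a b r ∪ outerRegion a b R)
    fun z hz => .inl (.inr hz)
  have h2 := hA.mono (T := A ∪ hBox a b r ∪ outerRegion a b R) fun z hz => .inl (.inl hz)
  have h3 := (conn_outerRegion hR hw').mono (T := A ∪ hBox a b r ∪ outerRegion a b R)
    fun z hz => .inr hz
  exact ((h1.tail huu h2.left_mem).trans h2).trans (Conn.head h2.right_mem hww h3)

/-- An arm meets every connection in the horseshoe between the two sides of its bottom. -/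
theorem arm_meets (hR : 0 ≤ R) {A B : Set Site} {u w s t : Site}
    (hA : Conn (FAdj std) A u w) (hu : u ∈ nearBox a b r) (hw : w ∈ hBoxPlus a b R)
    (hB : Conn (FAdj std) B s t) (hAH : A ⊆ horseshoe a b r R) (hBH : B ⊆ horseshoe a b r R)
    (hs : s.2 = b) (hs' : s.1 < a) (ht : t.2 = b) (ht' : a < t.1) : ∃ z, z ∈ A ∧ z ∈ B := by
  by_contra hcon
  have htm := mem_horseshoe.1 (hBH hB.right_mem)
  refine halfPlane_crossing (y₀ := b) (fun v hv => (hBH hv).1.2.2.1) ?_ ?_ hB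
    (hA.extend_arm hR hu hw) hs rfl ht rfl hs' ht' (by simp only; omega)
  · rintro v ((hv | hv) | hv)
    exacts [(hAH hv).1.2.2.1, hv.2.2.1, hv.1]
  · rw [Set.disjoint_left]
    rintro z hz ((hz' | hz') | hz')
    exacts [hcon ⟨z, hz', hz⟩, (hBH hz).2 hz', hz'.2 (hBH hz).1]

/-- A connection in the horseshoe between two bottom sites on the left of the inner box separates
the bottom sites in between from both boxes and from the right. -/
theorem left_connection_meets (hR : 0 ≤ R) {A B : Set Site} {v v' m t : Site}
    (hB : Conn (FAdj std) B v' v) (hA : Conn (FAdj std) A m t)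
    (hAH : A ⊆ horseshoe a b r R) (hBH : B ⊆ horseshoe a b r R)
    (hv : v.2 = b) (hv' : v'.2 = b) (hm : m.2 = b) (h1 : v'.1 < m.1) (h2 : m.1 < v.1)
    (h3 : v.1 < a) (ht : t ∈ nearBox a b r ∨ t ∈ hBoxPlus a b R ∨ (t.2 = b ∧ a < t.1)) :
    ∃ z, z ∈ A ∧ z ∈ B := by
  by_contra hcon
  have hA' := hA.mono (T := A ∪ hBox a b r ∪ outerRegion a b R) fun z hz => .inl (.inl hz)
  obtain ⟨e, he, hve, hc⟩ : ∃ e : Site, e.2 = b ∧ v.1 < e.1 ∧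
      Conn (FAdj std) (A ∪ hBox a b r ∪ outerRegion a b R) m e := by
    rcases ht with ⟨t', ht, htt⟩ | ht | ht
    · exact ⟨(a, b), rfl, h3, hA'.trans (((conn_hBox_center ht).mono
        (fun z hz => .inl (.inr hz))).tail htt hA'.right_mem).fsymm⟩
    · obtain ⟨t', ht, htt⟩ := exists_fadj_outerRegion ht
      exact ⟨(a + R + 1, b), rfl, by simp only; omega, hA'.trans (.head hA'.right_mem htt
        ((conn_outerRegion hR ht).mono fun z hz => .inr hz))⟩
    · exact ⟨t, ht.1, h3.trans ht.2, hA'⟩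
  refine halfPlane_crossing (y₀ := b) (fun v hv => (hBH hv).1.2.2.1) ?_ ?_ hB hc hv' hm hv he
    h1 h2 hve
  · rintro v ((hv | hv) | hv)
    exacts [(hAH hv).1.2.2.1, hv.2.2.1, hv.1]
  · rw [Set.disjoint_left]
    rintro z hz ((hz' | hz') | hz')
    exacts [hcon ⟨z, hz', hz⟩, (hBH hz).2 hz', hz'.2 (hBH hz).1]

/-- Two sites on the boundary of the inner box are joined to the bottom inside the box by disjoint
paths. -/
theorem exists_descents (hr : 1 ≤ r) {u w : Site} (hu : u ∈ hBoxPlus a b r)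
    (hw : w ∈ hBoxPlus a b r) (h : ccw a b r u < ccw a b r w) :
    ∃ (U W : Set Site) (x x' : ℤ), U ⊆ hBox a b r ∧ W ⊆ hBox a b r ∧ Disjoint U W ∧ x' < x ∧
      Conn (FAdj std) U u (x, b) ∧ Conn (FAdj std) W w (x', b) := by
  obtain ⟨u1, u2⟩ := u
  obtain ⟨w1, w2⟩ := w
  simp only [hBoxPlus, hBox, Set.mem_ofPred_eq] at hu hw
  have key : w1 < u1 ∨ (w1 = u1 ∧ u1 = a + r ∧ u2 < w2) ∨ (w1 = u1 ∧ u1 = a - r ∧ w2 < u2) := by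
    simp only [ccw] at h
    split_ifs at h <;> omega
  rcases key with key | ⟨rfl, rfl, key⟩ | ⟨rfl, rfl, key⟩
  · refine ⟨{z | z.1 = u1 ∧ b ≤ z.2 ∧ z.2 ≤ u2}, {z | z.1 = w1 ∧ b ≤ z.2 ∧ z.2 ≤ w2}, u1, w1,
      ?_, ?_, ?_, key, (conn_vseg (by omega) ?_).fsymm, (conn_vseg (by omega) ?_).fsymm⟩
    · rintro ⟨z1, z2⟩ hz
      simp only [hBox, Set.mem_ofPred_eq] at hz ⊢
      omega
    · rintro ⟨z1, z2⟩ hz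
      simp only [hBox, Set.mem_ofPred_eq] at hz ⊢
      omega
    · rw [Set.disjoint_left]
      rintro ⟨z1, z2⟩ hz hz'
      simp only [Set.mem_ofPred_eq] at hz hz'
      omega
    · exact fun z h1 h2 => ⟨rfl, h1, h2⟩
    · exact fun z h1 h2 => ⟨rfl, h1, h2⟩
  · refine ⟨{z | z.1 = a + r ∧ b ≤ z.2 ∧ z.2 ≤ u2},
      {z | z = (a + r, w2) ∨ z.1 = a + r - 1 ∧ b ≤ z.2 ∧ z.2 ≤ w2}, a + r, a + r - 1,
      ?_, ?_, ?_, by omega, (conn_vseg (by omega) ?_).fsymm,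
      .head (.inl rfl) (v := (a + r - 1, w2)) ?_ (conn_vseg (by omega) ?_).fsymm⟩
    · rintro ⟨z1, z2⟩ hz
      simp only [hBox, Set.mem_ofPred_eq] at hz ⊢
      omega
    · rintro ⟨z1, z2⟩ hz
      simp only [hBox, Set.mem_ofPred_eq, Prod.mk.injEq] at hz ⊢
      omega
    · rw [Set.disjoint_left]
      rintro ⟨z1, z2⟩ hz hz'
      simp only [Set.mem_ofPred_eq, Prod.mk.injEq] at hz hz'
      omega
    · exact fun z h1 h2 => ⟨rfl, h1, h2⟩
    · simp [FAdj]
    · exact fun z h1 h2 => .inr ⟨rfl, h1, h2⟩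
  · refine ⟨{z | z = (a - r, u2) ∨ z.1 = a - r + 1 ∧ b ≤ z.2 ∧ z.2 ≤ u2},
      {z | z.1 = a - r ∧ b ≤ z.2 ∧ z.2 ≤ w2}, a - r + 1, a - r,
      ?_, ?_, ?_, by omega, .head (.inl rfl) (v := (a - r + 1, u2)) ?_
        (conn_vseg (by omega) ?_).fsymm, (conn_vseg (by omega) ?_).fsymm⟩
    · rintro ⟨z1, z2⟩ hz
      simp only [hBox, Set.mem_ofPred_eq, Prod.mk.injEq] at hz ⊢
      omega
    · rintro ⟨z1, z2⟩ hz
      simp only [hBox, Set.mem_ofPred_eq] at hz ⊢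
      omega
    · rw [Set.disjoint_left]
      rintro ⟨z1, z2⟩ hz hz'
      simp only [Set.mem_ofPred_eq, Prod.mk.injEq] at hz hz'
      omega
    · simp [FAdj]
    · exact fun z h1 h2 => .inr ⟨rfl, h1, h2⟩
    · exact fun z h1 h2 => ⟨rfl, h1, h2⟩

/-- An arm separates the part of the horseshoe counterclockwise of it from the right bottom. -/
theorem arm_separates (hr : 1 ≤ r) (hR : r < R) {P Q : Set Site} {u u' w t : Site}
    (hu : u ∈ hBoxPlus a b r) (hw : w ∈ hBoxPlus a b r) (h : ccw a b r u < ccw a b r w)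
    (hP : Conn (FAdj std) P u u') (hu' : u' ∈ hBoxPlus a b R)
    (hQ : Conn (FAdj std) Q w t) (hPH : ∀ z ∈ P, z = u ∨ z ∈ horseshoe a b r R)
    (hQH : ∀ z ∈ Q, z = w ∨ z ∈ horseshoe a b r R) (ht : t.2 = b) (ht' : a + r < t.1) :
    ∃ z, z ∈ P ∧ z ∈ Q := by
  by_contra hcon
  obtain ⟨U, W, x, x', hU, hW, hUW, hx, hu0, hw0⟩ := exists_descents hr hu hw h
  obtain ⟨e, he, hee⟩ := exists_fadj_outerRegion hu'
  have hPe := ((hu0.fsymm.mono (T := P ∪ U ∪ outerRegion a b R) fun z hz => .inl (.inr hz)).trans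
    (hP.mono fun z hz => .inl (.inl hz))).trans (.head (.inl (.inl hP.right_mem)) hee
      ((conn_outerRegion (by omega) he).mono fun z hz => .inr hz))
  have hQe := (hw0.fsymm.mono (T := Q ∪ W) fun z hz => .inr hz).trans (hQ.mono fun z hz => .inl hz)
  have hxb : x ≤ a + r := (hU hu0.right_mem).2.1
  have ht2 : t.1 ≤ a + R := by
    rcases hQH t hQ.right_mem with h | h
    · have := hw.1.2.1
      rw [h] at ht'; omega
    · exact h.1.2.1
  have hQb : ∀ z ∈ Q, z ∈ hBox a b R ∧ b ≤ z.2 := by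
    intro z hz
    rcases hQH z hz with rfl | h
    · have := hw.1
      simp only [hBox, Set.mem_ofPred_eq] at this ⊢
      omega
    · exact ⟨h.1, h.1.2.2.1⟩
  refine halfPlane_crossing (y₀ := b) (A := Q ∪ W) ?_ ?_ ?_ hQe hPe rfl rfl ht rfl hx
    (by simp only; omega) (by simp only; omega)
  · rintro z (hz | hz)
    exacts [(hQb z hz).2, (hW hz).2.2.1]
  · rintro z ((hz | hz) | hz)
    · rcases hPH z hz with rfl | h
      exacts [hu.1.2.2.1, h.1.2.2.1]
    · exact (hU hz).2.2.1
    · exact hz.1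
  · rw [Set.disjoint_left]
    rintro z (hz | hz) ((hz' | hz') | hz')
    · exact hcon ⟨z, hz', hz⟩
    · rcases hQH z hz with rfl | h
      · exact Set.disjoint_left.1 hUW hz' hw0.left_mem
      · exact h.2 (hU hz')
    · exact hz'.2 (hQb z hz).1
    · rcases hPH z hz' with rfl | h
      · exact Set.disjoint_left.1 hUW hu0.left_mem hz
      · exact h.2 (hW hz)
    · exact Set.disjoint_left.1 hUW hz' hz
    · refine hz'.2 ?_
      have := hW hz
      simp only [hBox, Set.mem_ofPred_eq] at this ⊢
      omega

end

/-- There is a connection of colour `c` inside `D` from the inner box to the outer boundary. -/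
def Arm (a b r R : ℤ) (D : Set Site) (c : Bool) (ω : Config) : Prop :=
  ∃ u ∈ nearBox a b r, ∃ w ∈ hBoxPlus a b R, Conn (FAdj std) {z | z ∈ D ∧ ω z = c} u w

/-- The half circuits at the inner and outer scales exist, using sites of `S` or of colour `c`. -/
def Fenced (a b r n : ℤ) (S : Set Site) (c : Bool) (ω : Config) : Prop :=
  HalfCircuit a b (2 * r) (fun z => z ∈ S ∨ ω z = c) ∧
    HalfCircuit a b (2 * n) (fun z => z ∈ S ∨ ω z = c)

/-- The bottom sites of the horseshoe on the right of the inner box. -/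
def botRight (a b r R : ℤ) : Set Site := {z | z.2 = b ∧ a + r < z.1 ∧ z.1 ≤ a + R}

/-- The bottom sites of the horseshoe on the left strictly between the two half annuli. -/
def botMid (a b r n : ℤ) : Set Site := {z | z.2 = b ∧ a - 2 * n < z.1 ∧ z.1 < a - 4 * r}

section
variable {a b r n R : ℤ} {c : Bool} {ω : Config} {S : Set Site}

theorem botRight_subset (hr : 0 ≤ r) : botRight a b r R ⊆ horseshoe a b r R := by
  rintro ⟨x, y⟩ h
  simp only [botRight, Set.mem_ofPred_eq, mem_horseshoe] at h ⊢
  omega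

theorem botMid_subset (hr : 1 ≤ r) : botMid a b r n ⊆ horseshoe a b r (4 * n) := by
  rintro ⟨x, y⟩ h
  simp only [botMid, Set.mem_ofPred_eq, mem_horseshoe] at h ⊢
  omega

theorem halfAnn_inner_subset (hr : 1 ≤ r) (hrn : r ≤ n) :
    halfAnn a b (2 * r) ⊆ horseshoe a b r (4 * n) := by
  rintro ⟨x, y⟩ h
  simp only [halfAnn, rect, Set.mem_ofPred_eq, mem_horseshoe] at h ⊢
  omega

theorem halfAnn_outer_subset (hr : 1 ≤ r) (hrn : r ≤ n) :
    halfAnn a b (2 * n) ⊆ horseshoe a b r (4 * n) := by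
  rintro ⟨x, y⟩ h
  simp only [halfAnn, rect, Set.mem_ofPred_eq, mem_horseshoe] at h ⊢
  omega

/-- A connection around an arm, using sites of the arm's colour and explored sites, joins its
unexplored end to the arm. -/
theorem joined_to_arm (hR : 0 ≤ R) {u w v e : Site} {κ : Site → Prop}
    (σ : ℤ) (hσ : σ = 1 ∨ σ = -1) (hSH : S ⊆ horseshoe a b r R)
    (hS : ∀ z ∈ S, ∃ s : Site, s.2 = b ∧ σ * s.1 < σ * a ∧ Conn (FAdj std) S s z)
    (hA : Conn (FAdj std) {z | z ∈ horseshoe a b r R \ S ∧ κ z} u w)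
    (hu : u ∈ nearBox a b r) (hw : w ∈ hBoxPlus a b R)
    (hC : Conn (FAdj std) {z | z ∈ horseshoe a b r R ∧ (z ∈ S ∨ κ z)} v e)
    (hv : v.2 = b) (he : e.2 = b) (hv' : σ * a < σ * v.1) (he' : σ * e.1 < σ * a) :
    Conn (FAdj std) {z | z ∈ horseshoe a b r R \ S ∧ κ z} u v := by
  set A := {z | z ∈ horseshoe a b r R \ S ∧ κ z} with hAdef
  have meets : ∀ {B : Set Site} {t : Site}, Conn (FAdj std) B v t → B ⊆ horseshoe a b r R →
      t.2 = b → σ * t.1 < σ * a → ∃ z, Conn (FAdj std) A u z ∧ z ∈ B := by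
    intro B t hB hBH ht ht'
    have hAH : {y | Conn (FAdj std) A u y} ⊆ horseshoe a b r R := fun z hz => hz.right_mem.1.1
    rcases hσ with rfl | rfl
    · exact arm_meets hR hA.self_cluster hu hw hB.fsymm hAH hBH ht (by linarith) hv
        (by linarith)
    · exact arm_meets hR hA.self_cluster hu hw hB hAH hBH hv (by linarith) ht
        (by linarith)
  have hvS : v ∉ S := by
    intro h
    obtain ⟨s, hs, hs', hc⟩ := hS v h
    obtain ⟨z, hz, hz'⟩ := meets hc.fsymm hSH hs hs'
    exact hz.right_mem.1.2 hz'
  have hvA : v ∈ A := ⟨⟨hC.left_mem.1, hvS⟩, hC.left_mem.2.resolve_left hvS⟩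
  by_cases hve : Conn (FAdj std) A v e
  · obtain ⟨z, hz, hz'⟩ := meets hve.self_cluster (fun z hz => hz.right_mem.1.1) he he'
    exact hz.trans hz'.fsymm
  · obtain ⟨s, t, hs, hst, ht, htX⟩ := hC.first_exit (X := {y | Conn (FAdj std) A v y})
      (.refl hvA) hve
    have hsA : Conn (FAdj std) A v s := hs.right_mem.2
    have htS : t ∈ S := by
      by_contra h
      exact htX (hsA.tail hst ⟨⟨ht.1, h⟩, ht.2.resolve_left h⟩)
    obtain ⟨x, hx, hx', hc⟩ := hS t htS
    obtain ⟨z, hz, hz'⟩ := meets (B := {y | Conn (FAdj std) A v y} ∪ S)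
      (.trans (hsA.self_cluster.mono Set.subset_union_left)
        (.head (.inl hsA) hst (hc.fsymm.mono Set.subset_union_right)))
      (fun z hz => hz.elim (fun h => h.right_mem.1.1) fun h => hSH h) hx hx'
    rcases hz' with hz' | hz'
    · exact hz.trans hz'.fsymm
    · exact absurd hz' hz.right_mem.1.2

theorem conn_of_mem_reach {Λ A₀ : Set Site} {z : Site}
    (hz : z ∈ reach (FAdj std) Λ A₀ c ω) :
    ∃ s ∈ A₀, Conn (FAdj std) (reach (FAdj std) Λ A₀ c ω) s z := by
  obtain ⟨s, hs, h⟩ := exists_conn_of_mem_reach hz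
  refine ⟨s, hs, h.mono ?_⟩
  rintro y (hy | rfl)
  exacts [hy.1, hz]

/-- A closed arm not explored from the right is accompanied by an open arm on its right. -/
theorem exists_open_arm (hr : 1 ≤ r) (hR : r < R)
    (h : Arm a b r R (horseshoe a b r R \ reach (FAdj std) (horseshoe a b r R)
      (botRight a b r R) false ω) false ω) :
    Arm a b r R (horseshoe a b r R) true ω := by
  obtain ⟨u, hu, w, hw, hA⟩ := h
  set V := reach (FAdj std) (horseshoe a b r R) (botRight a b r R) false ω with hV
  have hVH : V ⊆ horseshoe a b r R := reach_subset (botRight_subset (by omega))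
  have hleft : ∀ z ∈ V, z.2 = b → a + r < z.1 := by
    intro z hz hzb
    by_contra hza
    obtain ⟨s, hs, hc⟩ := conn_of_mem_reach hz
    have hzH := mem_horseshoe.1 (hVH hz)
    obtain ⟨y, hy, hy'⟩ := arm_meets (by omega) hA hu hw hc.fsymm (fun z hz => hz.1.1)
      hVH hzb (by omega) hs.1 (by have := hs.2.1; omega)
    exact hy.1.2 hy'
  by_contra hno
  set M : Set Site := {z | z.2 = b - 1 ∧ a - r ≤ z.1 ∧ z.1 ≤ a + r} with hM
  set A₁ : Set Site := {z | ∃ u ∈ nearBox a b r,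
    Conn (FAdj std) {z | z ∈ horseshoe a b r R ∧ z ∈ V ∧ ω z = true} u z} with hA₁
  set A : Set Site := hBox a b r ∪ M ∪ A₁ with hAd
  set B : Set Site := {z | z.2 = b - 1 ∧ a + r < z.1} ∪ {z | z ∈ V ∧ ω z = false} with hB
  set κ : Site → Prop := fun z => z ∈ hBox a b r ∨ z ∈ M ∨ (z ∈ V ∧ ω z = true) with hκ
  have hA₁b : ∀ z ∈ A₁, z ∉ hBoxPlus a b R := by
    rintro z ⟨u, hu, hc⟩ hz
    exact hno ⟨u, hu, z, hz, hc.mono fun y hy => ⟨hy.1, hy.2.2⟩⟩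
  have hA₁H : ∀ z ∈ A₁, z ∈ horseshoe a b r R := fun z ⟨_, _, hc⟩ => hc.right_mem.1
  have hcl : Clusters (FAdj std) (rect (a - R) (a + R) (b - 1) (b + 2 * R)) κ A B := by
    constructor
    · rintro z ((hz | hz) | ⟨u, hu, hz⟩)
      exacts [.inl hz, .inr (.inl hz), .inr (.inr hz.right_mem.2)]
    · rintro z (hz | hz) (hk | hk | hk)
      · have := hz.1; have := hk.2.2.1; omega
      · have := hz.2; have := hk.2.2; omega
      · have := hz.1; have := (hVH hk.1).1.2.2.1; omega
      · exact (hVH hz.1).2 hk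
      · have := hk.1; have := (hVH hz.1).1.2.2.1; omega
      · simp [hz.2] at hk
    · rintro x hx y hy hxy (hk | hk | hk)
      · exact .inl (.inl hk)
      · exact .inl (.inr hk)
      · have hyH := hVH hk.1
        right
        rcases hx with (hx | hx) | ⟨u, hu, hx⟩
        · exact ⟨y, ⟨x, hx, hxy⟩, .refl ⟨hyH, hk⟩⟩
        · refine ⟨y, ?_, .refl ⟨hyH, hk⟩⟩
          have hyl := hleft y hk.1
          obtain ⟨x1, x2⟩ := x
          obtain ⟨y1, y2⟩ := y
          rw [mem_horseshoe] at hyH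
          simp only [hM, FAdj, std, reduceCtorEq, and_false, or_false, and_true,
            Set.mem_ofPred_eq] at hx hxy hyH hyl
          omega
        · exact ⟨u, hu, hx.tail hxy ⟨hyH, hk⟩⟩
    · rintro x hx y hy hxy hk
      simp only [hκ, not_or] at hk
      obtain ⟨hk1, hk2, hk3⟩ := hk
      have hyc : y ∈ V → y ∈ B := fun h => .inr ⟨h, by
        by_contra hc
        exact hk3 ⟨h, by simpa using hc⟩⟩
      have hxr : x ∈ V → x.2 = b → a + r < x.1 := hleft x
      have hyr : y ∈ botRight a b r R → y ∈ V := fun h => subset_reach h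
      by_cases hyb : y.2 = b - 1
      · left
        obtain ⟨x1, x2⟩ := x
        obtain ⟨y1, y2⟩ := y
        have hxv : (x1, x2) ∈ V → b ≤ x2 := fun h => (hVH h).1.2.2.1
        simp only [hB, hM, FAdj, std, reduceCtorEq, and_false, or_false, and_true,
          Set.mem_ofPred_eq, Set.mem_union] at hx hxy hyb hk2 hxr hxv ⊢
        rcases hx with hx | hx
        · omega
        · have := hxr hx.1
          have := hxv hx.1
          omega
      · apply hyc
        rcases hx with hx | hx
        · apply hyr
          obtain ⟨x1, x2⟩ := x
          obtain ⟨y1, y2⟩ := y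
          simp only [hBox, botRight, rect, FAdj, std, reduceCtorEq, and_false, or_false, and_true,
            Set.mem_ofPred_eq] at hx hxy hyb hk1 hy ⊢
          omega
        · refine reach_step hx.1 hx.2 hxy ?_
          refine mem_horseshoe.2 ⟨?_, hk1⟩
          simp only [rect, Set.mem_ofPred_eq] at hy
          omega
  obtain ⟨K, hK⟩ := Int.eq_ofNat_of_zero_le (show 0 ≤ R by omega)
  obtain ⟨k, hk⟩ := Int.eq_ofNat_of_zero_le (show 0 ≤ r by omega)
  have st := flux_rect hcl (a - R) (b - 1) (2 * K) (2 * K + 1) (by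
    rintro ⟨z1, z2⟩ hz
    simp only [rect, Set.mem_ofPred_eq] at *
    push_cast at hz
    omega)
  have hAx : ∀ z : Site, b - 1 ≤ z.2 → z.2 ≤ b + 2 * R → a - R ≤ z.1 → z.1 ≤ a + R →
      (z.1 = a - R ∨ z.1 = a + R ∨ z.2 = b + 2 * R) → z ∉ A := by
    rintro ⟨z1, z2⟩ h1 h2 h3 h4 h5 ((hz | hz) | hz)
    · simp only [hBox, Set.mem_ofPred_eq] at *
      omega
    · simp only [hM, Set.mem_ofPred_eq] at *
      omega
    · exact hA₁b _ hz ⟨⟨h3, h4, (hA₁H _ hz).1.2.2.1, h2⟩, h5⟩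
  have hAr : ∀ x : ℤ, (x, b - 1) ∈ A ↔ a - r ≤ x ∧ x ≤ a + r := by
    intro x
    constructor
    · rintro ((hz | hz) | hz)
      · have := hz.2.2.1; simp only at this; omega
      · exact hz.2
      · have := (hA₁H _ hz).1.2.2.1; simp only at this; omega
    · exact fun h => .inl (.inr ⟨rfl, h⟩)
  have hBr : ∀ x : ℤ, (x, b - 1) ∈ B ↔ a + r < x := by
    intro x
    constructor
    · rintro (hz | hz)
      · exact hz.2
      · have := (hVH hz.1).1.2.2.1; simp only at this; omega
    · exact fun h => .inl ⟨rfl, h⟩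
  rw [Finset.sum_eq_single (K + k), Finset.sum_eq_zero, Finset.sum_eq_zero, Finset.sum_eq_zero] at st
  · have e : a - R + ((K + k : ℕ) : ℤ) = a + r := by push_cast; omega
    rw [e] at st
    simp only [flux, hAr, hBr] at st
    rw [if_neg (by omega), if_pos (by omega)] at st
    omega
  · intro i hi
    have := Finset.mem_range.1 hi
    apply flux_eq_zero_of_notMem_left <;> apply hAx <;> push_cast <;> omega
  · intro i hi
    have := Finset.mem_range.1 hi
    apply flux_eq_zero_of_notMem_left <;> apply hAx <;> push_cast <;> omega
  · intro i hi
    have := Finset.mem_range.1 hi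
    apply flux_eq_zero_of_notMem_left <;> apply hAx <;> push_cast <;> omega
  · intro i hi hne
    simp only [flux, hAr, hBr]
    rw [if_neg (by omega), if_neg (by omega)]
    omega
  · intro h
    exact absurd (Finset.mem_range.2 (by omega)) h

/-- A connection of closed sites from the inner to the outer half annulus along the left bottom. -/
def LeftJoin (a b r n : ℤ) (ω : Config) : Prop :=
  ∃ v' v : Site, v.2 = b ∧ a - 4 * r ≤ v.1 ∧ v.1 ≤ a - 2 * r ∧ v'.2 = b ∧ v'.1 ≤ a - 2 * n ∧
    Conn (FAdj std) {z | z ∈ horseshoe a b r (4 * n) ∧ ω z = false} v' v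

theorem conn_halfAnn_inner (hr : 1 ≤ r) (hrn : r ≤ n) {κ : Site → Prop} {u v : Site}
    (h : Conn (FAdj std) {z | z ∈ halfAnn a b (2 * r) ∧ κ z} u v) :
    Conn (FAdj std) {z | z ∈ horseshoe a b r (4 * n) ∧ κ z} u v :=
  h.mono fun _ hz => ⟨halfAnn_inner_subset hr hrn hz.1, hz.2⟩

theorem conn_halfAnn_outer (hr : 1 ≤ r) (hrn : r ≤ n) {κ : Site → Prop} {u v : Site}
    (h : Conn (FAdj std) {z | z ∈ halfAnn a b (2 * n) ∧ κ z} u v) :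
    Conn (FAdj std) {z | z ∈ horseshoe a b r (4 * n) ∧ κ z} u v :=
  h.mono fun _ hz => ⟨halfAnn_outer_subset hr hrn hz.1, hz.2⟩

theorem leftJoin_of_fenced (hr : 1 ≤ r) (hrn : r ≤ n)
    (hS : S = reach (FAdj std) (horseshoe a b r (4 * n)) (botRight a b r (4 * n)) false ω)
    (h : Arm a b r (4 * n) (horseshoe a b r (4 * n) \ S) false ω)
    (hf : Fenced a b r n S false ω) : LeftJoin a b r n ω := by
  obtain ⟨u, hu, w, hw, hA⟩ := h
  have hSH : S ⊆ horseshoe a b r (4 * n) :=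
    hS ▸ reach_subset (botRight_subset (by omega))
  have hS' : ∀ z ∈ S, ∃ s : Site, s.2 = b ∧ -1 * s.1 < -1 * a ∧ Conn (FAdj std) S s z := by
    intro z hz
    rw [hS] at hz ⊢
    obtain ⟨s, hs, hc⟩ := conn_of_mem_reach hz
    exact ⟨s, hs.1, by have := hs.2.1; omega, hc⟩
  obtain ⟨⟨e, v, he, he1, -, hv, hv1, hv2, hc⟩, ⟨e', v', he', he1', -, hv', hv1', hv2', hc'⟩⟩ := hf
  have h1 := joined_to_arm (by omega) (-1) (by omega) hSH hS' hA hu hw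
    (conn_halfAnn_inner hr hrn hc).fsymm hv he (by omega) (by omega)
  have h2 := joined_to_arm (by omega) (-1) (by omega) hSH hS' hA hu hw
    (conn_halfAnn_outer hr hrn hc').fsymm hv' he' (by omega) (by omega)
  exact ⟨v', v, hv, by omega, hv2, hv', hv2', (h2.fsymm.trans h1).mono fun z hz => ⟨hz.1.1, hz.2⟩⟩

/-- No site of `S` open in `ω` is next to one of the two boxes or on the right of the bottom. -/
def Blocked (a b r R : ℤ) (S : Set Site) (ω : Config) : Prop :=
  ∀ z ∈ S, ω z = true → z ∉ nearBox a b r ∧ z ∉ hBoxPlus a b R ∧ ¬ (z.2 = b ∧ a < z.1)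

theorem blocked_of_leftJoin (hr : 1 ≤ r) (hrn : r ≤ n) (h : LeftJoin a b r n ω)
    (hS : S = reach (FAdj std) (horseshoe a b r (4 * n)) (botMid a b r n) true ω) :
    Blocked a b r (4 * n) S ω := by
  intro z hz hzo
  by_contra hcon
  obtain ⟨v', v, hv, hv1, hv2, hv', hv2', hc⟩ := h
  rw [hS] at hz
  obtain ⟨s, hs, hsz⟩ := exists_conn_of_mem_reach hz
  have hsz' : Conn (FAdj std) {z | z ∈ horseshoe a b r (4 * n) ∧ ω z = true} s z := by
    refine hsz.mono ?_
    rintro y (hy | rfl)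
    exacts [⟨reach_subset (botMid_subset hr) hy.1, hy.2⟩,
      ⟨reach_subset (botMid_subset hr) hz, hzo⟩]
  obtain ⟨y, hy, hy'⟩ := left_connection_meets (by omega) hc hsz' (fun z hz => hz.1)
    (fun z hz => hz.1) hv hv' hs.1 (by have := hs.2.1; omega) (by have := hs.2.2; omega) (by omega)
    (by tauto)
  simp [hy.2] at hy'

theorem arm_unexplored (h : Arm a b r (4 * n) (horseshoe a b r (4 * n)) true ω)
    (hS : S = reach (FAdj std) (horseshoe a b r (4 * n)) (botMid a b r n) true ω)
    (hb : Blocked a b r (4 * n) S ω) :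
    Arm a b r (4 * n) (horseshoe a b r (4 * n) \ S) true ω := by
  obtain ⟨u, hu, w, hw, hc⟩ := h
  refine ⟨u, hu, w, hw, hc.induction (.refl ⟨⟨hc.left_mem.1, fun h => ?_⟩, hc.left_mem.2⟩) ?_⟩
  · exact (hb u h hc.left_mem.2).1 hu
  · intro x y hx hux hxy hy
    refine hux.tail hxy ⟨⟨hy.1, fun h => hux.right_mem.1.2 ?_⟩, hy.2⟩
    rw [hS] at h ⊢
    exact reach_step h hy.2 hxy.symm hx.right_mem.1

/-- An open connection on the right joins the half annuli, and none leaves the left bottom. -/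
def LastSeparation (a b r n : ℤ) (ω : Config) : Prop :=
  (∃ u u' : Site, u.2 = b ∧ a + 2 * r ≤ u.1 ∧ u.1 ≤ a + 4 * r ∧ u'.2 = b ∧ a + 2 * n ≤ u'.1 ∧
    Conn (FAdj std) {z | z ∈ horseshoe a b r (4 * n) ∧ ω z = true} u u') ∧
  ∀ s ∈ botMid a b r n, ∀ t,
    Conn (FAdj std) {z | z ∈ horseshoe a b r (4 * n) ∧ ω z = true} s t →
      t ∉ nearBox a b r ∧ t ∉ hBoxPlus a b (4 * n) ∧ ¬ (t.2 = b ∧ a < t.1)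

theorem lastSeparation_of_fenced (hr : 1 ≤ r) (hrn : r ≤ n)
    (hS : S = reach (FAdj std) (horseshoe a b r (4 * n)) (botMid a b r n) true ω)
    (hb : Blocked a b r (4 * n) S ω)
    (h : Arm a b r (4 * n) (horseshoe a b r (4 * n) \ S) true ω)
    (hf : Fenced a b r n S true ω) : LastSeparation a b r n ω := by
  refine ⟨?_, fun s hs t ht => ?_⟩
  swap
  · obtain ⟨h1, h2⟩ := mem_reach_of_conn hs ht
    exact hb t (hS ▸ h1) h2
  obtain ⟨u, hu, w, hw, hA⟩ := h
  have hSH : S ⊆ horseshoe a b r (4 * n) := hS ▸ reach_subset (botMid_subset hr)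
  have hS' : ∀ z ∈ S, ∃ s : Site, s.2 = b ∧ 1 * s.1 < 1 * a ∧ Conn (FAdj std) S s z := by
    intro z hz
    rw [hS] at hz ⊢
    obtain ⟨s, hs, hc⟩ := conn_of_mem_reach hz
    exact ⟨s, hs.1, by have := hs.2.2; omega, hc⟩
  obtain ⟨⟨e, v, he, he1, he2, hv, hv1, hv2, hc⟩, ⟨e', v', he', he1', -, hv', hv1', hv2', hc'⟩⟩ := hf
  have h1 := joined_to_arm (by omega) 1 (by omega) hSH hS' hA hu hw
    (conn_halfAnn_inner hr hrn hc) he hv (by omega) (by omega)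
  have h2 := joined_to_arm (by omega) 1 (by omega) hSH hS' hA hu hw
    (conn_halfAnn_outer hr hrn hc') he' hv' (by omega) (by omega)
  exact ⟨e, e', he, he1, by omega, he', he1', (h1.fsymm.trans h2).mono fun z hz => ⟨hz.1.1, hz.2⟩⟩

/-- The event `LastSeparation` occurs for at most one of two suitably shifted horseshoes. -/
theorem LastSeparation.not_shift (hr : 1 ≤ r) {a' : ℤ} (h1 : a + 8 * r < a')
    (h2 : a' < a + 2 * n - r) (h : LastSeparation a b r n ω) : ¬ LastSeparation a' b r n ω := by
  rintro ⟨-, h'⟩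
  obtain ⟨⟨u, u', hu, hu1, hu2, hu', hu1', hc⟩, -⟩ := h
  have hum : u ∈ botMid a' b r n := ⟨hu, by omega, by omega⟩
  have hs : ∀ t, Conn (FAdj std) ({z | z ∈ horseshoe a b r (4 * n) ∧ ω z = true} ∩
      horseshoe a' b r (4 * n)) u t → t ∉ nearBox a' b r ∧ t ∉ hBoxPlus a' b (4 * n) ∧
        ¬ (t.2 = b ∧ a' < t.1) :=
    fun t ht => h' u hum t (ht.mono fun z hz => ⟨hz.2, hz.1.2⟩)
  have huH := botMid_subset hr hum
  by_cases hu'H : u' ∈ horseshoe a' b r (4 * n) ∧ Conn (FAdj std)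
      ({z | z ∈ horseshoe a b r (4 * n) ∧ ω z = true} ∩ horseshoe a' b r (4 * n)) u u'
  · exact (hs u' hu'H.2).2.2 ⟨hu', by omega⟩
  · obtain ⟨s, t, hus, hst, ht, htX⟩ := hc.first_exit (X := {y | Conn (FAdj std)
      ({z | z ∈ horseshoe a b r (4 * n) ∧ ω z = true} ∩ horseshoe a' b r (4 * n)) u y})
      (.refl ⟨hc.left_mem, huH⟩) fun h => hu'H ⟨h.right_mem.2, h⟩
    have hus' := hus.right_mem.2
    obtain ⟨g1, g2, -⟩ := hs s hus'
    have htH : t ∉ horseshoe a' b r (4 * n) := fun h => htX (hus'.tail hst ⟨ht, h⟩)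
    by_cases htb : t ∈ hBox a' b r
    · exact g1 ⟨t, htb, hst.symm⟩
    · apply g2
      have htB : t ∉ hBox a' b (4 * n) := fun h => htH ⟨h, htb⟩
      have hsB : s ∈ hBox a' b (4 * n) := hus'.right_mem.2.1
      have htb : b ≤ t.2 := ht.1.1.2.2.1
      have := hst.abs_le
      refine ⟨hsB, ?_⟩
      simp only [hBox, Set.mem_ofPred_eq] at htB hsB
      omega

end

section
variable {a b r n R : ℤ} {c : Bool} {ω : Config} {S : Set Site} {μ : Measure Config}

theorem HorseArm.exists_conn {p : List Site} (h : HorseArm a b r R p) :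
    ∃ u ∈ hBoxPlus a b r, ∃ w ∈ hBoxPlus a b R, p.head? = some u ∧ p.getLast? = some w ∧
      Conn (FAdj std) {z | z ∈ p} u w ∧ ∀ z ∈ p, z = u ∨ z ∈ horseshoe a b r R := by
  obtain ⟨⟨hp, -, hch⟩, ⟨u, hu, hpu⟩, ⟨w, hw, hpw⟩, ht⟩ := h
  rw [adj_eq_fadj] at hch
  refine ⟨u, hu, w, hw, hpu, hpw, conn_of_chain hch (fun _ h => h) hpu hpw, ?_⟩
  cases p with
  | nil => simp
  | cons x l =>
    intro z hz
    simp only [List.head?_cons, Option.some.injEq] at hpu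
    rcases List.mem_cons.1 hz with h | h
    · exact .inl (h.trans hpu)
    · exact .inr (ht z h)

theorem J2.exists_arm (hr : 1 ≤ r) (hR : r < R) (h : J2 a b r R ω) :
    Arm a b r R (horseshoe a b r R \ reach (FAdj std) (horseshoe a b r R)
      (botRight a b r R) false ω) false ω := by
  obtain ⟨p, q, hp, hpo, hq, hqc, hd, hin, -⟩ := h
  obtain ⟨u, hu, u', hu', hpu, -, hpc, hpH⟩ := hp.exists_conn
  obtain ⟨w, hw, w', hw', hqw, -, hqq, hqH⟩ := hq.exists_conn
  have hlt := hin u w hpu hqw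
  have hwn : w' ∉ hBox a b r := by
    obtain ⟨h1, h2⟩ := hw'
    simp only [hBox, Set.mem_ofPred_eq] at h1 ⊢
    omega
  obtain ⟨s, t, hs, hsB, hst, htB, hc⟩ := hqq.last_exit (X := hBox a b r) hw.1 hwn
  refine ⟨t, ⟨s, hsB, hst⟩, w', hw', hc.self_cluster.mono ?_⟩
  intro z hz
  have hzq : z ∈ q := hz.right_mem.1
  have hzH : z ∈ horseshoe a b r R := (hqH z hzq).resolve_left fun h => by
    subst h
    exact hz.right_mem.2 hw.1
  refine ⟨⟨hzH, fun hzV => ?_⟩, hqc z hzq⟩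
  obtain ⟨x, hx, hxz⟩ := exists_conn_of_mem_reach hzV
  have hwz : Conn (FAdj std) {z | z ∈ q} w z :=
    (hs.tail hst hc.left_mem.1).trans (hz.mono fun y hy => hy.1)
  have hxq : Conn (FAdj std) ({z | z ∈ q} ∪ {y | y ∈ horseshoe a b r R ∧ ω y = false}) z x := by
    refine hxz.fsymm.mono ?_
    rintro y (hy | hy)
    · exact .inr ⟨reach_subset (botRight_subset (by omega)) hy.1, hy.2⟩
    · exact .inl (Set.mem_singleton_iff.1 hy ▸ hzq)
  obtain ⟨y, hy, hy'⟩ := arm_separates hr hR hu hw hlt hpc hu'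
    ((hwz.mono Set.subset_union_left).trans hxq) hpH
    (fun z hz => hz.elim (hqH z) fun h => .inr h.1) hx.1 hx.2.1
  have hyo := hpo y hy
  rcases hy' with hy' | hy'
  · exact hd hy hy'
  · simp [hyo] at hy'

/-- Events monotone in the set of sites of colour `c` are positively correlated. -/
theorem IsBernoulliHalf.harris_colour (hμ : IsBernoulliHalf μ) {Λ : Set Site} {E F : Config → Prop}
    (hΛ : Λ.Finite) (hE : Dep Λ E) (hF : Dep Λ F)
    (iE : ∀ ω ω' : Config, (∀ v, ω v = c → ω' v = c) → E ω → E ω')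
    (iF : ∀ ω ω' : Config, (∀ v, ω v = c → ω' v = c) → F ω → F ω') :
    pr μ E * pr μ F ≤ pr μ (fun ω => E ω ∧ F ω) := by
  cases c
  · refine hμ.harris_decr hΛ hE hF (fun ω ω' h => iE ω ω' fun v hv => ?_)
      (fun ω ω' h => iF ω ω' fun v hv => ?_) <;>
    · have := h v
      rw [hv] at this
      exact le_bot_iff.1 this
  · refine hμ.harris hΛ hE hF (fun ω ω' h => iE ω ω' fun v hv => ?_)
      (fun ω ω' h => iF ω ω' fun v hv => ?_) <;>
    · have := h v
      rw [hv] at this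
      exact top_le_iff.1 this

theorem HalfCircuit.mono {s : ℤ} {κ κ' : Site → Prop} (h : HalfCircuit a b s κ)
    (hκ : ∀ z ∈ halfAnn a b s, κ z → κ' z) : HalfCircuit a b s κ' := by
  obtain ⟨u, v, h1, h2, h3, h4, h5, h6, h⟩ := h
  exact ⟨u, v, h1, h2, h3, h4, h5, h6, h.mono fun z hz => ⟨hz.1, hκ z hz.1 hz.2⟩⟩

theorem dep_HalfCircuit_union {s : ℤ} {Λ : Set Site} (hs : halfAnn a b s ⊆ Λ) :
    Dep (Λ \ S) fun ω => HalfCircuit a b s fun z => z ∈ S ∨ ω z = c := by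
  intro ω ω' hω h
  refine h.mono fun z hz hk => ?_
  by_cases hzS : z ∈ S
  · exact .inl hzS
  · exact .inr ((hω z ⟨hs hz, hzS⟩) ▸ hk.resolve_left hzS)

theorem dep_Arm {D : Set Site} : Dep D fun ω => Arm a b r R D c ω :=
  fun _ _ hω ⟨u, hu, w, hw, h⟩ => ⟨u, hu, w, hw, conn_congr hω h⟩

/-- The probability bound for a half circuit. -/
noncomputable abbrev circuitConst : ℝ := ((1 / 1024 : ℝ) ^ 6) ^ 3

theorem IsBernoulliHalf.pr_arm_fenced (hμ : IsBernoulliHalf μ) (hr : 1 ≤ r) (hrn : r ≤ n)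
    (S : Set Site) :
    circuitConst ^ 2 * pr μ (Arm a b r (4 * n) (horseshoe a b r (4 * n) \ S) c) ≤
      pr μ (fun ω => Arm a b r (4 * n) (horseshoe a b r (4 * n) \ S) c ω ∧
        Fenced a b r n S c ω) := by
  have hfin : (horseshoe a b r (4 * n) \ S).Finite := horseshoe_finite.subset Set.sdiff_subset
  have d1 := dep_HalfCircuit_union (S := S) (c := c) (halfAnn_inner_subset (a := a) (b := b) hr hrn)
  have d2 := dep_HalfCircuit_union (S := S) (c := c) (halfAnn_outer_subset (a := a) (b := b) hr hrn)
  have i : ∀ s, ∀ ω ω' : Config, (∀ v, ω v = c → ω' v = c) →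
      HalfCircuit a b s (fun z => z ∈ S ∨ ω z = c) →
      HalfCircuit a b s (fun z => z ∈ S ∨ ω' z = c) :=
    fun s ω ω' hω h => h.mono fun z _ hz => hz.imp_right (hω z)
  have p : ∀ k : ℤ, 1 ≤ k →
      circuitConst ≤ pr μ (fun ω => HalfCircuit a b (2 * k) fun z => z ∈ S ∨ ω z = c) :=
    fun k hk => (hμ.pr_HalfCircuit hk a b c).trans
      (hμ.pr_mono fun ω h => h.mono fun z _ hz => .inr hz)
  have h1 := hμ.harris_colour hfin d1 d2 (i _) (i _)
  have h2 := hμ.harris_colour (E := Arm a b r (4 * n) (horseshoe a b r (4 * n) \ S) c) hfin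
    dep_Arm (d1.and d2)
    (fun ω ω' hω ⟨u, hu, w, hw, h⟩ => ⟨u, hu, w, hw, h.mono fun z hz => ⟨hz.1, hω z hz.2⟩⟩)
    (fun ω ω' hω h => ⟨i _ ω ω' hω h.1, i _ ω ω' hω h.2⟩)
  refine le_trans ?_ h2
  rw [mul_comm]
  refine mul_le_mul_of_nonneg_left ?_ pr_nonneg
  refine le_trans ?_ h1
  rw [sq]
  exact mul_le_mul (p r hr) (p n (hr.trans hrn)) (by positivity) pr_nonneg

theorem IsBernoulliHalf.pr_fence (hμ : IsBernoulliHalf μ) (hr : 1 ≤ r) (hrn : r ≤ n)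
    {A₀ : Set Site} (hA₀ : A₀ ⊆ horseshoe a b r (4 * n)) {G : Set Site → Config → Prop}
    (hG : ∀ S, Dep S (G S)) {V : Config → Set Site}
    (hV : ∀ ω, V ω = reach (FAdj std) (horseshoe a b r (4 * n)) A₀ c ω) :
    circuitConst ^ 2 * pr μ (fun ω => G (V ω) ω ∧
        Arm a b r (4 * n) (horseshoe a b r (4 * n) \ V ω) c ω) ≤
      pr μ (fun ω => G (V ω) ω ∧ (Arm a b r (4 * n) (horseshoe a b r (4 * n) \ V ω) c ω ∧
        Fenced a b r n (V ω) c ω)) := by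
  refine hμ.explore horseshoe_finite (fun ω => hV ω ▸ reach_subset hA₀) (fun ω ω' h => ?_) hG
    (O := fun S ω => Arm a b r (4 * n) (horseshoe a b r (4 * n) \ S) c ω)
    (O' := fun S ω => Arm a b r (4 * n) (horseshoe a b r (4 * n) \ S) c ω ∧ Fenced a b r n S c ω)
    (fun S => dep_Arm) (fun S => dep_Arm.and ((dep_HalfCircuit_union
      (halfAnn_inner_subset hr hrn)).and (dep_HalfCircuit_union (halfAnn_outer_subset hr hrn))))
    fun ω _ => hμ.pr_arm_fenced hr hrn _
  rw [hV] at h ⊢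
  rw [hV]
  exact reach_congr h

theorem dep_Blocked : Dep S (Blocked a b r R S) :=
  fun _ _ hω h z hz hzo => h z hz ((hω z hz).trans hzo)

theorem IsBernoulliHalf.pr_J2_le_lastSeparation (hμ : IsBernoulliHalf μ) (hr : 1 ≤ r)
    (hrn : r ≤ n) :
    circuitConst ^ 4 * pr μ (J2 a b r (4 * n)) ≤ pr μ (LastSeparation a b r n) := by
  have h1 := hμ.pr_fence (c := false) (G := fun _ _ => True) hr hrn
    (botRight_subset (a := a) (b := b) (r := r) (by omega)) (fun _ _ _ _ _ => trivial)
    (fun _ => rfl)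
  have h2 := hμ.pr_fence (c := true) hr hrn (botMid_subset (a := a) (b := b) hr)
    (fun S => dep_Blocked (S := S) (a := a) (b := b) (r := r) (R := 4 * n)) (fun _ => rfl)
  have h0 := hμ.pr_mono (E := J2 a b r (4 * n)) fun ω h =>
    (⟨trivial, h.exists_arm hr (by omega)⟩ : True ∧ _)
  have h3 := hμ.pr_mono fun ω (h : True ∧ Arm a b r (4 * n) (horseshoe a b r (4 * n) \
      reach (FAdj std) (horseshoe a b r (4 * n)) (botRight a b r (4 * n)) false ω) false ω ∧
      Fenced a b r n (reach (FAdj std) (horseshoe a b r (4 * n)) (botRight a b r (4 * n)) false ω)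
        false ω) =>
    have hb := blocked_of_leftJoin hr hrn (leftJoin_of_fenced hr hrn rfl h.2.1 h.2.2) rfl
    (⟨hb, arm_unexplored (exists_open_arm hr (by omega) h.2.1) rfl hb⟩ : _ ∧ _)
  have h4 := hμ.pr_mono fun ω (h : Blocked a b r (4 * n)
      (reach (FAdj std) (horseshoe a b r (4 * n)) (botMid a b r n) true ω) ω ∧
      Arm a b r (4 * n) (horseshoe a b r (4 * n) \
      reach (FAdj std) (horseshoe a b r (4 * n)) (botMid a b r n) true ω) true ω ∧
      Fenced a b r n (reach (FAdj std) (horseshoe a b r (4 * n)) (botMid a b r n) true ω)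
        true ω) => lastSeparation_of_fenced hr hrn rfl h.1 h.2.1 h.2.2
  have e : 0 ≤ circuitConst ^ 2 := by positivity
  have h5 := ((mul_le_mul_of_nonneg_left h0 e).trans h1).trans h3
  have h6 := ((mul_le_mul_of_nonneg_left h5 e).trans h2).trans h4
  rw [← mul_assoc, ← pow_add] at h6
  exact h6

theorem dep_LastSeparation : Dep (horseshoe a b r (4 * n)) (LastSeparation a b r n) :=
  fun _ _ hω h => ⟨by
      obtain ⟨u, u', h1, h2, h3, h4, h5, h⟩ := h.1
      exact ⟨u, u', h1, h2, h3, h4, h5, conn_congr hω h⟩,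
    fun s hs t ht => h.2 s hs t (conn_congr (fun v hv => (hω v hv).symm) ht)⟩

end

/-- The horizontal translation by `t`. -/
def shift (t : ℤ) (z : Site) : Site := (z.1 + t, z.2)

section
variable {a b r n R t : ℤ} {ω : Config} {S T : Set Site} {μ : Measure Config}

theorem shift_injective : Function.Injective (shift t) := by
  rintro ⟨x, y⟩ ⟨x', y'⟩ h
  simp only [shift, Prod.mk.injEq, add_left_inj] at h
  exact Prod.ext h.1 h.2

theorem shift_neg_shift (z : Site) : shift t (shift (-t) z) = z := by simp [shift]

theorem fadj_shift {u v : Site} : FAdj std (shift t u) (shift t v) ↔ FAdj std u v := by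
  simp only [FAdj, shift, std, reduceCtorEq, and_false, or_false, and_true]
  omega

theorem shift_mem_hBox {z : Site} : shift t z ∈ hBox (a + t) b r ↔ z ∈ hBox a b r := by
  simp only [hBox, shift, Set.mem_ofPred_eq]
  omega

theorem shift_mem_horseshoe {z : Site} :
    shift t z ∈ horseshoe (a + t) b r R ↔ z ∈ horseshoe a b r R :=
  and_congr shift_mem_hBox (not_congr shift_mem_hBox)

theorem shift_mem_hBoxPlus {z : Site} : shift t z ∈ hBoxPlus (a + t) b r ↔ z ∈ hBoxPlus a b r := by
  refine and_congr shift_mem_hBox ?_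
  simp only [shift]
  omega

theorem shift_mem_nearBox {z : Site} : shift t z ∈ nearBox (a + t) b r ↔ z ∈ nearBox a b r := by
  constructor
  · rintro ⟨w, hw, h⟩
    rw [← shift_neg_shift (t := t) w] at hw h
    exact ⟨_, shift_mem_hBox.1 hw, fadj_shift.1 h⟩
  · rintro ⟨w, hw, h⟩
    exact ⟨_, shift_mem_hBox.2 hw, fadj_shift.2 h⟩

theorem Conn.shift {u v : Site} (h : Conn (FAdj std) S u v) (hS : ∀ z ∈ S, _root_.shift t z ∈ T) :
    Conn (FAdj std) T (_root_.shift t u) (_root_.shift t v) :=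
  h.map _ (fun _ _ _ _ h => fadj_shift.2 h) hS

theorem LastSeparation.shift (h : LastSeparation a b r n (ω ∘ _root_.shift t)) :
    LastSeparation (a + t) b r n ω := by
  obtain ⟨⟨u, u', h1, h2, h3, h4, h5, h⟩, h'⟩ := h
  refine ⟨⟨_root_.shift t u, _root_.shift t u', h1, ?_, ?_, h4, ?_,
    h.shift fun z hz => ⟨shift_mem_horseshoe.2 hz.1, hz.2⟩⟩, fun s hs x hx => ?_⟩
  · simp only [_root_.shift]; omega
  · simp only [_root_.shift]; omega
  · simp only [_root_.shift]; omega
  · have := h' (_root_.shift (-t) s) ⟨hs.1, by have := hs.2.1; simp only [_root_.shift]; omega,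
      by have := hs.2.2; simp only [_root_.shift]; omega⟩ (_root_.shift (-t) x) (hx.shift ?_)
    · rw [← shift_mem_nearBox (t := t), ← shift_mem_hBoxPlus (t := t), shift_neg_shift] at this
      refine ⟨this.1, this.2.1, fun h => this.2.2 ⟨h.1, ?_⟩⟩
      simp only [_root_.shift]
      omega
    · intro z hz
      refine ⟨?_, ?_⟩
      · rw [← shift_mem_horseshoe (t := t), shift_neg_shift]
        exact hz.1
      · simp only [Function.comp, shift_neg_shift]
        exact hz.2

theorem IsBernoulliHalf.pr_lastSeparation_le (hμ : IsBernoulliHalf μ) :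
    pr μ (LastSeparation a b r n) ≤ pr μ (LastSeparation (a + t) b r n) := by
  rw [← hμ.pr_comap horseshoe_finite dep_LastSeparation (shift_injective (t := t))]
  exact hμ.pr_mono fun ω h => h.shift

theorem IsBernoulliHalf.pr_lastSeparation (hμ : IsBernoulliHalf μ) (hr : 1 ≤ r) {N : ℕ} : N * pr μ (LastSeparation a b r (8 * r * N)) ≤ 1 := by
  have := hμ.1
  set E : ℕ → Set Config := fun k => {ω | LastSeparation (a + 9 * r * k) b r (8 * r * N) ω} with hE
  have hd : ∀ k l : ℕ, k < l → l < N → Disjoint (E k) (E l) := by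
    intro k l hkl hl
    rw [Set.disjoint_left]
    intro ω h h'
    have e1 : (k : ℤ) + 1 ≤ l := by exact_mod_cast hkl
    have e2 : (l : ℤ) + 1 ≤ N := by exact_mod_cast hl
    have e0 : (0 : ℤ) ≤ k := Int.natCast_nonneg _
    refine LastSeparation.not_shift hr ?_ ?_ h h'
    · nlinarith
    · nlinarith
  have h1 := sum_measureReal_le_measureReal_univ (μ := μ) (s := Finset.range N) (t := E)
    (fun k _ => dep_LastSeparation.measurableSet horseshoe_finite) ?_
  · rw [probReal_univ] at h1
    refine le_trans ?_ h1
    rw [← nsmul_eq_mul, ← Finset.card_range N, ← Finset.sum_const, Finset.card_range]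
    exact Finset.sum_le_sum fun k _ => hμ.pr_lastSeparation_le
  · intro k hk l hl hkl
    rw [Finset.coe_range, Set.mem_Iio] at hk hl
    rcases lt_or_gt_of_ne hkl with h | h
    · exact hd k l h hl
    · exact (hd l k h hk).symm

theorem IsBernoulliHalf.pr_J2_le (hμ : IsBernoulliHalf μ) (hr : 1 ≤ r) (m : ℕ) :
    pr μ (J2 a b r (r * 2 ^ m)) ≤ 32 * (circuitConst ^ 4)⁻¹ * (1 / 2) ^ m := by
  have hK : 0 < circuitConst ^ 4 := by positivity
  rcases lt_or_ge m 5 with hm | hm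
  · have h1 : (1 / 2 : ℝ) ^ 5 ≤ (1 / 2) ^ m :=
      pow_le_pow_of_le_one (by norm_num) (by norm_num) hm.le
    have h2 : 1 ≤ (circuitConst ^ 4)⁻¹ :=
      (one_le_inv₀ hK).2 (pow_le_one₀ (by positivity) (by norm_num [circuitConst]))
    refine hμ.pr_le_one.trans ?_
    nlinarith
  · obtain ⟨k, rfl⟩ := Nat.exists_eq_add_of_le hm
    have h1 := hμ.pr_lastSeparation (a := a) (b := b) hr (N := 2 ^ k)
    have h2 := hμ.pr_J2_le_lastSeparation (a := a) (b := b) (n := 8 * r * (2 ^ k : ℕ)) hr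
      (by have : (1 : ℤ) ≤ (2 ^ k : ℕ) := by exact_mod_cast Nat.one_le_two_pow
          nlinarith)
    have e : 4 * (8 * r * ((2 ^ k : ℕ) : ℤ)) = r * 2 ^ (5 + k) := by push_cast; ring
    rw [e] at h2
    have h3 : ((2 ^ k : ℕ) : ℝ) * (circuitConst ^ 4 * pr μ (J2 a b r (r * 2 ^ (5 + k)))) ≤ 1 :=
      (mul_le_mul_of_nonneg_left h2 (by positivity)).trans h1
    have e2 : 32 * (circuitConst ^ 4)⁻¹ * (1 / 2 : ℝ) ^ (5 + k) =
        1 / (((2 ^ k : ℕ) : ℝ) * circuitConst ^ 4) := by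
      push_cast
      rw [pow_add, one_div_pow, one_div_pow]
      field_simp
      norm_num
    rw [e2, le_div_iff₀ (by positivity)]
    linarith

end

section
variable {a b r R x x' : ℤ} {ω : Config}

theorem bdPos_of_mem_hBoxPlus {s : Site} (hs : s ∈ hBoxPlus a b R) :
    BdPos (a - R) (a + R) b (b + 2 * R) s (a + R + 1 + ccw a b R s) := by
  refine ⟨hs.1, ?_⟩
  have := hs.2
  simp only [ccw]
  split_ifs <;> omega

/-- Disjoint paths from the bottom of a box to its boundary do not exchange their order. -/
theorem ccw_lt_of_disjoint {A B : Set Site} {s s' : Site} (hA : A ⊆ hBox a b R)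
    (hB : B ⊆ hBox a b R) (hAB : Disjoint A B) (hs : s ∈ hBoxPlus a b R)
    (hs' : s' ∈ hBoxPlus a b R) (hx : x < x') (h : Conn (FAdj std) A (x, b) s)
    (h' : Conn (FAdj std) B (x', b) s') : ccw a b R s' < ccw a b R s := by
  by_contra hlt
  have hne : s ≠ s' := fun e => Set.disjoint_left.1 hAB h.right_mem (e ▸ h'.right_mem)
  have hx' := (hB h'.left_mem).2.1
  have hlt' : ccw a b R s < ccw a b R s' ∧ 0 ≤ ccw a b R s := by
    obtain ⟨s1, s2⟩ := s
    obtain ⟨t1, t2⟩ := s'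
    simp only [hBoxPlus, hBox, Set.mem_ofPred_eq, ne_eq, Prod.mk.injEq] at hs hs' hne
    simp only [ccw] at hlt ⊢
    split_ifs at hlt ⊢ <;> omega
  exact rect_crossing hA hB hAB h h' ⟨hA h.left_mem, .inl ⟨rfl, rfl⟩⟩
    ⟨hB h'.left_mem, .inl ⟨rfl, rfl⟩⟩ (bdPos_of_mem_hBoxPlus hs) (bdPos_of_mem_hBoxPlus hs')
    hx (by simp only at hx' ⊢; omega) (by omega)

theorem mem_hBoxPlus_of_fadj {s t : Site} (hs : s ∈ hBox a b r) (ht : t ∉ hBox a b r)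
    (htb : b ≤ t.2) (h : FAdj std s t) : s ∈ hBoxPlus a b r := by
  have := h.abs_le
  refine ⟨hs, ?_⟩
  simp only [hBox, Set.mem_ofPred_eq] at hs ht
  omega

/-- A connection from the inner box to the outer boundary contains an arm of the horseshoe. -/
theorem Conn.exists_horseArm (hR : r ≤ R) {X : Set Site} {v s : Site} (hX : X ⊆ hBox a b R)
    (h : Conn (FAdj std) X v s) (hv : v ∈ hBox a b r) (hs : s ∈ hBoxPlus a b R) :
    ∃ p u, HorseArm a b r R p ∧ (∀ z ∈ p, z ∈ X) ∧ p.head? = some u ∧ p.getLast? = some s := by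
  by_cases hsr : s ∈ hBox a b r
  · have hsr' : s ∈ hBoxPlus a b r := by
      refine ⟨hsr, ?_⟩
      have h1 := hs.2
      simp only [hBox, Set.mem_ofPred_eq] at hsr
      omega
    refine ⟨[s], s, ⟨⟨by simp, by simp, List.isChain_singleton _⟩, ⟨s, hsr', rfl⟩, ⟨s, hs, rfl⟩, by simp⟩,
      ?_, rfl, rfl⟩
    intro z hz
    rw [List.mem_singleton.1 hz]
    exact h.right_mem
  · obtain ⟨u, t, hvu, hu, hut, ht, hts⟩ := h.last_exit hv hsr
    obtain ⟨p, hp, hnd, hch, hpX, hhd, hla⟩ := hts.exists_list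
    have hup : u ∈ hBoxPlus a b r :=
      mem_hBoxPlus_of_fadj hu ht (hX hts.left_mem.1).2.2.1 hut
    obtain ⟨t', l, rfl⟩ := List.exists_cons_of_ne_nil hp
    obtain rfl : t' = t := by simpa using hhd
    have hla' : (u :: t' :: l).getLast? = some s := by
      rw [List.getLast?_cons_cons]; exact hla
    refine ⟨u :: t' :: l, u, ⟨⟨by simp, ?_, ?_⟩, ⟨u, hup, rfl⟩, ⟨s, hs, hla'⟩, ?_⟩, ?_, rfl, hla'⟩
    · exact List.nodup_cons.2 ⟨fun h => (hpX u h).2 hu, hnd⟩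
    · rw [adj_eq_fadj]
      exact List.isChain_cons_cons.2 ⟨hut, hch⟩
    · exact fun z hz => ⟨hX (hpX z hz).1, (hpX z hz).2⟩
    · intro z hz
      rcases List.mem_cons.1 hz with rfl | hz
      exacts [hvu.right_mem, (hpX z hz).1]

/-- A closed and an open connection from adjacent bottom sites within distance `r` of the centre
to the boundary of the box of radius `R`. -/
def BottomPair (a b r R : ℤ) (ω : Config) : Prop :=
  ∃ x, a - r ≤ x ∧ x < a + r ∧ ∃ s ∈ hBoxPlus a b R, ∃ s' ∈ hBoxPlus a b R,
    Conn (FAdj std) {z | z ∈ hBox a b R ∧ ω z = false} (x, b) s ∧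
      Conn (FAdj std) {z | z ∈ hBox a b R ∧ ω z = true} (x + 1, b) s'

theorem BottomPair.j2 (hr : 1 ≤ r) (hR : r ≤ R) (h : BottomPair a b r R ω) : J2 a b r R ω := by
  obtain ⟨x, hx, hx', s, hs, s', hs', hc, hc'⟩ := h
  obtain ⟨q, w, hq, hqX, hqw, hqs⟩ := hc.exists_horseArm hR (fun z hz => hz.1)
    (show (x, b) ∈ hBox a b r by simp only [hBox, Set.mem_ofPred_eq]; omega) hs
  obtain ⟨p, u, hp, hpX, hpu, hps⟩ := hc'.exists_horseArm hR (fun z hz => hz.1)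
    (show (x + 1, b) ∈ hBox a b r by simp only [hBox, Set.mem_ofPred_eq]; omega) hs'
  have hlt : ccw a b R s' < ccw a b R s := by
    refine ccw_lt_of_disjoint (fun z hz => hz.1) (fun z hz => hz.1) ?_ hs hs' (lt_add_one x) hc hc'
    rw [Set.disjoint_left]
    intro z hz hz'
    simpa [hz.2] using hz'.2
  have hpq : List.Disjoint p q := fun z hz hz' => by simpa [(hpX z hz).2] using (hqX z hz').2
  refine ⟨p, q, hp, fun z hz => (hpX z hz).2, hq, fun z hz => (hqX z hz).2, hpq, ?_, ?_⟩
  · intro u₀ w₀ hu₀ hw₀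
    obtain ⟨u₁, hu, u', -, hu₁, hu', hpc, hpH⟩ := hp.exists_conn
    obtain ⟨w₁, hw, w', -, hw₁, hw', hqc, hqH⟩ := hq.exists_conn
    obtain rfl : u₀ = u₁ := Option.some.inj (hu₀.symm.trans hu₁)
    obtain rfl : w₀ = w₁ := Option.some.inj (hw₀.symm.trans hw₁)
    obtain rfl : s' = u' := Option.some.inj (hps.symm.trans hu')
    obtain rfl : s = w' := Option.some.inj (hqs.symm.trans hw')
    by_contra hcon
    have hne : u₀ ≠ w₀ := fun e => hpq hpc.left_mem (e ▸ hqc.left_mem)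
    have hwu : ccw a b r w₀ < ccw a b r u₀ := by
      obtain ⟨u1, u2⟩ := u₀
      obtain ⟨w1, w2⟩ := w₀
      simp only [hBoxPlus, hBox, Set.mem_ofPred_eq, ne_eq, Prod.mk.injEq] at hu hw hne
      simp only [ccw] at hcon ⊢
      split_ifs at hcon ⊢ <;> omega
    obtain ⟨W, U, y, y', hW, hU, hWU, hy, hyw, hyu⟩ := exists_descents hr hw hu hwu
    have hsub : hBox a b r ⊆ hBox a b R := fun z hz => by
      simp only [hBox, Set.mem_ofPred_eq] at hz ⊢
      omega
    have hd : ∀ z, z ∈ hBox a b r → z ∉ horseshoe a b r R := fun z hz hz' => hz'.2 hz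
    refine absurd hlt (not_lt.2 (le_of_lt (ccw_lt_of_disjoint (A := U ∪ {z | z ∈ p})
      (B := W ∪ {z | z ∈ q}) ?_ ?_ ?_ hs' hs hy
      ((hyu.fsymm.mono Set.subset_union_left).trans (hpc.mono Set.subset_union_right))
      ((hyw.fsymm.mono Set.subset_union_left).trans (hqc.mono Set.subset_union_right)))))
    · exact Set.union_subset (hU.trans hsub) fun z hz => (hpX z hz).1
    · exact Set.union_subset (hW.trans hsub) fun z hz => (hqX z hz).1
    · rw [Set.disjoint_left]
      rintro z (hz | hz) (hz' | hz')
      · exact Set.disjoint_left.1 hWU hz' hz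
      · rcases hqH z hz' with rfl | h
        · exact Set.disjoint_left.1 hWU hyw.left_mem hz
        · exact hd z (hU hz) h
      · rcases hpH z hz with rfl | h
        · exact Set.disjoint_left.1 hWU hz' hyu.left_mem
        · exact hd z (hW hz') h
      · exact hpq hz hz'
  · intro u₀ w₀ hu₀ hw₀
    obtain rfl : s' = u₀ := Option.some.inj (hps.symm.trans hu₀)
    obtain rfl : s = w₀ := Option.some.inj (hqs.symm.trans hw₀)
    exact hlt

theorem dep_BottomPair : Dep (hBox a b R) (BottomPair a b r R) :=
  fun _ _ hω ⟨x, h1, h2, s, hs, s', hs', h, h'⟩ =>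
    ⟨x, h1, h2, s, hs, s', hs', conn_congr hω h, conn_congr hω h'⟩

theorem BottomPair.shift {t : ℤ} (h : BottomPair a b r R (ω ∘ _root_.shift t)) :
    BottomPair (a + t) b r R ω := by
  obtain ⟨x, h1, h2, s, hs, s', hs', h, h'⟩ := h
  refine ⟨x + t, by omega, by omega, _, shift_mem_hBoxPlus.2 hs, _, shift_mem_hBoxPlus.2 hs',
    h.shift fun z hz => ⟨shift_mem_hBox.2 hz.1, hz.2⟩, ?_⟩
  rw [add_right_comm]
  exact h'.shift fun z hz => ⟨shift_mem_hBox.2 hz.1, hz.2⟩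

theorem IsBernoulliHalf.pr_bottomPair_le {μ : Measure Config} (hμ : IsBernoulliHalf μ) (a' : ℤ) :
    pr μ (BottomPair a b r R) ≤ pr μ (BottomPair a' b r R) := by
  rw [← hμ.pr_comap hBox_finite dep_BottomPair (shift_injective (t := a' - a))]
  exact hμ.pr_mono fun ω h => by simpa using h.shift

end

/-- The configuration with the left half of the upper boundary of the rectangle of width `9R` and
height `2R + 1` closed and the right half open. -/
def painted (a b R : ℤ) (ω : Config) : Config := fun z =>
  if z.1 = a ∨ (z.2 = b + 2 * R + 1 ∧ z.1 < a + 5 * R) then false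
  else if z.1 = a + 9 * R ∨ z.2 = b + 2 * R + 1 then true else ω z

section
variable {a b r R : ℤ} {ω : Config}

/-- Some adjacent bottom sites are connected to the closed and to the open part of the boundary. -/
theorem exists_painted_pair (hR : 1 ≤ R) : ∃ x,
    Conn (FAdj std) {z | z ∈ rect a (a + 9 * R) b (b + 2 * R + 1) ∧ ¬ painted a b R ω z = true}
      (a, b) (x, b) ∧
    Conn (FAdj std) {z | z ∈ rect a (a + 9 * R) b (b + 2 * R + 1) ∧ painted a b R ω z = true}
      (a + 9 * R, b) (x + 1, b) := by
  set Λ := rect a (a + 9 * R) b (b + 2 * R + 1) with hΛ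
  set κ : Site → Prop := fun z => painted a b R ω z = true with hκ
  set A := clusterOf (FAdj std) Λ κ {(a + 9 * R, b)} with hA
  set B := clusterOf (FAdj std) Λ (fun v => ¬ κ v) {(a, b)} with hB
  have hcl : Clusters (FAdj std) Λ κ A B := clusters_clusterOf _ _ _ _ _
  have hr : ∀ y, b ≤ y → y ≤ b + 2 * R + 1 → (a + 9 * R, y) ∈ A := by
    intro y h1 h2
    refine ⟨_, rfl, conn_vseg h1 fun z hz hz' => ⟨?_, ?_⟩⟩
    · simp only [hΛ, rect, Set.mem_ofPred_eq]; omega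
    · simp only [hκ, painted]
      rw [if_neg (by omega), if_pos (by simp)]
  have hl : ∀ y, b ≤ y → y ≤ b + 2 * R + 1 → (a, y) ∈ B := by
    intro y h1 h2
    refine ⟨_, rfl, conn_vseg h1 fun z hz hz' => ⟨?_, ?_⟩⟩
    · simp only [hΛ, rect, Set.mem_ofPred_eq]; omega
    · simp only [hκ, painted]
      rw [if_pos (by simp)]
      simp
  have htr : ∀ x, a + 5 * R ≤ x → x ≤ a + 9 * R → (x, b + 2 * R + 1) ∈ A := by
    intro x h1 h2
    obtain ⟨s, hs, h⟩ := hr (b + 2 * R + 1) (by omega) le_rfl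
    refine ⟨s, hs, h.trans (Conn.fsymm (conn_hseg h2 fun z hz hz' => ⟨?_, ?_⟩))⟩
    · simp only [hΛ, rect, Set.mem_ofPred_eq]; omega
    · simp only [hκ, painted]
      rw [if_neg (by omega), if_pos (by simp)]
  have htl : ∀ x, a ≤ x → x < a + 5 * R → (x, b + 2 * R + 1) ∈ B := by
    intro x h1 h2
    obtain ⟨s, hs, h⟩ := hl (b + 2 * R + 1) (by omega) le_rfl
    refine ⟨s, hs, h.trans (conn_hseg h1 fun z hz hz' => ⟨?_, ?_⟩)⟩
    · simp only [hΛ, rect, Set.mem_ofPred_eq]; omega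
    · simp only [hκ, painted]
      rw [if_pos (by simp only [true_and]; omega)]
      simp
  have hAB : ∀ z, z ∈ A → z ∉ B := fun z h h' => hcl.colorB z h' (hcl.colorA z h)
  obtain ⟨K, hK⟩ := Int.eq_ofNat_of_zero_le (show 0 ≤ R by omega)
  have st := flux_rect hcl a b (9 * K) (2 * K + 1) (by
    rintro ⟨z1, z2⟩ hz
    simp only [hΛ, rect, Set.mem_ofPred_eq] at *
    push_cast at hz
    omega)
  have e1 : a + ((9 * K : ℕ) : ℤ) = a + 9 * R := by push_cast; omega
  have e2 : b + ((2 * K + 1 : ℕ) : ℤ) = b + 2 * R + 1 := by push_cast; omega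
  have e3 : a + ((5 * K - 1 : ℕ) : ℤ) + 1 = a + 5 * R := by omega
  rw [e1, e2, Finset.sum_eq_zero (s := Finset.range (2 * K + 1)),
    Finset.sum_eq_zero (s := Finset.range (2 * K + 1)),
    Finset.sum_eq_single (s := Finset.range (9 * K)) (a := 5 * K - 1)
      (f := fun i : ℕ => flux A B (a + i, b + 2 * R + 1) (a + i + 1, b + 2 * R + 1))] at st
  · have h1 := htl (a + (5 * K - 1 : ℕ)) (by omega) (by omega)
    have h2 := htr (a + (5 * K - 1 : ℕ) + 1) (by omega) (by omega)
    have h3 : flux A B (a + (5 * K - 1 : ℕ), b + 2 * R + 1)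
        (a + (5 * K - 1 : ℕ) + 1, b + 2 * R + 1) = 1 := by
      simp [flux, h1, h2, hAB _ h2]
    rw [h3] at st
    by_contra hcon
    have h4 : ∑ i ∈ Finset.range (9 * K), flux A B (a + i, b) (a + i + 1, b) ≤ 0 := by
      refine Finset.sum_nonpos fun i _ => ?_
      have : ¬ ((a + (i : ℤ), b) ∈ B ∧ (a + (i : ℤ) + 1, b) ∈ A) := by
        rintro ⟨⟨s, rfl, h⟩, s', rfl, h'⟩
        exact hcon ⟨_, h, h'⟩
      rw [flux, if_neg this]
      split_ifs <;> omega
    omega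
  · intro i hi hne
    have := Finset.mem_range.1 hi
    rcases lt_or_gt_of_ne hne with h | h
    · exact flux_eq_zero_of_notMem_left (fun h' => hAB _ h' (htl _ (by omega) (by omega)))
        (fun h' => hAB _ h' (htl _ (by omega) (by omega)))
    · exact flux_eq_zero_of_notMem_right (hAB _ (htr _ (by omega) (by omega)))
        (hAB _ (htr _ (by omega) (by omega)))
  · intro h
    exact absurd (Finset.mem_range.2 (by omega)) h
  · intro j hj
    have := Finset.mem_range.1 hj
    exact flux_eq_zero_of_notMem_left (fun h' => hAB _ h' (hl _ (by omega) (by omega)))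
        (fun h' => hAB _ h' (hl _ (by omega) (by omega)))
  · intro j hj
    have := Finset.mem_range.1 hj
    exact flux_eq_zero_of_notMem_right (hAB _ (hr _ (by omega) (by omega)))
        (hAB _ (hr _ (by omega) (by omega)))

/-- The two half circuits confine the adjacent bottom sites to the middle of the rectangle. -/
theorem exists_bottomPair (hr : 1 ≤ r) (hR : r ≤ R)
    (hc : HalfCircuit a b (2 * R) fun z => ω z = false)
    (ho : HalfCircuit (a + 9 * R) b (2 * R) fun z => ω z = true) {N : ℤ} (hN : 5 * R ≤ 2 * r * N) :
    ∃ k, 0 ≤ k ∧ k < N ∧ BottomPair (a + 2 * R + r + 2 * r * k) b r R ω := by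
  obtain ⟨x, hx, hx'⟩ := exists_painted_pair (a := a) (b := b) (ω := ω) (show 1 ≤ R by omega)
  have h1 : a + 2 * R ≤ x := by
    obtain ⟨u, v, hu, hu1, -, hv, -, hv2, huv⟩ := hc
    by_contra hlt
    have hd : ∀ z, painted a b R ω z = true → z ∈ halfAnn a b (2 * R) → ω z = true := by
      intro z hz hz'
      simp only [painted] at hz
      simp only [halfAnn, rect, Set.mem_ofPred_eq] at hz'
      split_ifs at hz with g1 g2
      · omega
      · exact hz
    have hdis : Disjoint {z | z ∈ halfAnn a b (2 * R) ∧ ω z = false}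
        {z | z ∈ rect a (a + 9 * R) b (b + 2 * R + 1) ∧ painted a b R ω z = true} := by
      rw [Set.disjoint_left]
      intro z hz hz'
      simpa [hz.2] using hd z hz'.2 hz.1
    have hxr := hx.right_mem.1.1
    rcases lt_or_eq_of_le (show x + 1 ≤ u.1 by omega) with h | h
    · refine halfPlane_crossing (y₀ := b) (fun z hz => hz.1.1.2.2.1) (fun z hz => hz.1.2.2.1) hdis
        huv.fsymm hx'.fsymm hv rfl hu rfl ?_ h ?_
      · simp only at hxr ⊢; omega
      · have := huv.left_mem.1.1.2.1
        simp only; omega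
    · exact Set.disjoint_left.1 hdis huv.left_mem ((Prod.ext h.symm hu : u = (x + 1, b)) ▸
        hx'.right_mem)
  have h2 : x < a + 7 * R := by
    obtain ⟨u, v, hu, hu1, -, hv, -, hv2, huv⟩ := ho
    by_contra hlt
    have hd : ∀ z, ¬ painted a b R ω z = true → z ∈ halfAnn (a + 9 * R) b (2 * R) →
        ω z = false := by
      intro z hz hz'
      simp only [painted] at hz
      simp only [halfAnn, rect, Set.mem_ofPred_eq] at hz'
      split_ifs at hz with g1 g2
      · omega
      · exact absurd rfl hz
      · simpa using hz
    have hdis : Disjoint {z | z ∈ rect a (a + 9 * R) b (b + 2 * R + 1) ∧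
        ¬ painted a b R ω z = true}
        {z | z ∈ halfAnn (a + 9 * R) b (2 * R) ∧ ω z = true} := by
      rw [Set.disjoint_left]
      intro z hz hz'
      simpa [hz'.2] using hd z hz.2 hz'.1
    have hxr := hx'.right_mem.1.2.1
    rcases lt_or_eq_of_le (show v.1 ≤ x by omega) with h | h
    · refine halfPlane_crossing (y₀ := b) (fun z hz => hz.1.2.2.1) (fun z hz => hz.1.1.2.2.1) hdis
        hx huv.fsymm rfl hv rfl hu ?_ h ?_
      · have := huv.right_mem.1.1.1
        simp only; omega
      · simp only at hxr ⊢; omega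
    · exact Set.disjoint_left.1 hdis hx.right_mem ((Prod.ext h hv : v = (x, b)) ▸ huv.right_mem)
  have hk := Int.emod_add_mul_ediv (x - (a + 2 * R)) (2 * r)
  have hk0 := Int.emod_nonneg (x - (a + 2 * R)) (show 2 * r ≠ 0 by omega)
  have hk1 := Int.emod_lt_of_pos (x - (a + 2 * R)) (show 0 < 2 * r by omega)
  set k := (x - (a + 2 * R)) / (2 * r) with hkd
  refine ⟨k, Int.ediv_nonneg (by omega) (by omega), ?_, x, by omega, by omega, ?_⟩
  · by_contra hkN
    have : 2 * r * N ≤ 2 * r * k := mul_le_mul_of_nonneg_left (by omega) (by omega)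
    omega
  set e := a + 2 * R + r + 2 * r * k with he
  have key : ∀ c : Bool, ∀ (v w : Site), Conn (FAdj std)
      {z | z ∈ rect a (a + 9 * R) b (b + 2 * R + 1) ∧ painted a b R ω z = c} v w →
      v ∈ hBox e b R → w ∉ hBox e b R → ∃ s ∈ hBoxPlus e b R,
        Conn (FAdj std) {z | z ∈ hBox e b R ∧ ω z = c} v s := by
    intro c v w h hv hw
    obtain ⟨s, t, hs, hst, ht, ht'⟩ := h.first_exit hv hw
    refine ⟨s, mem_hBoxPlus_of_fadj hs.right_mem.2 ht' ht.1.2.2.1 hst, hs.mono fun z hz => ⟨hz.2, ?_⟩⟩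
    have hzc := hz.1.2
    have hzb := hz.2
    simp only [hBox, Set.mem_ofPred_eq] at hzb
    simp only [painted] at hzc
    rwa [if_neg (by omega), if_neg (by omega)] at hzc
  obtain ⟨s, hs, hsc⟩ := key false (x, b) (a, b) (by simpa using hx.fsymm)
    (by simp only [hBox, Set.mem_ofPred_eq]; omega) (by simp only [hBox, Set.mem_ofPred_eq]; omega)
  obtain ⟨s', hs', hsc'⟩ := key true (x + 1, b) (a + 9 * R, b) hx'.fsymm
    (by simp only [hBox, Set.mem_ofPred_eq]; omega) (by simp only [hBox, Set.mem_ofPred_eq]; omega)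
  exact ⟨s, hs, s', hs', hsc, hsc'⟩

theorem IsBernoulliHalf.le_pr_J2 {μ : Measure Config} (hμ : IsBernoulliHalf μ) (hr : 1 ≤ r)
    (m : ℕ) : circuitConst ^ 2 / 3 * (1 / 2) ^ m ≤ pr μ (J2 a b r (r * 2 ^ m)) := by
  have := hμ.1
  set R := r * 2 ^ m with hRd
  have hm : (1 : ℤ) ≤ 2 ^ m := one_le_pow₀ (by norm_num)
  have hR : r ≤ R := by nlinarith
  have fin : ∀ a' : ℤ, (halfAnn a' b (2 * R)).Finite := fun a' =>
    (rect_finite _ _ _ _).subset fun z hz => hz.1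
  have h1 := hμ.pr_indep (fin a) (fin (a + 9 * R)) (by
      rw [Set.disjoint_left]
      intro z hz hz'
      have := hz.1.2.1
      have := hz'.1.1
      omega) (dep_HalfCircuit (a := a) (b := b) (s := 2 * R) (c := false))
    (dep_HalfCircuit (a := a + 9 * R) (b := b) (s := 2 * R) (c := true))
  have h2 : circuitConst ^ 2 ≤ pr μ (fun ω => HalfCircuit a b (2 * R) (fun z => ω z = false) ∧
      HalfCircuit (a + 9 * R) b (2 * R) (fun z => ω z = true)) := by
    rw [h1, sq]
    exact mul_le_mul (hμ.pr_HalfCircuit (by omega) _ _ _) (hμ.pr_HalfCircuit (by omega) _ _ _)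
      (by positivity) pr_nonneg
  set N : ℕ := 3 * 2 ^ m with hN
  have h3 : pr μ (fun ω => HalfCircuit a b (2 * R) (fun z => ω z = false) ∧
      HalfCircuit (a + 9 * R) b (2 * R) (fun z => ω z = true)) ≤
      ∑ k ∈ Finset.range N, pr μ (BottomPair (a + 2 * R + r + 2 * r * k) b r R) := by
    refine le_trans (measureReal_mono (fun ω h => ?_) (measure_ne_top _ _))
      (measureReal_biUnion_finset_le (Finset.range N)
        fun k : ℕ => {ω | BottomPair (a + 2 * R + r + 2 * r * k) b r R ω})
    obtain ⟨k, hk, hkN, h⟩ := exists_bottomPair hr hR h.1 h.2 (N := N) (by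
      rw [hN, hRd]; push_cast; nlinarith)
    lift k to ℕ using hk
    exact Set.mem_biUnion (x := k) (by simpa using hkN) h
  have h4 : ∑ k ∈ Finset.range N, pr μ (BottomPair (a + 2 * R + r + 2 * r * k) b r R) ≤
      N * pr μ (J2 a b r R) := by
    rw [← nsmul_eq_mul]
    refine (Finset.sum_le_card_nsmul _ _ _ fun k _ => ?_).trans_eq (by rw [Finset.card_range])
    exact (hμ.pr_bottomPair_le a).trans (hμ.pr_mono fun ω h => h.j2 hr hR)
  have h5 := h2.trans (h3.trans h4)
  rw [hN] at h5
  push_cast at h5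
  rw [one_div_pow, mul_one_div, div_div, div_le_iff₀ (by positivity)]
  linarith

end

theorem two_pow_div_two_pow {ρ ν : ℕ} (h : ρ ≤ ν) :
    (2 : ℝ≥0∞) ^ ρ / 2 ^ ν = ENNReal.ofReal ((1 / 2) ^ (ν - ρ)) := by
  have e : (1 / 2 : ℝ) ^ (ν - ρ) = 2 ^ ρ / 2 ^ ν := by
    rw [one_div_pow, pow_sub₀ _ two_ne_zero h]
    simp [div_eq_mul_inv]
  rw [e, ENNReal.ofReal_div_of_pos (by positivity), ENNReal.ofReal_pow (by norm_num),
    ENNReal.ofReal_pow (by norm_num), ENNReal.ofReal_ofNat]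

/-- There exist constants `0 < c ≤ C < ∞` such that for all integers
`0 ≤ ρ ≤ ν` (and every position of the horseshoe pair),
`c·(2^ρ/2^ν) ≤ P(J₂(ρ,ν)) ≤ C·(2^ρ/2^ν)`. -/
theorem statement2 :
    ∃ c C : ℝ≥0∞, 0 < c ∧ c ≤ C ∧ C < ⊤ ∧
      ∀ μ : Measure Config, IsBernoulliHalf μ →
        ∀ a b : ℤ, ∀ ρ ν : ℕ, ρ ≤ ν →
          c * ((2 : ℝ≥0∞) ^ ρ / (2 : ℝ≥0∞) ^ ν) ≤
              μ {ω | J2 a b ((2 : ℤ) ^ ρ) ((2 : ℤ) ^ ν) ω} ∧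
            μ {ω | J2 a b ((2 : ℤ) ^ ρ) ((2 : ℤ) ^ ν) ω} ≤
              C * ((2 : ℝ≥0∞) ^ ρ / (2 : ℝ≥0∞) ^ ν) := by
  refine ⟨ENNReal.ofReal (circuitConst ^ 2 / 3), ENNReal.ofReal (32 * (circuitConst ^ 4)⁻¹),
    ENNReal.ofReal_pos.2 (by positivity), ENNReal.ofReal_le_ofReal ?_, ENNReal.ofReal_lt_top, ?_⟩
  · have h1 : 1 ≤ (circuitConst ^ 4)⁻¹ :=
      (one_le_inv₀ (by positivity)).2 (pow_le_one₀ (by positivity) (by norm_num [circuitConst]))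
    have h2 : circuitConst ^ 2 ≤ 1 := pow_le_one₀ (by positivity) (by norm_num [circuitConst])
    linarith
  · intro μ hμ a b ρ ν h
    have := hμ.1
    have e : (2 : ℤ) ^ ν = 2 ^ ρ * 2 ^ (ν - ρ) := by rw [← pow_add, Nat.add_sub_cancel' h]
    have hr : (1 : ℤ) ≤ 2 ^ ρ := one_le_pow₀ (by norm_num)
    have hp : μ {ω | J2 a b (2 ^ ρ) (2 ^ ρ * 2 ^ (ν - ρ)) ω} =
        ENNReal.ofReal (pr μ (J2 a b (2 ^ ρ) (2 ^ ρ * 2 ^ (ν - ρ)))) :=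
      (ofReal_measureReal (measure_ne_top _ _)).symm
    rw [two_pow_div_two_pow h, e, hp, ← ENNReal.ofReal_mul (by positivity),
      ← ENNReal.ofReal_mul (by positivity)]
    exact ⟨ENNReal.ofReal_le_ofReal (hμ.le_pr_J2 hr _), ENNReal.ofReal_le_ofReal (hμ.pr_J2_le hr _)⟩
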